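/- arXiv:2412.03869 — 5 statements merged into one kernel-verified Lean document; each statement's English description precedes it below -/
import Mathlib

section
/- Every connected finite simple graph of order n and size at most (12n/7) − 3 contains an independent vertex cut S with |S| ≤ 3. -/
open SimpleGraph

/-- `S` is a vertex cut of `G`: a proper subset of the vertex set whose removal
disconnects the graph. -/
def IsVertexCut {V : Type*} [Fintype V] (G : SimpleGraph V) (S : Finset V) : Prop :=
  (S : Set V) ≠ Set.univ ∧ ¬ (G.induce ((S : Set V)ᶜ)).Connected

/-- The connectivity `κ(G)`: the minimum cardinality of a vertex cut of `G`. -/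
noncomputable def graphConnectivity {V : Type*} [Fintype V] (G : SimpleGraph V) : ℕ :=
  sInf {k | ∃ S : Finset V, IsVertexCut G S ∧ S.card = k}


namespace IVC
open Classical

set_option linter.unusedSectionVars false

variable {V : Type*} [Fintype V]

/-- neighbours of `v` inside `W`. -/
noncomputable def nb (G : SimpleGraph V) (W : Finset V) (v : V) : Finset V :=
  W.filter (fun u => G.Adj v u)

theorem mem_nb {G : SimpleGraph V} {W : Finset V} {v u : V} : u ∈ nb G W v ↔ u ∈ W ∧ G.Adj v u := by
  simp [nb]

/-- number of neighbours of `v` inside `W`. -/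
noncomputable def dg (G : SimpleGraph V) (W : Finset V) (v : V) : ℕ := (nb G W v).card

theorem dg_le {G : SimpleGraph V} {W T : Finset V} {v : V}
    (h : ∀ u, u ∈ W → G.Adj v u → u ∈ T) : dg G W v ≤ T.card :=
  Finset.card_le_card fun u hu => h u (mem_nb.1 hu).1 (mem_nb.1 hu).2

theorem le_dg {G : SimpleGraph V} {W T : Finset V} {v : V}
    (h : ∀ u, u ∈ T → u ∈ W ∧ G.Adj v u) : T.card ≤ dg G W v :=
  Finset.card_le_card fun u hu => mem_nb.2 (h u hu)

/-- `S, P, Q` is a partition of `W` with `S` a small independent set separating `P` and `Q`. -/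
structure Sep (G : SimpleGraph V) (W S P Q : Finset V) : Prop where
  cov : ∀ v, v ∈ W ↔ (v ∈ S ∨ v ∈ P ∨ v ∈ Q)
  sp : ∀ v, v ∈ S → v ∉ P
  sq : ∀ v, v ∈ S → v ∉ Q
  pq : ∀ v, v ∈ P → v ∉ Q
  pne : ∃ v, v ∈ P
  qne : ∃ v, v ∈ Q
  nadj : ∀ p q, p ∈ P → q ∈ Q → ¬ G.Adj p q
  indep : ∀ s t, s ∈ S → t ∈ S → ¬ G.Adj s t
  card : S.card ≤ 3

theorem Sep.symm {G : SimpleGraph V} {W S P Q : Finset V} (h : Sep G W S P Q) : Sep G W S Q P where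
  cov v := by have := h.cov v; tauto
  sp := h.sq
  sq := h.sp
  pq v hv hp := h.pq v hp hv
  pne := h.qne
  qne := h.pne
  nadj p q hp hq ha := h.nadj q p hq hp ha.symm
  indep := h.indep
  card := h.card

/-- no small independent cut inside `W`. -/
def NFon (G : SimpleGraph V) (W : Finset V) : Prop := ∀ S P Q, ¬ Sep G W S P Q

theorem dg_sup_le (G F : SimpleGraph V) (W : Finset V) (v : V) :
    dg (G ⊔ F) W v ≤ dg G W v + dg F W v := by
  refine (dg_le (T := nb G W v ∪ nb F W v) ?_).trans (Finset.card_union_le _ _)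
  intro u hu h
  rw [Finset.mem_union, mem_nb, mem_nb]
  rcases h with h | h <;> tauto

theorem dg_mono (G : SimpleGraph V) {W W' : Finset V} (h : W ⊆ W') (v : V) :
    dg G W v ≤ dg G W' v :=
  dg_le fun _ hu ha => mem_nb.2 ⟨h hu, ha⟩

/-- total degree of a graph -/
noncomputable def tot (F : SimpleGraph V) : ℕ := ∑ v, dg F Finset.univ v

theorem tot_sup_le (F F' : SimpleGraph V) : tot (F ⊔ F') ≤ tot F + tot F' := by
  unfold tot
  rw [← Finset.sum_add_distrib]
  exact Finset.sum_le_sum fun v _ => dg_sup_le _ _ _ _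

theorem tot_bot : tot (⊥ : SimpleGraph V) = 0 := by
  simp [tot, dg, nb]

theorem tot_edge_le (a b : V) : tot (edge a b) ≤ 2 := by
  have h : ∀ v, dg (edge a b) Finset.univ v ≤ (if v = a then 1 else 0) + (if v = b then 1 else 0) := by
    intro v
    refine (dg_le (T := (if v = a then {b} else ∅) ∪ (if v = b then {a} else ∅)) ?_).trans
      ((Finset.card_union_le _ _).trans ?_)
    · intro u _
      rw [edge_adj]
      rintro ⟨h, -⟩
      rcases h with ⟨rfl, rfl⟩ | ⟨rfl, rfl⟩ <;> simp
    · gcongr <;> split_ifs <;> simp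
  unfold tot
  refine (Finset.sum_le_sum fun v _ => h v).trans ?_
  rw [Finset.sum_add_distrib]
  simp

theorem dg_split (G : SimpleGraph V) (X : Finset V) (v : V) :
    dg G Finset.univ v = dg G X v + dg G Xᶜ v := by
  unfold dg nb
  rw [← Finset.card_union_of_disjoint]
  · congr 1; ext u; simp; tauto
  · rw [Finset.disjoint_left]; intro u; simp; tauto

theorem dg_double (G : SimpleGraph V) (X Y : Finset V) :
    ∑ v ∈ X, dg G Y v = ∑ v ∈ Y, dg G X v := by
  have h : ∀ (Z : Finset V) v, dg G Z v = ∑ u ∈ Z, if G.Adj v u then 1 else 0 := by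
    intro Z v
    unfold dg nb
    rw [Finset.card_filter]
  simp only [h]
  rw [Finset.sum_comm]
  simp only [G.adj_comm]

/-- minimal counterexample -/
structure MC (G : SimpleGraph V) : Prop where
  nf : NFon G Finset.univ
  min : ∀ (H : SimpleGraph V) (W : Finset V), W.Nonempty → W ≠ Finset.univ → NFon H W →
    24 * W.card ≤ 7 * (∑ v ∈ W, dg H W v) + 34
  low : 7 * (∑ v, dg G Finset.univ v) + 34 < 24 * Fintype.card V

theorem MC.red {G : SimpleGraph V} (hG : MC G) (X : Finset V) (hX : X.Nonempty) (hXu : X ≠ Finset.univ)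
    (F : SimpleGraph V) (q : ℕ) (hF : tot F ≤ 2 * q) (hNF : NFon (G ⊔ F) Xᶜ) :
    ∑ v ∈ X, (7 * dg G Finset.univ v + 7 * dg G Xᶜ v) < 24 * X.card + 14 * q := by
  have h1 := hG.min (G ⊔ F) Xᶜ (by
    rw [Finset.nonempty_iff_ne_empty]; intro h; apply hXu; rwa [Finset.compl_eq_empty_iff] at h)
    (by intro h; rw [Finset.compl_eq_univ_iff] at h; simp [h] at hX) hNF
  have h2 : ∑ v ∈ Xᶜ, dg (G ⊔ F) Xᶜ v ≤ ∑ v ∈ Xᶜ, dg G Xᶜ v + 2 * q := by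
    calc _ ≤ ∑ v ∈ Xᶜ, (dg G Xᶜ v + dg F Xᶜ v) := Finset.sum_le_sum fun v _ => dg_sup_le _ _ _ _
      _ = ∑ v ∈ Xᶜ, dg G Xᶜ v + ∑ v ∈ Xᶜ, dg F Xᶜ v := Finset.sum_add_distrib
      _ ≤ _ := by
        gcongr
        refine le_trans ?_ hF
        unfold tot
        calc _ ≤ ∑ v ∈ Xᶜ, dg F Finset.univ v := Finset.sum_le_sum fun v _ => dg_mono _ (Finset.subset_univ _) _
          _ ≤ _ := Finset.sum_le_sum_of_subset (Finset.subset_univ _)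
  have h3 : ∑ v, dg G Finset.univ v = ∑ v ∈ X, dg G Finset.univ v + ∑ v ∈ Xᶜ, dg G Finset.univ v :=
    (Finset.sum_add_sum_compl X _).symm
  have h4 : ∑ v ∈ Xᶜ, dg G Finset.univ v = ∑ v ∈ X, dg G Xᶜ v + ∑ v ∈ Xᶜ, dg G Xᶜ v := by
    rw [← dg_double G Xᶜ X, ← Finset.sum_add_distrib]
    exact Finset.sum_congr rfl fun v _ => dg_split _ _ _
  have h5 := hG.low
  have h6 : X.card + Xᶜ.card = Fintype.card V := Finset.card_add_card_compl X
  rw [Finset.sum_add_distrib, ← Finset.mul_sum, ← Finset.mul_sum]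
  omega

/-- a set with at most three outside neighbours has adjacent outside neighbours -/
theorem MC.cut {G : SimpleGraph V} (hG : MC G) (X C : Finset V) (hX : X.Nonempty)
    (hN : ∀ x u, x ∈ X → G.Adj x u → u ∈ X ∨ u ∈ C) (hC : C.card ≤ 3)
    (hc : X.card + C.card < Fintype.card V) : ∃ c d, c ∈ C ∧ d ∈ C ∧ G.Adj c d := by
  by_contra! hcon
  have hQ : ∃ v, v ∉ X ∪ C := by
    by_contra! h
    have : X ∪ C = Finset.univ := by ext v; simp only [h v, Finset.mem_univ]
    have h2 := Finset.card_union_le X C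
    rw [this, Finset.card_univ] at h2
    omega
  refine hG.nf (C \ X) X (X ∪ C)ᶜ ⟨?_, ?_, ?_, ?_, hX, ?_, ?_, ?_, ?_⟩
  · intro v; simp; tauto
  · intro v; simp
  · intro v; simp; tauto
  · intro v; simp; tauto
  · obtain ⟨v, hv⟩ := hQ; exact ⟨v, by simpa using hv⟩
  · intro p q hp hq ha
    have := hN p q hp ha
    simp at hq; tauto
  · intro s t hs ht
    simp at hs ht
    exact hcon s t hs.1 ht.1
  · exact (Finset.card_le_card Finset.sdiff_subset).trans hC

theorem MC.clique {G : SimpleGraph V} (hG : MC G) (X C : Finset V) (hX : X.Nonempty)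
    (hN : ∀ x u, x ∈ X → G.Adj x u → u ∈ X ∨ u ∈ C)
    (hXu : X ≠ Finset.univ) (F : SimpleGraph V) (q : ℕ) (hF : tot F ≤ 2 * q)
    (hcl : ∀ c d, c ∈ C → d ∈ C → c ≠ d → (G ⊔ F).Adj c d) :
    ∑ v ∈ X, (7 * dg G Finset.univ v + 7 * dg G Xᶜ v) < 24 * X.card + 14 * q := by
  apply hG.red X hX hXu F q hF
  have key : ∀ S P Q, Sep (G ⊔ F) Xᶜ S P Q → (∀ c, c ∈ C → c ∉ Q) → False := by
    intro S P Q h hQ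
    refine hG.nf S (P ∪ X) Q ⟨?_, ?_, ?_, ?_, ?_, h.qne, ?_, ?_, h.card⟩
    · intro v; have := h.cov v; simp at this ⊢; tauto
    · intro v hv; have := h.cov v; have := h.sp v; simp at *; tauto
    · exact h.sq
    · intro v hv; have := h.cov v; have := h.pq v; simp at *; tauto
    · obtain ⟨v, hv⟩ := h.pne; exact ⟨v, by simp [hv]⟩
    · intro p r hp hr ha
      rcases Finset.mem_union.1 hp with hp | hp
      · exact h.nadj p r hp hr (Or.inl ha)
      · have h1 := hN p r hp ha
        have := h.cov r; have := hQ r; simp at *; tauto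
    · intro s t hs ht ha; exact h.indep s t hs ht (Or.inl ha)
  intro S P Q h
  by_cases h1 : ∀ c, c ∈ C → c ∉ Q
  · exact key S P Q h h1
  by_cases h2 : ∀ c, c ∈ C → c ∉ P
  · exact key S Q P h.symm h2
  push Not at h1 h2
  obtain ⟨c, hc, hcQ⟩ := h1
  obtain ⟨d, hd, hdP⟩ := h2
  have : d ≠ c := by rintro rfl; exact h.pq _ hdP hcQ
  exact h.nadj d c hdP hcQ (hcl d c hd hc this)

/-- three outside neighbours -/
theorem MC.tri3 {G : SimpleGraph V} (hG : MC G) (X : Finset V) (c1 c2 c3 : V) (hX : X.Nonempty)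
    (h1 : c1 ∉ X) (h2 : c2 ∉ X) (h3 : c3 ∉ X)
    (hN : ∀ x u, x ∈ X → G.Adj x u → u ∈ X ∨ u = c1 ∨ u = c2 ∨ u = c3)
    (hc : X.card + 3 < Fintype.card V) :
    ∑ v ∈ X, (7 * dg G Finset.univ v + 7 * dg G Xᶜ v) < 24 * X.card + 28 := by
  have hXu : X ≠ Finset.univ := by rintro rfl; simp at h1
  have hle : ({c1, c2, c3} : Finset V).card ≤ 3 := Finset.card_le_three
  obtain ⟨c, d, hc', hd', hcd⟩ := hG.cut X {c1, c2, c3} hX (by simpa using hN) hle (by omega)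
  have main : ∀ a b e : V, G.Adj a b → ({c1, c2, c3} : Finset V) = {a, b, e} →
     ∑ v ∈ X, (7 * dg G Finset.univ v + 7 * dg G Xᶜ v) < 24 * X.card + 28 := by
    intro a b e hab heq
    refine hG.clique X {c1, c2, c3} hX (by simpa using hN) hXu (edge a e ⊔ edge b e) 2 ?_ ?_
    · have := tot_sup_le (edge a e) (edge b e)
      have := tot_edge_le a e
      have := tot_edge_le b e
      omega
    · rw [heq]
      intro c d hc hd hne
      simp only [Finset.mem_insert, Finset.mem_singleton] at hc hd
      simp only [sup_adj, edge_adj]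
      have := hab.symm
      grind
  simp only [Finset.mem_insert, Finset.mem_singleton] at hc' hd'
  have hne := hcd.ne
  rcases hc' with rfl | rfl | rfl <;> rcases hd' with rfl | rfl | rfl <;> try exact absurd rfl hne
  · exact main _ _ c3 hcd rfl
  · exact main _ _ c2 hcd (by ext; simp; tauto)
  · exact main _ _ c3 hcd (by ext; simp; tauto)
  · exact main _ _ c1 hcd (by ext; simp; tauto)
  · exact main _ _ c2 hcd (by ext; simp; tauto)
  · exact main _ _ c1 hcd (by ext; simp; tauto)

end IVC

namespace IVC
open Classical
set_option linter.unusedSectionVars false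
variable {V : Type*} [Fintype V] {G : SimpleGraph V}

/-- degree -/
noncomputable def de (G : SimpleGraph V) (v : V) : ℕ := dg G Finset.univ v

/-- number of neighbours outside a list -/
noncomputable def ou (G : SimpleGraph V) (l : List V) (v : V) : ℕ := dg G (l.toFinset)ᶜ v

theorem ou1 {l : List V} {v c : V} (h : G.Adj v c) (hc : c ∉ l) : 1 ≤ ou G l v := by
  have := le_dg (G := G) (W := (l.toFinset)ᶜ) (T := {c}) (v := v) (by simp [h, hc])
  rwa [Finset.card_singleton] at this

theorem ou2 {l : List V} {v c d : V} (h : G.Adj v c) (hc : c ∉ l) (h' : G.Adj v d) (hd : d ∉ l)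
    (hcd : c ≠ d) : 2 ≤ ou G l v := by
  have := le_dg (G := G) (W := (l.toFinset)ᶜ) (T := {c, d}) (v := v) (by simp [h, hc, h', hd])
  rwa [Finset.card_pair hcd] at this

theorem ou3 {l : List V} {v c d e : V} (h : G.Adj v c) (hc : c ∉ l) (h' : G.Adj v d) (hd : d ∉ l)
    (h'' : G.Adj v e) (he : e ∉ l)
    (hcd : c ≠ d) (hce : c ≠ e) (hde : d ≠ e) : 3 ≤ ou G l v := by
  have := le_dg (G := G) (W := (l.toFinset)ᶜ) (T := {c, d, e}) (v := v) (by simp [h, hc, h', hd, h'', he])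
  rwa [Finset.card_eq_three.2 ⟨c, d, e, hcd, hce, hde, rfl⟩] at this

theorem sumL (l : List V) (hl : l.Nodup) (f : V → ℕ) : ∑ v ∈ l.toFinset, f v = (l.map f).sum :=
  List.sum_toFinset f hl

theorem MC.redL (hG : MC G) (l : List V) (hl : l.Nodup) (hne : l ≠ [])
    (hlen : l.length < Fintype.card V)
    (F : SimpleGraph V) (q : ℕ) (hF : tot F ≤ 2 * q) (hNF : NFon (G ⊔ F) (l.toFinset)ᶜ) :
    (l.map (fun v => 7 * de G v + 7 * ou G l v)).sum < 24 * l.length + 14 * q := by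
  rw [← sumL l hl, ← List.toFinset_card_of_nodup hl]
  refine hG.red _ (by simpa using hne) ?_ F q hF hNF
  intro h
  have := List.toFinset_card_of_nodup hl
  rw [h, Finset.card_univ] at this
  omega

theorem MC.cutL (hG : MC G) (l : List V) (c1 c2 c3 : V) (hl : l.Nodup) (hne : l ≠ [])
    (hlen : l.length + 3 < Fintype.card V)
    (hN : ∀ x ∈ l, ∀ u, G.Adj x u → u ∈ l ∨ u = c1 ∨ u = c2 ∨ u = c3) :
    G.Adj c1 c2 ∨ G.Adj c1 c3 ∨ G.Adj c2 c3 := by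
  have hle : ({c1, c2, c3} : Finset V).card ≤ 3 := Finset.card_le_three
  obtain ⟨c, d, hc, hd, hcd⟩ := hG.cut l.toFinset {c1, c2, c3} (by simpa using hne) (by intro x u hx hu; have := hN x (by simpa using hx) u hu; simpa using this)
    hle (by rw [List.toFinset_card_of_nodup hl]; omega)
  have := hcd.symm
  have := hcd.ne
  simp only [Finset.mem_insert, Finset.mem_singleton] at hc hd
  grind

theorem MC.cliqueL (hG : MC G) (l : List V) (c1 c2 c3 : V) (hl : l.Nodup) (hne : l ≠ [])
    (hlen : l.length < Fintype.card V)
    (hN : ∀ x ∈ l, ∀ u, G.Adj x u → u ∈ l ∨ u = c1 ∨ u = c2 ∨ u = c3)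
    (h12 : c1 = c2 ∨ G.Adj c1 c2) (h13 : c1 = c3 ∨ G.Adj c1 c3) (h23 : c2 = c3 ∨ G.Adj c2 c3) :
    (l.map (fun v => 7 * de G v + 7 * ou G l v)).sum < 24 * l.length := by
  rw [← sumL l hl, ← List.toFinset_card_of_nodup hl]
  refine hG.clique _ {c1, c2, c3} (by simpa using hne) (by intro x u hx hu; have := hN x (by simpa using hx) u hu; simpa using this) ?_ ⊥ 0 (by simp [tot_bot]) ?_
  · intro h
    have := List.toFinset_card_of_nodup hl
    rw [h, Finset.card_univ] at this
    omega
  · intro c d hc hd hcd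
    have := G.adj_comm c d
    simp only [Finset.mem_insert, Finset.mem_singleton] at hc hd
    simp only [sup_adj, bot_adj]
    grind

theorem MC.tri3L (hG : MC G) (l : List V) (c1 c2 c3 : V) (hl : l.Nodup) (hne : l ≠ [])
    (hlen : l.length + 3 < Fintype.card V)
    (h1 : c1 ∉ l) (h2 : c2 ∉ l) (h3 : c3 ∉ l)
    (hN : ∀ x ∈ l, ∀ u, G.Adj x u → u ∈ l ∨ u = c1 ∨ u = c2 ∨ u = c3) :
    (l.map (fun v => 7 * de G v + 7 * ou G l v)).sum < 24 * l.length + 28 := by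
  rw [← sumL l hl, ← List.toFinset_card_of_nodup hl]
  refine hG.tri3 _ c1 c2 c3 (by simpa using hne) (by simpa using h1) (by simpa using h2)
    (by simpa using h3) (by intro x u hx hu; have := hN x (by simpa using hx) u hu; simpa using this) (by rw [List.toFinset_card_of_nodup hl]; omega)

theorem addP (hG : MC G) {X S P Q : Finset V} {F : SimpleGraph V} (h : Sep (G ⊔ F) Xᶜ S P Q)
    (hQ : ∀ x ∈ X, ∀ u, G.Adj x u → u ∉ Q) : False := by
  refine hG.nf S (P ∪ X) Q ⟨?_, ?_, ?_, ?_, ?_, h.qne, ?_, ?_, h.card⟩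
  · intro v; have := h.cov v; simp at this ⊢; tauto
  · intro v hv; have := h.cov v; have := h.sp v; simp at *; tauto
  · exact h.sq
  · intro v hv; have := h.cov v; have := h.pq v; simp at *; tauto
  · obtain ⟨v, hv⟩ := h.pne; exact ⟨v, by simp [hv]⟩
  · intro p r hp hr ha
    rcases Finset.mem_union.1 hp with hp | hp
    · exact h.nadj p r hp hr (Or.inl ha)
    · exact hQ p hp r ha hr
  · intro s t hs ht ha; exact h.indep s t hs ht (Or.inl ha)

/-! ### neighbourhoods of prescribed size -/

theorem de_eq (T : Finset V) {v : V} (h : ∀ u, G.Adj v u ↔ u ∈ T) : de G v = T.card := by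
  unfold de dg; congr 1; ext u; simp [mem_nb, h]

theorem nb_full {v : V} (T : Finset V) (hT : ∀ u ∈ T, G.Adj v u) (hd : de G v = T.card) :
    ∀ u, G.Adj v u ↔ u ∈ T := by
  have : T = nb G Finset.univ v :=
    Finset.eq_of_subset_of_card_le (fun u hu => mem_nb.2 ⟨Finset.mem_univ _, hT u hu⟩) hd.le
  intro u; rw [this, mem_nb]; simp

theorem nb_one {v : V} (T : Finset V) (hT : ∀ u ∈ T, G.Adj v u) (hd : de G v = T.card + 1) :
    ∃ w, w ∉ T ∧ G.Adj v w ∧ ∀ u, G.Adj v u ↔ u ∈ T ∨ u = w := by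
  have hs : T ⊆ nb G Finset.univ v := fun u hu => mem_nb.2 ⟨Finset.mem_univ _, hT u hu⟩
  have hc : T.card < (nb G Finset.univ v).card := by unfold de dg at hd; omega
  obtain ⟨w, hw, hwT⟩ := Finset.exists_mem_notMem_of_card_lt_card hc
  have hw' := (mem_nb.1 hw).2
  refine ⟨w, hwT, hw', fun u => ?_⟩
  rw [nb_full (insert w T) (by simp; exact ⟨hw', hT⟩) (by rw [Finset.card_insert_of_notMem hwT, hd])]
  simp [or_comm]

theorem nb3 {v x y : V} (hx : G.Adj v x) (hy : G.Adj v y) (hxy : x ≠ y) (hd : de G v = 3) :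
    ∃ t, t ≠ x ∧ t ≠ y ∧ ∀ u, G.Adj v u ↔ u = x ∨ u = y ∨ u = t := by
  obtain ⟨t, ht, -, h⟩ := nb_one (G := G) (v := v) {x, y} (by simp [hx, hy]) (by rw [Finset.card_pair hxy, hd])
  simp at ht
  exact ⟨t, by tauto, by tauto, fun u => by rw [h]; simp; tauto⟩

theorem nb4 {v x y z : V} (hx : G.Adj v x) (hy : G.Adj v y) (hz : G.Adj v z) (hxy : x ≠ y)
    (hxz : x ≠ z) (hyz : y ≠ z) (hd : de G v = 4) :
    ∃ t, t ≠ x ∧ t ≠ y ∧ t ≠ z ∧ ∀ u, G.Adj v u ↔ u = x ∨ u = y ∨ u = z ∨ u = t := by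
  obtain ⟨t, ht, -, h⟩ := nb_one (G := G) (v := v) {x, y, z} (by simp [hx, hy, hz])
    (by rw [Finset.card_eq_three.2 ⟨x, y, z, hxy, hxz, hyz, rfl⟩, hd])
  simp at ht
  exact ⟨t, by tauto, by tauto, by tauto, fun u => by rw [h]; simp; tauto⟩

/-! ### minimum degree -/

theorem MC.deg3 (hG : MC G) (v : V) : 3 ≤ de G v := by
  have hlow := hG.low
  have sum_ge : ∀ k, (∀ v, k ≤ de G v) → k * Fintype.card V ≤ ∑ v, dg G Finset.univ v := by
    intro k hk
    have := Finset.card_nsmul_le_sum Finset.univ (fun v => dg G Finset.univ v) k (fun v _ => hk v)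
    simpa [mul_comm] using this
  have hnb : ∀ (v : V) x u, x ∈ ({v} : Finset V) → G.Adj x u → u ∈ ({v} : Finset V) ∨ u ∈ nb G Finset.univ v := by
    intro v x u hx h
    rw [Finset.mem_singleton] at hx
    subst hx
    exact Or.inr (mem_nb.2 ⟨Finset.mem_univ _, h⟩)
  have h1 : ∀ v, 1 ≤ de G v := by
    intro v
    by_contra! h
    have h0 : (nb G Finset.univ v).card = 0 := by unfold de dg at h; omega
    obtain ⟨c, d, hc, -⟩ := hG.cut {v} (nb G Finset.univ v) (by simp) (hnb v) (by omega) (by simp; omega)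
    rw [Finset.card_eq_zero] at h0
    simp [h0] at hc
  have n1 := sum_ge 1 h1
  have h2 : ∀ v, 2 ≤ de G v := by
    intro v
    by_contra! h
    have h0 : (nb G Finset.univ v).card = 1 := by have := h1 v; unfold de dg at *; omega
    obtain ⟨c, d, hc, hd, hcd⟩ := hG.cut {v} (nb G Finset.univ v) (by simp) (hnb v) (by omega) (by simp; omega)
    obtain ⟨a, ha⟩ := Finset.card_eq_one.1 h0
    simp [ha] at hc hd
    subst hc; subst hd
    exact G.loopless.irrefl _ hcd
  have n2 := sum_ge 2 h2
  by_contra! h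
  have h0 : (nb G Finset.univ v).card = 2 := by have := h2 v; unfold de dg at *; omega
  obtain ⟨c, d, hc, hd, hcd⟩ := hG.cut {v} (nb G Finset.univ v) (by simp) (hnb v) (by omega) (by simp; omega)
  have hc := (mem_nb.1 hc).2
  have hd := (mem_nb.1 hd).2
  have hne := hcd.ne
  have hN := nb_full (v := v) (G := G) {c, d} (by simp [hc, hd]) (by rw [Finset.card_pair hne]; exact h0)
  have h3 := hG.cliqueL [v] c d d (by simp) (by simp) (by simp; omega) (by
    intro x hx u; simp at hx; subst hx; rw [hN]; simp; tauto) (Or.inr hcd) (Or.inr hcd) (Or.inl rfl)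
  have h4 := ou2 (l := [v]) hc (by simpa using hc.ne') hd (by simpa using hd.ne') hne
  have h5 : de G v = 2 := h0
  simp [h5] at h3
  omega

theorem MC.n12 (hG : MC G) : 12 ≤ Fintype.card V := by
  have hlow := hG.low
  have := Finset.card_nsmul_le_sum Finset.univ (fun v => dg G Finset.univ v) 3 (fun v _ => hG.deg3 v)
  simp at this
  omega

theorem MC.D3edge (hG : MC G) {v : V} (hv : de G v = 3) :
    ∃ x y, G.Adj v x ∧ G.Adj v y ∧ G.Adj x y := by
  have := hG.n12
  have h0 : (nb G Finset.univ v).card = 3 := hv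
  obtain ⟨c, d, hc, hd, hcd⟩ := hG.cut {v} (nb G Finset.univ v) (by simp) (by
    intro x u hx h
    rw [Finset.mem_singleton] at hx
    subst hx
    exact Or.inr (mem_nb.2 ⟨Finset.mem_univ _, h⟩)) (by omega) (by simp; omega)
  exact ⟨c, d, (mem_nb.1 hc).2, (mem_nb.1 hd).2, hcd⟩

theorem MC.K (hG : MC G) {v x y t : V} (hN : ∀ u, G.Adj v u ↔ u = x ∨ u = y ∨ u = t)
    (hxy : G.Adj x y) (hxt : x ≠ t) (hyt : y ≠ t) :
    ¬ G.Adj y t ∧ ∃ u, G.Adj x u ∧ u ≠ v ∧ u ≠ y ∧ ¬ G.Adj u y := by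
  by_contra hcon
  have hcon : G.Adj y t ∨ ∀ u, G.Adj x u → u ≠ v → u ≠ y → G.Adj u y := by
    by_contra! h; exact hcon h
  have hne := hxy.ne
  have h3 : de G v = 3 := by
    rw [de_eq {x, y, t} (by simpa using hN)]
    exact Finset.card_eq_three.2 ⟨x, y, t, hne, hxt, hyt, rfl⟩
  have hvx : G.Adj v x := (hN x).2 (by simp)
  have hvy : G.Adj v y := (hN y).2 (by simp)
  have hvt : G.Adj v t := (hN t).2 (by simp)
  have h4 := ou3 (l := [v]) hvx (by simpa using hvx.ne') hvy (by simpa using hvy.ne') hvt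
    (by simpa using hvt.ne') hne hxt hyt
  have hn := hG.n12
  have key := hG.redL [v] (by simp) (by simp) (by simp; omega) (edge x t) 1 (tot_edge_le x t) ?_
  · simp [h3] at key; omega
  simp only [List.toFinset_cons, List.toFinset_nil, insert_empty_eq]
  have Fxt : (G ⊔ edge x t).Adj x t := by simp [edge_adj, hxt]
  have main : ∀ S P Q, Sep (G ⊔ edge x t) {v}ᶜ S P Q → x ∈ S → y ∈ P → t ∈ Q → False := by
    intro S P Q h hx hy ht
    have hcon : ∀ u, G.Adj x u → u ≠ v → u ≠ y → G.Adj u y := by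
      rcases hcon with hc | hc
      · exact absurd (Or.inl hc) (h.nadj y t hy ht)
      · exact hc
    have nadj : ∀ p q, p ∈ P → q ∈ Q → ¬ G.Adj p q := fun p q hp hq ha => h.nadj p q hp hq (Or.inl ha)
    have indep : ∀ p q, p ∈ S → q ∈ S → ¬ G.Adj p q := fun p q hp hq ha => h.indep p q hp hq (Or.inl ha)
    have cov : ∀ u, u ≠ v ↔ (u ∈ S ∨ u ∈ P ∨ u ∈ Q) := fun u => by have := h.cov u; simpa using this
    have sp := h.sp
    have sq := h.sq
    have pq := h.pq
    have sym := fun a b => G.adj_comm a b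
    refine hG.nf (insert v (S.erase x)) (insert x P) Q ⟨?_, ?_, ?_, ?_, ⟨x, by simp⟩, h.qne, ?_, ?_, ?_⟩
    · intro u; simp only [Finset.mem_univ, Finset.mem_insert, Finset.mem_erase, true_iff]; grind
    · intro u; simp only [Finset.mem_insert, Finset.mem_erase]; grind
    · intro u; simp only [Finset.mem_insert, Finset.mem_erase]; grind
    · intro u; simp only [Finset.mem_insert]; grind
    · intro p q; simp only [Finset.mem_insert]; grind
    · intro p q; simp only [Finset.mem_insert, Finset.mem_erase]
      have := G.loopless.irrefl v
      grind
    · have h1 := h.card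
      have h2 := Finset.card_erase_add_one hx
      have := Finset.card_insert_le v (S.erase x)
      omega
  intro S P Q h
  have h' := h.symm
  have e1 := h.nadj x t
  have e2 := h'.nadj x t
  have e3 := h.indep x t
  have e4 := h.nadj x y
  have e5 := h'.nadj x y
  have e6 := h.indep x y
  have Fxy : (G ⊔ edge x t).Adj x y := Or.inl hxy
  have cx := h.cov x
  have cy := h.cov y
  have ct := h.cov t
  have := hvx.ne'
  have := hvy.ne'
  have := hvt.ne'
  have m1 := main S P Q h
  have m2 := main S Q P h'
  have b1 : ¬ (x ∉ Q ∧ y ∉ Q ∧ t ∉ Q) := by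
    intro hh
    refine addP hG h ?_
    intro a ha u hu
    simp at ha
    subst ha
    rw [hN] at hu
    rcases hu with rfl | rfl | rfl
    exacts [hh.1, hh.2.1, hh.2.2]
  have b2 : ¬ (x ∉ P ∧ y ∉ P ∧ t ∉ P) := by
    intro hh
    refine addP hG h' ?_
    intro a ha u hu
    simp at ha
    subst ha
    rw [hN] at hu
    rcases hu with rfl | rfl | rfl
    exacts [hh.1, hh.2.1, hh.2.2]
  have s1 := h.sp x
  have s2 := h.sq x
  have s3 := h.pq x
  have s1 := h.sp y
  have s2 := h.sq y
  have s3 := h.pq y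
  have s1 := h.sp t
  have s2 := h.sq t
  have s3 := h.pq t
  simp only [Finset.mem_compl, Finset.mem_singleton] at cx cy ct
  grind

end IVC

namespace IVC
open Classical
set_option linter.unusedSectionVars false
variable {V : Type*} [Fintype V] {G : SimpleGraph V}

/-- `v` has degree three, neighbours `x, y, t`, the only edge among these being `xy`. -/
structure Tr (G : SimpleGraph V) (v x y t : V) : Prop where
  d3 : de G v = 3
  nbr : ∀ u, G.Adj v u ↔ u = x ∨ u = y ∨ u = t
  xy : G.Adj x y
  xt : ¬ G.Adj x t
  yt : ¬ G.Adj y t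
  nxt : x ≠ t
  nyt : y ≠ t

theorem Tr.symm {v x y t : V} (h : Tr G v x y t) : Tr G v y x t :=
  ⟨h.d3, fun u => by rw [h.nbr]; tauto, h.xy.symm, h.yt, h.xt, h.nyt, h.nxt⟩

theorem Tr.vx {v x y t : V} (h : Tr G v x y t) : G.Adj v x := (h.nbr x).2 (by simp)
theorem Tr.vy {v x y t : V} (h : Tr G v x y t) : G.Adj v y := (h.nbr y).2 (by simp)
theorem Tr.vt {v x y t : V} (h : Tr G v x y t) : G.Adj v t := (h.nbr t).2 (by simp)

theorem MC.tr (hG : MC G) {v x y : V} (hv : de G v = 3) (hx : G.Adj v x) (hy : G.Adj v y)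
    (hxy : G.Adj x y) : ∃ t, Tr G v x y t := by
  obtain ⟨t, htx, hty, hN⟩ := nb3 hx hy hxy.ne hv
  refine ⟨t, hv, hN, hxy, ?_, ?_, htx.symm, hty.symm⟩
  · exact (hG.K (v := v) (x := y) (y := x) (t := t) (fun u => by rw [hN]; tauto) hxy.symm hty.symm htx.symm).1
  · exact (hG.K hN hxy htx.symm hty.symm).1

theorem MC.exTr (hG : MC G) {v : V} (hv : de G v = 3) : ∃ x y t, Tr G v x y t := by
  obtain ⟨x, y, hx, hy, hxy⟩ := hG.D3edge hv
  exact ⟨x, y, hG.tr hv hx hy hxy⟩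

theorem Tr.uniq {v x y t x' y' t' : V} (h : Tr G v x y t) (h' : Tr G v x' y' t') :
    t' = t ∧ ((x' = x ∧ y' = y) ∨ (x' = y ∧ y' = x)) := by
  have h1 := (h.nbr x').1 h'.vx
  have h2 := (h.nbr y').1 h'.vy
  have h3 := (h.nbr t').1 h'.vt
  have h4 := h'.xy
  have h5 := h.xt
  have h6 := h.yt
  have h7 := h'.nxt
  have h8 := h'.nyt
  have h9 := h4.symm
  have h10 := h4.ne
  grind

/-- adjacent degree three vertices `a, b` with common neighbour `z` and outer neighbours `s, t`. -/
structure Pr (G : SimpleGraph V) (a b z s t : V) : Prop where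
  ta : Tr G a b z s
  tb : Tr G b a z t
  st : G.Adj s t
  dz : 4 ≤ de G z

theorem Pr.symm {a b z s t : V} (h : Pr G a b z s t) : Pr G b a z t s :=
  ⟨h.tb, h.ta, h.st.symm, h.dz⟩

theorem MC.pr (hG : MC G) {a b z : V} (ha : de G a = 3) (hb : de G b = 3) (hab : G.Adj a b)
    (haz : G.Adj a z) (hbz : G.Adj b z) : ∃ s t, Pr G a b z s t := by
  obtain ⟨s, hs⟩ := hG.tr ha hab haz hbz
  obtain ⟨t, ht⟩ := hG.tr hb hab.symm hbz haz
  have hn := hG.n12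
  have := hs.xt
  have := hs.yt
  have := ht.xt
  have := ht.yt
  have hst : G.Adj s t := by
    have h := hG.cutL [a, b] z s t (by simp [hab.ne]) (by simp) (by simp; omega) (by
      intro x hx u
      simp only [List.mem_cons, List.not_mem_nil, or_false] at hx ⊢
      rcases hx with rfl | rfl
      · rw [hs.nbr]; tauto
      · rw [ht.nbr]; tauto)
    tauto
  refine ⟨s, t, hs, ht, hst, ?_⟩
  by_contra hz
  have hz : de G z = 3 := by have := hG.deg3 z; omega
  obtain ⟨z', hz'⟩ := hG.tr hz haz.symm hbz.symm hab
  have h1 : G.Adj s z' := by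
    have h := hG.cutL [a, z] b s z' (by simp [haz.ne]) (by simp) (by simp; omega) (by
      intro x hx u
      simp only [List.mem_cons, List.not_mem_nil, or_false] at hx ⊢
      rcases hx with rfl | rfl
      · rw [hs.nbr]; tauto
      · rw [hz'.nbr]; tauto)
    have := hz'.yt
    tauto
  have h2 : G.Adj t z' := by
    have h := hG.cutL [b, z] a t z' (by simp [hbz.ne]) (by simp) (by simp; omega) (by
      intro x hx u
      simp only [List.mem_cons, List.not_mem_nil, or_false] at hx ⊢
      rcases hx with rfl | rfl
      · rw [ht.nbr]; tauto
      · rw [hz'.nbr]; tauto)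
    have := hz'.xt
    tauto
  have key := hG.cliqueL [a, b, z] s t z' (by simp [hab.ne, haz.ne, hbz.ne]) (by simp) (by simp; omega) (by
      intro x hx u
      simp only [List.mem_cons, List.not_mem_nil, or_false] at hx ⊢
      rcases hx with rfl | rfl | rfl
      · rw [hs.nbr]; tauto
      · rw [ht.nbr]; tauto
      · rw [hz'.nbr]; tauto) (Or.inr hst) (Or.inr h1) (Or.inr h2)
  have o1 := ou1 (l := [a, b, z]) hs.vt (by simp [hs.vt.ne', hs.nxt.symm, hs.nyt.symm])
  have o2 := ou1 (l := [a, b, z]) ht.vt (by simp [ht.vt.ne', ht.nxt.symm, ht.nyt.symm])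
  have o3 := ou1 (l := [a, b, z]) hz'.vt (by simp [hz'.vt.ne', hz'.nxt.symm, hz'.nyt.symm])
  simp [ha, hb, hz] at key
  omega

theorem Pr.uniq {a b z s t b' z' s' t' : V} (h : Pr G a b z s t) (h' : Pr G a b' z' s' t') :
    b' = b ∧ z' = z ∧ s' = s ∧ t' = t := by
  have h1 := h.ta.uniq h'.ta
  have h2 := h.dz
  have h3 := h.tb.d3
  have h4 := h'.dz
  have h5 := h'.tb.d3
  have h6 : b' = b ∧ z' = z := by
    rcases h1.2 with h | ⟨rfl, rfl⟩
    · exact h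
    · omega
  obtain ⟨rfl, rfl⟩ := h6
  have h7 := h.tb.uniq h'.tb
  exact ⟨rfl, rfl, h1.1, h7.1⟩

/-- all the adjacency and distinctness facts of a pair -/
theorem Pr.facts {a b z s t : V} (h : Pr G a b z s t) :
    (a ≠ b ∧ a ≠ z ∧ a ≠ s ∧ a ≠ t ∧ b ≠ z ∧ b ≠ s ∧ b ≠ t ∧ z ≠ s ∧ z ≠ t ∧ s ≠ t) ∧
    (¬ G.Adj s z ∧ ¬ G.Adj s b ∧ ¬ G.Adj t z ∧ ¬ G.Adj t a ∧ ¬ G.Adj z s ∧ ¬ G.Adj b s ∧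
      ¬ G.Adj z t ∧ ¬ G.Adj a t) := by
  refine ⟨⟨h.ta.vx.ne, h.ta.vy.ne, h.ta.vt.ne, h.tb.nxt, h.tb.vy.ne, h.ta.nxt, h.tb.vt.ne,
    h.ta.nyt, h.tb.nyt, h.st.ne⟩, ?_⟩
  have h1 := h.ta.xt
  have h2 := h.ta.yt
  have h3 := h.tb.xt
  have h4 := h.tb.yt
  have := G.adj_comm b s
  have := G.adj_comm z s
  have := G.adj_comm a t
  have := G.adj_comm z t
  tauto

set_option maxHeartbeats 2000000 in
theorem MC.O2 (hG : MC G) {a b z s t : V} (h : Pr G a b z s t) (hs : de G s = 3) :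
    ∃ r, Tr G s t r a ∧ 4 ≤ de G r ∧ 5 ≤ de G t := by
  have hn := hG.n12
  have hsa := h.ta.vt.symm
  have hst := h.st
  obtain ⟨⟨n1, n2, n3, n4, n5, n6, n7, n8, n9, n10⟩, e1, e2, e3, e4, e5, e6, e7, e8⟩ := h.facts
  have hna := h.ta.nbr
  have hnb := h.tb.nbr
  obtain ⟨r, hr⟩ : ∃ r, Tr G s t r a := by
    obtain ⟨x, y, w, hx⟩ := hG.exTr hs
    have k1 := (hx.nbr a).1 hsa
    have k2 := (hx.nbr t).1 hst
    have k3 : ∀ u, G.Adj a u → ¬ G.Adj s u := by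
      intro u hu hu'
      rcases (h.ta.nbr u).1 hu with rfl | rfl | rfl
      · exact e2 hu'
      · exact e1 hu'
      · exact G.loopless.irrefl _ hu'
    rcases k1 with rfl | rfl | rfl
    · exact absurd hx.vy (k3 _ hx.xy)
    · exact absurd hx.vx (k3 _ hx.xy.symm)
    · rcases k2 with rfl | rfl | rfl
      · exact ⟨_, hx⟩
      · exact ⟨_, hx.symm⟩
      · exact absurd rfl n4
  have hns := hr.nbr
  have m1 := hr.nyt
  have m2 : r ≠ b := by rintro rfl; exact e2 hr.vy
  have m3 : r ≠ z := by rintro rfl; exact e1 hr.vy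
  have m4 := hr.vy.ne'
  have m5 := hr.xy.ne'
  refine ⟨r, hr, ?_, ?_⟩
  · by_contra hd
    have hd : de G r = 3 := by have := hG.deg3 r; omega
    obtain ⟨a', r', hp⟩ := hG.pr hs hd hr.vy hst hr.xy.symm
    have : a' = a := by
      have := hp.ta.uniq hr
      exact this.1.symm
    subst this
    have hnr := hp.tb.nbr
    have h1 := (hna r').1 hp.st
    have h2 : r' ≠ s := hp.tb.nxt.symm
    have h3 : r' ≠ b := by
      rintro rfl
      have := (hnb r).1 ((G.adj_comm _ _).1 hp.tb.vt)
      tauto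
    have h4 : r' = z := by tauto
    subst h4
    have h := hG.cutL [a', b, s, r] r' t t (by simp; grind) (by simp) (by simp; omega) (by
      intro x hx u
      simp only [List.mem_cons, List.not_mem_nil, or_false] at hx ⊢
      rcases hx with rfl | rfl | rfl | rfl
      · rw [hna]; tauto
      · rw [hnb]; tauto
      · rw [hns]; tauto
      · rw [hnr]; tauto)
    have := G.loopless.irrefl t
    tauto
  · have o1 := ou1 (l := [a, b, s, t]) h.ta.vy (by simp; grind)
    have o2 := ou1 (l := [a, b, s, t]) h.tb.vy (by simp; grind)
    have o3 := ou1 (l := [a, b, s, t]) hr.vy (by simp; grind)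
    have o4 := ou1 (l := [a, b, s, t]) hr.xy (by simp; grind)
    have ha := h.ta.d3
    have hb := h.tb.d3
    by_contra hd
    have hd : de G t = 3 ∨ de G t = 4 := by have := hG.deg3 t; omega
    rcases hd with hd | hd
    · have hnt := nb_full (v := t) (G := G) {b, s, r}
        (by simp [h.tb.vt.symm, hst.symm, hr.xy]) (by
          rw [hd]; symm; rw [Finset.card_eq_three]; exact ⟨b, s, r, n6, m2.symm, m4.symm, rfl⟩)
      simp at hnt
      have hN : ∀ x ∈ [a, b, s, t], ∀ u, G.Adj x u → u ∈ [a, b, s, t] ∨ u = z ∨ u = r ∨ u = r := by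
        intro x hx u
        simp only [List.mem_cons, List.not_mem_nil, or_false] at hx ⊢
        rcases hx with rfl | rfl | rfl | rfl
        · rw [hna]; tauto
        · rw [hnb]; tauto
        · rw [hns]; tauto
        · rw [hnt]; tauto
      have h1 := hG.cutL [a, b, s, t] z r r (by simp; grind) (by simp) (by simp; omega) hN
      have h2 : G.Adj z r := by have := G.loopless.irrefl r; tauto
      have key := hG.cliqueL [a, b, s, t] z r r (by simp; grind) (by simp) (by simp; omega) hN
        (Or.inr h2) (Or.inr h2) (Or.inl rfl)
      simp [ha, hb, hs, hd] at key
      omega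
    · obtain ⟨u, u1, u2, u3, hnt⟩ := nb4 h.tb.vt.symm hst.symm hr.xy n6 m2.symm m4.symm hd
      have htu := (hnt u).2 (by simp)
      have u4 : u ≠ a := by rintro rfl; exact e4 htu
      have key := hG.tri3L [a, b, s, t] z r u (by simp; grind) (by simp) (by simp; omega)
        (by simp; grind) (by simp; grind) (by simp [u1, u2, u4, htu.ne']) (by
        intro x hx u
        simp only [List.mem_cons, List.not_mem_nil, or_false] at hx ⊢
        rcases hx with rfl | rfl | rfl | rfl
        · rw [hna]; tauto
        · rw [hnb]; tauto
        · rw [hns]; tauto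
        · rw [hnt]; tauto)
      have o5 := ou2 (l := [a, b, s, t]) hr.xy (by simp; grind) htu (by simp [u1, u2, u4, htu.ne']) u3.symm
      simp [ha, hb, hs, hd] at key
      omega

end IVC

namespace IVC
open Classical
set_option linter.unusedSectionVars false
variable {V : Type*} [Fintype V] {G : SimpleGraph V}

theorem Sep.sup {F : SimpleGraph V} {W S P Q : Finset V} (h : Sep (G ⊔ F) W S P Q) :
    Sep G W S P Q :=
  ⟨h.cov, h.sp, h.sq, h.pq, h.pne, h.qne, fun p q hp hq ha => h.nadj p q hp hq (Or.inl ha),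
    fun p q hp hq ha => h.indep p q hp hq (Or.inl ha), h.card⟩

/-- a closed link with one pair and two single vertices -/
structure QT (G : SimpleGraph V) (s t a b z v1 v2 w1 w2 : V) : Prop where
  hp : Pr G a b z s t
  h1 : Tr G v1 s t w1
  h2 : Tr G v2 s t w2
  ns : ∀ u, G.Adj s u ↔ u = t ∨ u = v1 ∨ u = v2 ∨ u = a
  nt : ∀ u, G.Adj t u ↔ u = s ∨ u = v1 ∨ u = v2 ∨ u = b
  ds : de G s = 4
  dt : de G t = 4
  v12 : v1 ≠ v2

theorem QT.swap12 {s t a b z v1 v2 w1 w2 : V} (h : QT G s t a b z v1 v2 w1 w2) :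
    QT G s t a b z v2 v1 w2 w1 :=
  ⟨h.hp, h.h2, h.h1, fun u => by rw [h.ns]; tauto, fun u => by rw [h.nt]; tauto, h.ds, h.dt, h.v12.symm⟩

theorem QT.swapst {s t a b z v1 v2 w1 w2 : V} (h : QT G s t a b z v1 v2 w1 w2) :
    QT G t s b a z v2 v1 w2 w1 :=
  ⟨h.hp.symm, h.h2.symm, h.h1.symm, fun u => by rw [h.nt]; tauto, fun u => by rw [h.ns]; tauto,
    h.dt, h.ds, h.v12.symm⟩

theorem QT.facts1 {s t a b z v1 v2 w1 w2 : V} (h : QT G s t a b z v1 v2 w1 w2) :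
    v1 ≠ s ∧ v1 ≠ t ∧ v1 ≠ a ∧ v1 ≠ b ∧ v1 ≠ z ∧ v1 ≠ w1 ∧ v1 ≠ w2 ∧ w1 ≠ s ∧ w1 ≠ t ∧ w1 ≠ a ∧ w1 ≠ b := by
  have hf := h.hp.facts
  have d1 := h.h1.d3
  have dz := h.hp.dz
  have a1 : v1 ≠ a := by rintro rfl; exact hf.2.2.2.2.1 h.h1.vy.symm
  have a2 : v1 ≠ b := by rintro rfl; exact hf.2.2.1 h.h1.vx.symm
  have a3 : v1 ≠ z := by rintro rfl; omega
  refine ⟨h.h1.vx.ne, h.h1.vy.ne, a1, a2, a3, h.h1.vt.ne, ?_, h.h1.nxt.symm, h.h1.nyt.symm, ?_, ?_⟩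
  · rintro rfl; exact h.h2.xt h.h1.vx.symm
  · rintro rfl
    have := (h.hp.ta.nbr v1).1 h.h1.vt.symm
    have := h.h1.vx.ne
    tauto
  · rintro rfl
    have := (h.hp.tb.nbr v1).1 h.h1.vt.symm
    have := h.h1.vy.ne
    tauto

set_option maxHeartbeats 2000000 in
theorem QT.auxA {s t a b z v1 v2 w1 w2 : V} (h : QT G s t a b z v1 v2 w1 w2) (hG : MC G)
    {S P Q : Finset V} (hS : Sep G ([s, t, v1, v2].toFinset)ᶜ S P Q) (ha : a ∈ P) (h2 : w2 ∈ Q)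
    (hb : b ∈ S) (h1 : w1 ∈ S) : False := by
  obtain ⟨⟨n1, n2, n3, n4, n5, n6, n7, n8, n9, n10⟩, -⟩ := h.hp.facts
  obtain ⟨m1, m2, m3, m4, m5, m6, m7, m8, m9, m10, m11⟩ := h.facts1
  obtain ⟨k1, k2, k3, k4, k5, k6, k7, k8, k9, k10, k11⟩ := h.swap12.facts1
  have v12 := h.v12
  have ns := h.ns
  have nt := h.nt
  have nv1 := h.h1.nbr
  have nv2 := h.h2.nbr
  have nb := h.hp.tb.nbr
  have haz := h.hp.ta.vy
  have hbz := h.hp.tb.vy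
  have cov : ∀ u, ¬ (u = s ∨ u = t ∨ u = v1 ∨ u = v2) ↔ (u ∈ S ∨ u ∈ P ∨ u ∈ Q) := fun u => by
    have := hS.cov u
    simpa using this
  have sp := hS.sp
  have sq := hS.sq
  have pq := hS.pq
  have nadj := hS.nadj
  have indep := hS.indep
  have zP : z ∈ P := by
    have := indep b z hb
    have := nadj a z ha
    have := cov z
    tauto
  have sym := fun a b => G.adj_comm a b
  refine hG.nf (insert v2 (S.erase b)) (insert b (insert s (insert t (insert v1 P)))) Q
    ⟨?_, ?_, ?_, ?_, ⟨s, by simp⟩, hS.qne, ?_, ?_, ?_⟩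
  · intro u; simp only [Finset.mem_univ, Finset.mem_insert, Finset.mem_erase, true_iff]
    have := cov u; tauto
  · intro u; simp only [Finset.mem_insert, Finset.mem_erase]
    have := cov u; have := sp u; grind
  · intro u; simp only [Finset.mem_insert, Finset.mem_erase]
    have := cov u; have := sq u; grind
  · intro u; simp only [Finset.mem_insert]
    have := cov u; have := sq u; have := pq u; grind
  · intro p q hp hq
    simp only [Finset.mem_insert] at hp
    have cq := cov q
    have s1 := sq q
    have p1 := pq q
    rcases hp with rfl | rfl | rfl | rfl | hp
    · rw [nb]; grind
    · rw [ns]; grind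
    · rw [nt]; grind
    · rw [nv1]; grind
    · exact nadj p q hp hq
  · have hv : ∀ q, q ∈ insert v2 (S.erase b) → ¬ G.Adj v2 q := by
      intro q hq
      rw [nv2]
      simp only [Finset.mem_insert, Finset.mem_erase] at hq
      have cq := cov q
      have s1 := sq q
      grind
    intro p q hp hq
    simp only [Finset.mem_insert, Finset.mem_erase] at hp
    rcases hp with rfl | hp
    · exact hv q hq
    · have hq' := hq
      simp only [Finset.mem_insert, Finset.mem_erase] at hq'
      rcases hq' with rfl | hq'
      · intro hh
        exact hv p (by simp [hp]) hh.symm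
      · exact indep p q hp.2 hq'.2
  · have h1 := hS.card
    have h2 := Finset.card_erase_add_one hb
    have := Finset.card_insert_le v2 (S.erase b)
    omega

set_option maxHeartbeats 2000000 in
theorem QT.auxB {s t a b z v1 v2 w1 w2 : V} (h : QT G s t a b z v1 v2 w1 w2) (hG : MC G)
    {S P Q : Finset V} (hS : Sep G ([s, t, a, b].toFinset)ᶜ S P Q) (hv1 : v1 ∈ P) (hz : z ∈ Q)
    (hv2 : v2 ∈ S) (h1 : w1 ∈ S) (h2 : w2 ∈ P) : False := by
  obtain ⟨⟨n1, n2, n3, n4, n5, n6, n7, n8, n9, n10⟩, -⟩ := h.hp.facts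
  obtain ⟨m1, m2, m3, m4, m5, m6, m7, m8, m9, m10, m11⟩ := h.facts1
  obtain ⟨k1, k2, k3, k4, k5, k6, k7, k8, k9, k10, k11⟩ := h.swap12.facts1
  have v12 := h.v12
  have ns := h.ns
  have nt := h.nt
  have nv1 := h.h1.nbr
  have na := h.hp.ta.nbr
  have nb := h.hp.tb.nbr
  have cov : ∀ u, ¬ (u = s ∨ u = t ∨ u = a ∨ u = b) ↔ (u ∈ S ∨ u ∈ P ∨ u ∈ Q) := fun u => by
    have := hS.cov u
    simpa using this
  have sp := hS.sp
  have sq := hS.sq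
  have pq := hS.pq
  have nadj := hS.nadj
  have hN : ∀ u, u ∈ P → u ≠ v1 → ∀ y, G.Adj y u → y ≠ s ∧ y ≠ t ∧ y ≠ a ∧ y ≠ b ∧ y ≠ v1 := by
    intro u hu hu1 y hy
    have c := cov u
    have c1 := sp u
    have c2 := pq u
    refine ⟨?_, ?_, ?_, ?_, ?_⟩ <;> rintro rfl
    · rw [ns] at hy; grind
    · rw [nt] at hy; grind
    · rw [na] at hy; grind
    · rw [nb] at hy; grind
    · rw [nv1] at hy; grind
  refine hG.nf S (P.erase v1) (insert v1 (insert s (insert t (insert a (insert b Q)))))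
    ⟨?_, ?_, ?_, ?_, ⟨w2, by simp [h2, m7.symm]⟩, ⟨s, by simp⟩, ?_, hS.indep, hS.card⟩
  · intro u; simp only [Finset.mem_univ, Finset.mem_insert, Finset.mem_erase, true_iff]
    have := cov u; tauto
  · intro u; simp only [Finset.mem_erase]
    have := sp u; tauto
  · intro u; simp only [Finset.mem_insert]
    have := cov u; have := sq u; have := sp u; grind
  · intro u; simp only [Finset.mem_insert, Finset.mem_erase]
    have := cov u; have := pq u; grind
  · intro p q hp hq ha
    simp only [Finset.mem_insert, Finset.mem_erase] at hp hq
    have := hN p hp.2 hp.1 q ha.symm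
    have := nadj p q hp.2
    tauto

set_option maxHeartbeats 2000000 in
theorem QT.caseA {s t a b z v1 v2 w1 w2 : V} (h : QT G s t a b z v1 v2 w1 w2) (hG : MC G)
    (hw : G.Adj w1 w2) : False := by
  obtain ⟨⟨n1, n2, n3, n4, n5, n6, n7, n8, n9, n10⟩, -⟩ := h.hp.facts
  obtain ⟨m1, m2, m3, m4, m5, m6, m7, m8, m9, m10, m11⟩ := h.facts1
  obtain ⟨k1, k2, k3, k4, k5, k6, k7, k8, k9, k10, k11⟩ := h.swap12.facts1
  have v12 := h.v12
  have hn := hG.n12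
  have key := hG.redL [s, t, v1, v2] (by simp; grind) (by simp) (by simp; omega)
    (edge a w1 ⊔ edge b w2) 2 (by
      have := tot_sup_le (edge a w1) (edge b w2)
      have := tot_edge_le a w1
      have := tot_edge_le b w2
      omega) ?_
  · have o1 := ou1 (l := [s, t, v1, v2]) h.hp.ta.vt.symm (by simp; grind)
    have o2 := ou1 (l := [s, t, v1, v2]) h.hp.tb.vt.symm (by simp; grind)
    have o3 := ou1 (l := [s, t, v1, v2]) h.h1.vt (by simp; grind)
    have o4 := ou1 (l := [s, t, v1, v2]) h.h2.vt (by simp; grind)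
    simp [h.ds, h.dt, h.h1.d3, h.h2.d3] at key
    omega
  intro S P Q hS
  have F1 : (G ⊔ (edge a w1 ⊔ edge b w2)).Adj a w1 := by simp [edge_adj, m10.symm]
  have F2 : (G ⊔ (edge a w1 ⊔ edge b w2)).Adj b w2 := by simp [edge_adj, k11.symm]
  have F3 : (G ⊔ (edge a w1 ⊔ edge b w2)).Adj a b := Or.inl h.hp.ta.vx
  have F4 : (G ⊔ (edge a w1 ⊔ edge b w2)).Adj w1 w2 := Or.inl hw
  have B1 : ¬ (a ∉ Q ∧ b ∉ Q ∧ w1 ∉ Q ∧ w2 ∉ Q) := by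
    rintro ⟨q1, q2, q3, q4⟩
    refine addP hG hS ?_
    intro y hy u hu hq
    have := (hS.cov u).2 (by tauto)
    simp at this hy
    rcases hy with rfl | rfl | rfl | rfl
    · rw [h.ns] at hu; clear hS; grind only
    · rw [h.nt] at hu; clear hS; grind only
    · rw [h.h1.nbr] at hu; clear hS; grind only
    · rw [h.h2.nbr] at hu; clear hS; grind only
  have B2 : ¬ (a ∉ P ∧ b ∉ P ∧ w1 ∉ P ∧ w2 ∉ P) := by
    rintro ⟨q1, q2, q3, q4⟩
    refine addP hG hS.symm ?_
    intro y hy u hu hq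
    have := (hS.cov u).2 (by tauto)
    simp at this hy
    rcases hy with rfl | rfl | rfl | rfl
    · rw [h.ns] at hu; clear hS; grind only
    · rw [h.nt] at hu; clear hS; grind only
    · rw [h.h1.nbr] at hu; clear hS; grind only
    · rw [h.h2.nbr] at hu; clear hS; grind only
  have c1 : a ∈ S ∨ a ∈ P ∨ a ∈ Q := (hS.cov a).1 (by simp; grind)
  have c2 : b ∈ S ∨ b ∈ P ∨ b ∈ Q := (hS.cov b).1 (by simp; grind)
  have c3 : w1 ∈ S ∨ w1 ∈ P ∨ w1 ∈ Q := (hS.cov w1).1 (by simp; grind)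
  have c4 : w2 ∈ S ∨ w2 ∈ P ∨ w2 ∈ Q := (hS.cov w2).1 (by simp; grind)
  have ex : ∀ x y, (G ⊔ (edge a w1 ⊔ edge b w2)).Adj x y → ¬ (x ∈ P ∧ y ∈ Q) ∧ ¬ (x ∈ Q ∧ y ∈ P) ∧ ¬ (x ∈ S ∧ y ∈ S) := by
    intro x y hxy
    exact ⟨fun hh => hS.nadj x y hh.1 hh.2 hxy, fun hh => hS.symm.nadj x y hh.1 hh.2 hxy,
      fun hh => hS.indep x y hh.1 hh.2 hxy⟩
  have e1 := ex _ _ F1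
  have e2 := ex _ _ F2
  have e3 := ex _ _ F3
  have e4 := ex _ _ F4
  clear ex F1 F2 F3 F4
  have d1 := hS.pq a
  have d2 := hS.pq b
  have d3 := hS.pq w1
  have d4 := hS.pq w2
  have A1 := fun h1 h2 h3 h4 => h.auxA hG hS.sup h1 h2 h3 h4
  have A2 := fun h1 h2 h3 h4 => h.auxA hG hS.symm.sup h1 h2 h3 h4
  have eqs : [s, t, v1, v2].toFinset = [t, s, v2, v1].toFinset :=
    List.toFinset_eq_of_perm _ _ ((List.Perm.swap _ _ _).trans (((List.Perm.swap _ _ _).cons _).cons _))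
  have A3 := fun h1 h2 h3 h4 => h.swapst.auxA hG (eqs ▸ hS.sup) h1 h2 h3 h4
  have A4 := fun h1 h2 h3 h4 => h.swapst.auxA hG (eqs ▸ hS.symm.sup) h1 h2 h3 h4
  clear eqs n1 n2 n3 n4 n5 n6 n7 n8 n9 n10 m1 m2 m3 m4 m5 m6 m7 m8 m9 m10 m11 k1 k2 k3 k4 k5 k6 k7 k8 k9 k10 k11 hn h hG hS hw
  grind

set_option maxHeartbeats 2000000 in
theorem QT.caseB {s t a b z v1 v2 w1 w2 : V} (h : QT G s t a b z v1 v2 w1 w2) (hG : MC G)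
    (hw : G.Adj z w1) : False := by
  obtain ⟨⟨n1, n2, n3, n4, n5, n6, n7, n8, n9, n10⟩, -⟩ := h.hp.facts
  obtain ⟨m1, m2, m3, m4, m5, m6, m7, m8, m9, m10, m11⟩ := h.facts1
  obtain ⟨k1, k2, k3, k4, k5, k6, k7, k8, k9, k10, k11⟩ := h.swap12.facts1
  have v12 := h.v12
  have hn := hG.n12
  have key := hG.redL [s, t, a, b] (by simp; grind) (by simp) (by simp; omega)
    (edge v1 v2 ⊔ (edge v1 w2 ⊔ edge v2 z)) 3 (by
      have := tot_sup_le (edge v1 v2) (edge v1 w2 ⊔ edge v2 z)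
      have := tot_sup_le (edge v1 w2) (edge v2 z)
      have := tot_edge_le v1 v2
      have := tot_edge_le v1 w2
      have := tot_edge_le v2 z
      omega) ?_
  · have o1 := ou2 (l := [s, t, a, b]) h.h1.vx.symm (by simp; grind) h.h2.vx.symm (by simp; grind) v12
    have o2 := ou2 (l := [s, t, a, b]) h.h1.vy.symm (by simp; grind) h.h2.vy.symm (by simp; grind) v12
    have o3 := ou1 (l := [s, t, a, b]) h.hp.ta.vy (by simp; grind)
    have o4 := ou1 (l := [s, t, a, b]) h.hp.tb.vy (by simp; grind)
    simp [h.ds, h.dt, h.hp.ta.d3, h.hp.tb.d3] at key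
    omega
  intro S P Q hS
  have F1 : (G ⊔ (edge v1 v2 ⊔ (edge v1 w2 ⊔ edge v2 z))).Adj v1 v2 := by simp [edge_adj, v12]
  have F2 : (G ⊔ (edge v1 v2 ⊔ (edge v1 w2 ⊔ edge v2 z))).Adj v1 w2 := by simp [edge_adj, m7]
  have F3 : (G ⊔ (edge v1 v2 ⊔ (edge v1 w2 ⊔ edge v2 z))).Adj v2 z := by simp [edge_adj, k5]
  have F4 : (G ⊔ (edge v1 v2 ⊔ (edge v1 w2 ⊔ edge v2 z))).Adj z w1 := Or.inl hw
  have F5 : (G ⊔ (edge v1 v2 ⊔ (edge v1 w2 ⊔ edge v2 z))).Adj v1 w1 := Or.inl h.h1.vt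
  have F6 : (G ⊔ (edge v1 v2 ⊔ (edge v1 w2 ⊔ edge v2 z))).Adj v2 w2 := Or.inl h.h2.vt
  have B1 : ¬ (v1 ∉ Q ∧ v2 ∉ Q ∧ z ∉ Q) := by
    rintro ⟨q1, q2, q3⟩
    refine addP hG hS ?_
    intro y hy u hu hq
    have := (hS.cov u).2 (by tauto)
    simp at this hy
    rcases hy with rfl | rfl | rfl | rfl
    · rw [h.ns] at hu; clear hS; grind only
    · rw [h.nt] at hu; clear hS; grind only
    · rw [h.hp.ta.nbr] at hu; clear hS; grind only
    · rw [h.hp.tb.nbr] at hu; clear hS; grind only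
  have B2 : ¬ (v1 ∉ P ∧ v2 ∉ P ∧ z ∉ P) := by
    rintro ⟨q1, q2, q3⟩
    refine addP hG hS.symm ?_
    intro y hy u hu hq
    have := (hS.cov u).2 (by tauto)
    simp at this hy
    rcases hy with rfl | rfl | rfl | rfl
    · rw [h.ns] at hu; clear hS; grind only
    · rw [h.nt] at hu; clear hS; grind only
    · rw [h.hp.ta.nbr] at hu; clear hS; grind only
    · rw [h.hp.tb.nbr] at hu; clear hS; grind only
  have c1 : v1 ∈ S ∨ v1 ∈ P ∨ v1 ∈ Q := (hS.cov v1).1 (by simp; grind)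
  have c2 : v2 ∈ S ∨ v2 ∈ P ∨ v2 ∈ Q := (hS.cov v2).1 (by simp; grind)
  have c3 : w1 ∈ S ∨ w1 ∈ P ∨ w1 ∈ Q := (hS.cov w1).1 (by simp; grind)
  have c4 : w2 ∈ S ∨ w2 ∈ P ∨ w2 ∈ Q := (hS.cov w2).1 (by simp; grind)
  have c5 : z ∈ S ∨ z ∈ P ∨ z ∈ Q := (hS.cov z).1 (by simp; grind)
  have ex : ∀ x y, (G ⊔ (edge v1 v2 ⊔ (edge v1 w2 ⊔ edge v2 z))).Adj x y → ¬ (x ∈ P ∧ y ∈ Q) ∧ ¬ (x ∈ Q ∧ y ∈ P) ∧ ¬ (x ∈ S ∧ y ∈ S) := by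
    intro x y hxy
    exact ⟨fun hh => hS.nadj x y hh.1 hh.2 hxy, fun hh => hS.symm.nadj x y hh.1 hh.2 hxy,
      fun hh => hS.indep x y hh.1 hh.2 hxy⟩
  have e1 := ex _ _ F1
  have e2 := ex _ _ F2
  have e3 := ex _ _ F3
  have e4 := ex _ _ F4
  have e5 := ex _ _ F5
  have e6 := ex _ _ F6
  clear ex F1 F2 F3 F4 F5 F6
  have d1 := hS.pq v1
  have d2 := hS.pq v2
  have d3 := hS.pq w1
  have d4 := hS.pq w2
  have d5 := hS.pq z
  have A1 := fun h1 h2 h3 h4 h5 => h.auxB hG hS.sup h1 h2 h3 h4 h5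
  have A2 := fun h1 h2 h3 h4 h5 => h.auxB hG hS.symm.sup h1 h2 h3 h4 h5
  clear n1 n2 n3 n4 n5 n6 n7 n8 n9 n10 m1 m2 m3 m4 m5 m6 m7 m8 m9 m10 m11 k1 k2 k3 k4 k5 k6 k7 k8 k9 k10 k11 hn h hG hS hw
  grind

set_option maxHeartbeats 2000000 in
theorem QT.false {s t a b z v1 v2 w1 w2 : V} (h : QT G s t a b z v1 v2 w1 w2) (hG : MC G) : False := by
  obtain ⟨⟨n1, n2, n3, n4, n5, n6, n7, n8, n9, n10⟩, -⟩ := h.hp.facts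
  obtain ⟨m1, m2, m3, m4, m5, m6, m7, m8, m9, m10, m11⟩ := h.facts1
  obtain ⟨k1, k2, k3, k4, k5, k6, k7, k8, k9, k10, k11⟩ := h.swap12.facts1
  have v12 := h.v12
  have hn := hG.n12
  have := hG.cutL [s, t, v1, v2, a, b] z w1 w2 (by simp; grind) (by simp) (by simp; omega) (by
    intro x hx u
    simp only [List.mem_cons, List.not_mem_nil, or_false] at hx ⊢
    rcases hx with rfl | rfl | rfl | rfl | rfl | rfl
    · rw [h.ns]; tauto
    · rw [h.nt]; tauto
    · rw [h.h1.nbr]; tauto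
    · rw [h.h2.nbr]; tauto
    · rw [h.hp.ta.nbr]; tauto
    · rw [h.hp.tb.nbr]; tauto)
  rcases this with h1 | h1 | h1
  · exact h.caseB hG h1
  · exact h.swap12.caseB hG h1
  · exact h.caseA hG h1

end IVC

namespace IVC
open Classical
set_option linter.unusedSectionVars false
variable {V : Type*} [Fintype V] {G : SimpleGraph V}

theorem prpr {a b z s t a' b' z' : V} (h : Pr G a b z s t) (h' : Pr G a' b' z' s t) (hne : a ≠ a') :
    b ≠ b' ∧ z ≠ a' ∧ z ≠ b' ∧ a ≠ b' ∧ z' ≠ a ∧ z' ≠ b ∧ a' ≠ b := by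
  have f := h.facts
  have f' := h'.facts
  refine ⟨?_, ?_, ?_, ?_, ?_, ?_, ?_⟩
  · rintro rfl
    exact hne (h'.symm.uniq h.symm).1
  · rintro rfl; have := h.dz; have := h'.ta.d3; omega
  · rintro rfl; have := h.dz; have := h'.tb.d3; omega
  · rintro rfl; exact f'.2.2.1 h.ta.vt.symm
  · rintro rfl; have := h'.dz; have := h.ta.d3; omega
  · rintro rfl; have := h'.dz; have := h.tb.d3; omega
  · rintro rfl; exact f.2.2.1 h'.ta.vt.symm

theorem prtr {a b z s t v w : V} (h : Pr G a b z s t) (h1 : Tr G v s t w) :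
    v ≠ a ∧ v ≠ b ∧ v ≠ z ∧ w ≠ a ∧ w ≠ b := by
  have hf := h.facts
  have d1 := h1.d3
  have dz := h.dz
  have a1 : v ≠ a := by rintro rfl; exact hf.2.2.2.2.1 h1.vy.symm
  have a2 : v ≠ b := by rintro rfl; exact hf.2.2.1 h1.vx.symm
  have a3 : v ≠ z := by rintro rfl; omega
  refine ⟨a1, a2, a3, ?_, ?_⟩
  · rintro rfl
    have := (h.ta.nbr v).1 h1.vt.symm
    have := h1.vx.ne
    tauto
  · rintro rfl
    have := (h.tb.nbr v).1 h1.vt.symm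
    have := h1.vy.ne
    tauto

theorem nbf4 {v x y z w : V} (hx : G.Adj v x) (hy : G.Adj v y) (hz : G.Adj v z) (hw : G.Adj v w)
    (h1 : x ≠ y) (h2 : x ≠ z) (h3 : x ≠ w) (h4 : y ≠ z) (h5 : y ≠ w) (h6 : z ≠ w) (hd : de G v = 4) :
    ∀ u, G.Adj v u ↔ u = x ∨ u = y ∨ u = z ∨ u = w := by
  have := nb_full (G := G) (v := v) {x, y, z, w} (by simp [hx, hy, hz, hw]) (by
    rw [hd]; symm; rw [Finset.card_insert_of_notMem (by simp [h1, h2, h3]),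
      Finset.card_insert_of_notMem (by simp [h4, h5]), Finset.card_pair h6])
  simpa using this

set_option maxHeartbeats 2000000 in
theorem MC.PPP (hG : MC G) {x y a1 a2 a3 b1 b2 b3 z1 z2 z3 : V} (h1 : Pr G a1 b1 z1 x y)
    (h2 : Pr G a2 b2 z2 x y) (h3 : Pr G a3 b3 z3 x y) (n12 : a1 ≠ a2) (n13 : a1 ≠ a3) (n23 : a2 ≠ a3)
    (dx : de G x = 4) (dy : de G y = 4) : False := by
  obtain ⟨p1, p2, p3, p4, p5, p6, p7⟩ := prpr h1 h2 n12
  obtain ⟨q1, q2, q3, q4, q5, q6, q7⟩ := prpr h1 h3 n13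
  obtain ⟨r1, r2, r3, r4, r5, r6, r7⟩ := prpr h2 h3 n23
  obtain ⟨⟨f1, f2, f3, f4, f5, f6, f7, f8, f9, f10⟩, -⟩ := h1.facts
  obtain ⟨⟨g1, g2, g3, g4, g5, g6, g7, g8, g9, -⟩, -⟩ := h2.facts
  obtain ⟨⟨i1, i2, i3, i4, i5, i6, i7, i8, i9, -⟩, -⟩ := h3.facts
  have hn := hG.n12
  have nx := nbf4 h1.st h1.ta.vt.symm h2.ta.vt.symm h3.ta.vt.symm f4.symm g4.symm i4.symm n12 n13 n23 dx
  have ny := nbf4 h1.st.symm h1.tb.vt.symm h2.tb.vt.symm h3.tb.vt.symm f6.symm g6.symm i6.symm p1 q1 r1 dy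
  have z1l : z1 ∉ [x, y, a1, b1, a2, b2, a3, b3] := by simp; grind only
  have z2l : z2 ∉ [x, y, a1, b1, a2, b2, a3, b3] := by simp; grind only
  have z3l : z3 ∉ [x, y, a1, b1, a2, b2, a3, b3] := by simp; grind only
  have key := hG.tri3L [x, y, a1, b1, a2, b2, a3, b3] z1 z2 z3 (by simp; grind only) (by simp)
    (by simp; omega) z1l z2l z3l (by
      intro v hv u
      simp only [List.mem_cons, List.not_mem_nil, or_false] at hv ⊢
      rcases hv with rfl | rfl | rfl | rfl | rfl | rfl | rfl | rfl
      · rw [nx]; grind only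
      · rw [ny]; grind only
      · rw [h1.ta.nbr]; grind only
      · rw [h1.tb.nbr]; grind only
      · rw [h2.ta.nbr]; grind only
      · rw [h2.tb.nbr]; grind only
      · rw [h3.ta.nbr]; grind only
      · rw [h3.tb.nbr]; grind only)
  have o1 := ou1 h1.ta.vy z1l
  have o2 := ou1 h1.tb.vy z1l
  have o3 := ou1 h2.ta.vy z2l
  have o4 := ou1 h2.tb.vy z2l
  have o5 := ou1 h3.ta.vy z3l
  have o6 := ou1 h3.tb.vy z3l
  simp [dx, dy, h1.ta.d3, h1.tb.d3, h2.ta.d3, h2.tb.d3, h3.ta.d3, h3.tb.d3] at key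
  omega

set_option maxHeartbeats 2000000 in
theorem MC.PPT (hG : MC G) {x y a1 a2 v b1 b2 z1 z2 w : V} (h1 : Pr G a1 b1 z1 x y)
    (h2 : Pr G a2 b2 z2 x y) (h3 : Tr G v x y w) (n12 : a1 ≠ a2)
    (dx : de G x = 4) (dy : de G y = 4) : False := by
  obtain ⟨p1, p2, p3, p4, p5, p6, p7⟩ := prpr h1 h2 n12
  obtain ⟨q1, q2, q3, q4, q5⟩ := prtr h1 h3
  obtain ⟨r1, r2, r3, r4, r5⟩ := prtr h2 h3
  obtain ⟨⟨f1, f2, f3, f4, f5, f6, f7, f8, f9, f10⟩, -⟩ := h1.facts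
  obtain ⟨⟨g1, g2, g3, g4, g5, g6, g7, g8, g9, -⟩, -⟩ := h2.facts
  have i1 := h3.nxt
  have i2 := h3.nyt
  have i3 := h3.vx.ne
  have i4 := h3.vy.ne
  have i5 := h3.vt.ne
  have hn := hG.n12
  have nx := nbf4 h1.st h1.ta.vt.symm h2.ta.vt.symm h3.vx.symm f4.symm g4.symm i4.symm n12 q1.symm r1.symm dx
  have ny := nbf4 h1.st.symm h1.tb.vt.symm h2.tb.vt.symm h3.vy.symm f6.symm g6.symm i3.symm p1 q2.symm r2.symm dy
  have z1l : z1 ∉ [x, y, a1, b1, a2, b2, v] := by simp; grind only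
  have z2l : z2 ∉ [x, y, a1, b1, a2, b2, v] := by simp; grind only
  have wl : w ∉ [x, y, a1, b1, a2, b2, v] := by simp; grind only
  have key := hG.tri3L [x, y, a1, b1, a2, b2, v] z1 z2 w (by simp; grind only) (by simp)
    (by simp; omega) z1l z2l wl (by
      intro v hv u
      simp only [List.mem_cons, List.not_mem_nil, or_false] at hv ⊢
      rcases hv with rfl | rfl | rfl | rfl | rfl | rfl | rfl
      · rw [nx]; grind only
      · rw [ny]; grind only
      · rw [h1.ta.nbr]; grind only
      · rw [h1.tb.nbr]; grind only
      · rw [h2.ta.nbr]; grind only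
      · rw [h2.tb.nbr]; grind only
      · rw [h3.nbr]; grind only)
  have o1 := ou1 h1.ta.vy z1l
  have o2 := ou1 h1.tb.vy z1l
  have o3 := ou1 h2.ta.vy z2l
  have o4 := ou1 h2.tb.vy z2l
  have o5 := ou1 h3.vt wl
  simp [dx, dy, h1.ta.d3, h1.tb.d3, h2.ta.d3, h2.tb.d3, h3.d3] at key
  omega

theorem MC.PTT (hG : MC G) {x y a b z v1 v2 w1 w2 : V} (h : Pr G a b z x y)
    (h1 : Tr G v1 x y w1) (h2 : Tr G v2 x y w2) (n12 : v1 ≠ v2)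
    (dx : de G x = 4) (dy : de G y = 4) : False := by
  obtain ⟨q1, q2, q3, q4, q5⟩ := prtr h h1
  obtain ⟨r1, r2, r3, r4, r5⟩ := prtr h h2
  obtain ⟨⟨f1, f2, f3, f4, f5, f6, f7, f8, f9, f10⟩, -⟩ := h.facts
  have nx := nbf4 h.st h1.vx.symm h2.vx.symm h.ta.vt.symm h1.vy.ne' h2.vy.ne' f4.symm n12 q1 r1 dx
  have ny := nbf4 h.st.symm h1.vy.symm h2.vy.symm h.tb.vt.symm h1.vx.ne' h2.vx.ne' f6.symm n12 q2 r2 dy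
  exact QT.false ⟨h, h1, h2, nx, ny, dx, dy, n12⟩ hG

theorem MC.TTT (hG : MC G) {x y v1 v2 v3 w1 w2 w3 : V}
    (h1 : Tr G v1 x y w1) (h2 : Tr G v2 x y w2) (h3 : Tr G v3 x y w3)
    (n12 : v1 ≠ v2) (n13 : v1 ≠ v3) (n23 : v2 ≠ v3)
    (dx : de G x = 4) : False := by
  have nx := nbf4 h1.xy h1.vx.symm h2.vx.symm h3.vx.symm h1.vy.ne' h2.vy.ne' h3.vy.ne' n12 n13 n23 dx
  obtain ⟨-, u, hu, u1, u2, u3⟩ := hG.K h1.nbr h1.xy h1.nxt h1.nyt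
  rw [nx] at hu
  rcases hu with rfl | rfl | rfl | rfl
  · exact u2 rfl
  · exact u1 rfl
  · exact u3 h2.vy
  · exact u3 h3.vy

theorem MC.closed (hG : MC G) {x y u1 u2 u3 : V}
    (h1 : (∃ w, Tr G u1 x y w) ∨ (∃ b z, Pr G u1 b z x y))
    (h2 : (∃ w, Tr G u2 x y w) ∨ (∃ b z, Pr G u2 b z x y))
    (h3 : (∃ w, Tr G u3 x y w) ∨ (∃ b z, Pr G u3 b z x y))
    (n12 : u1 ≠ u2) (n13 : u1 ≠ u3) (n23 : u2 ≠ u3)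
    (dx : de G x = 4) (dy : de G y = 4) : False := by
  rcases h1 with ⟨w1, h1⟩ | ⟨b1, z1, h1⟩ <;> rcases h2 with ⟨w2, h2⟩ | ⟨b2, z2, h2⟩ <;>
    rcases h3 with ⟨w3, h3⟩ | ⟨b3, z3, h3⟩
  · exact hG.TTT h1 h2 h3 n12 n13 n23 dx
  · exact hG.PTT h3 h1 h2 n12 dx dy
  · exact hG.PTT h2 h1 h3 n13 dx dy
  · exact hG.PPT h2 h3 h1 n23 dx dy
  · exact hG.PTT h1 h2 h3 n23 dx dy
  · exact hG.PPT h1 h3 h2 n13 dx dy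
  · exact hG.PPT h1 h2 h3 n12 dx dy
  · exact hG.PPP h1 h2 h3 n12 n13 n23 dx dy

set_option maxHeartbeats 2000000 in
/-- two degree-24 clients at a vertex of degree five -/
theorem MC.five (hG : MC G) {x y a1 a2 b1 b2 z1 z2 t1 t2 : V} (h1 : Pr G a1 b1 z1 t1 x)
    (h2 : Pr G a2 b2 z2 t2 x) (k1 : Tr G t1 x y a1) (k2 : Tr G t2 x y a2) (nb : b1 ≠ b2)
    (dx : de G x = 5) (dy : de G y = 4) : False := by
  obtain ⟨⟨f1, f2, f3, f4, f5, f6, f7, f8, f9, f10⟩, e1, e2, e3, e4, e5, e6, e7, e8⟩ := h1.facts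
  obtain ⟨⟨g1, g2, g3, g4, g5, g6, g7, g8, g9, g10⟩, j1, j2, j3, j4, j5, j6, j7, j8⟩ := h2.facts
  have hn := hG.n12
  have na : a1 ≠ a2 := by rintro rfl; exact nb (h2.uniq h1).1
  have nt : t1 ≠ t2 := by
    rintro rfl
    exact na (k2.uniq k1).1
  have d3s : de G a1 = 3 ∧ de G b1 = 3 ∧ de G t1 = 3 ∧ de G a2 = 3 ∧ de G b2 = 3 ∧ de G t2 = 3 :=
    ⟨h1.ta.d3, h1.tb.d3, k1.d3, h2.ta.d3, h2.tb.d3, k2.d3⟩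
  obtain ⟨da1, db1, dt1, da2, db2, dt2⟩ := d3s
  have dz1 := h1.dz
  have dz2 := h2.dz
  have m1 : a1 ≠ b2 := by rintro rfl; exact e8 h2.tb.vt
  have m2 : a2 ≠ b1 := by rintro rfl; exact j8 h1.tb.vt
  have m3 : t1 ≠ a2 := by rintro rfl; exact j8 k1.vx
  have m4 : t2 ≠ a1 := by rintro rfl; exact e8 k2.vx
  have m5 : t1 ≠ b2 := by
    rintro rfl
    have := k1.uniq h2.tb
    have h3 := this.2
    rcases h3 with ⟨rfl, -⟩ | ⟨rfl, rfl⟩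
    · exact g4 rfl
    · omega
  have m6 : t2 ≠ b1 := by
    rintro rfl
    have := k2.uniq h1.tb
    have h3 := this.2
    rcases h3 with ⟨rfl, -⟩ | ⟨rfl, rfl⟩
    · exact f4 rfl
    · omega
  have xne : ∀ u, de G u = 3 → x ≠ u := by rintro u hu rfl; omega
  have yne : ∀ u, de G u = 3 → y ≠ u := by rintro u hu rfl; omega
  have z1ne : ∀ u, de G u = 3 → z1 ≠ u := by rintro u hu rfl; omega
  have z2ne : ∀ u, de G u = 3 → z2 ≠ u := by rintro u hu rfl; omega
  have hxy := k1.xy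
  obtain ⟨u, w1, w2, w3, ny⟩ := nb4 hxy.symm k1.vy.symm k2.vy.symm (xne _ dt1) (xne _ dt2) nt dy
  have hyu := (ny u).2 (by simp)
  have y1 : y ≠ z1 := by rintro rfl; exact e1 k1.vy
  have y2 : y ≠ z2 := by rintro rfl; exact j1 k2.vy
  have ua1 : u ≠ a1 := by rintro rfl; exact k1.yt hyu
  have ua2 : u ≠ a2 := by rintro rfl; exact k2.yt hyu
  have ub1 : u ≠ b1 := by
    rintro rfl
    have := (h1.tb.nbr y).1 hyu.symm
    have := yne _ da1
    have := hxy.ne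
    tauto
  have ub2 : u ≠ b2 := by
    rintro rfl
    have := (h2.tb.nbr y).1 hyu.symm
    have := yne _ da2
    have := hxy.ne
    tauto
  have nx := nb_full (G := G) (v := x) {y, t1, t2, b1, b2}
    (by simp [hxy, k1.vx.symm, k2.vx.symm, h1.tb.vt.symm, h2.tb.vt.symm]) (by
    rw [dx]; symm
    rw [Finset.card_insert_of_notMem (by simp [*]),
      Finset.card_insert_of_notMem (by simp; grind only), Finset.card_insert_of_notMem (by simp; grind only),
      Finset.card_pair nb])
  simp at nx
  have xa1 := xne _ da1
  have xa2 := xne _ da2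
  have xb1 := xne _ db1
  have xb2 := xne _ db2
  have xt1 := xne _ dt1
  have xt2 := xne _ dt2
  have ya1 := yne _ da1
  have ya2 := yne _ da2
  have yb1 := yne _ db1
  have yb2 := yne _ db2
  have yt1 := yne _ dt1
  have yt2 := yne _ dt2
  have nxy := hxy.ne
  have nyu := hyu.ne
  have z1l : z1 ∉ [x, y, t1, t2, a1, b1, a2, b2] := by
    simp only [List.mem_cons, List.not_mem_nil, or_false]
    have := z1ne _ da2
    have := z1ne _ db2
    have := z1ne _ dt2
    clear z1ne z2ne xne yne
    grind only
  have z2l : z2 ∉ [x, y, t1, t2, a1, b1, a2, b2] := by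
    simp only [List.mem_cons, List.not_mem_nil, or_false]
    have := z2ne _ da1
    have := z2ne _ db1
    have := z2ne _ dt1
    clear z1ne z2ne xne yne
    grind only
  clear z1ne z2ne xne yne
  have ul : u ∉ [x, y, t1, t2, a1, b1, a2, b2] := by
    simp only [List.mem_cons, List.not_mem_nil, or_false]
    grind only
  have key := hG.tri3L [x, y, t1, t2, a1, b1, a2, b2] z1 z2 u (by simp; grind only) (by simp)
    (by simp; omega) z1l z2l ul (by
      intro v hv u
      simp only [List.mem_cons, List.not_mem_nil, or_false] at hv ⊢
      rcases hv with rfl | rfl | rfl | rfl | rfl | rfl | rfl | rfl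
      · rw [nx]; grind only
      · rw [ny]; grind only
      · rw [k1.nbr]; grind only
      · rw [k2.nbr]; grind only
      · rw [h1.ta.nbr]; grind only
      · rw [h1.tb.nbr]; grind only
      · rw [h2.ta.nbr]; grind only
      · rw [h2.tb.nbr]; grind only)
  have o1 := ou1 h1.ta.vy z1l
  have o2 := ou1 h1.tb.vy z1l
  have o3 := ou1 h2.ta.vy z2l
  have o4 := ou1 h2.tb.vy z2l
  have o5 := ou1 hyu ul
  simp [dx, dy, da1, da2, db1, db2, dt1, dt2] at key
  omega

end IVC

namespace IVC
open Classical
set_option linter.unusedSectionVars false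
variable {V : Type*} [Fintype V] {G : SimpleGraph V}

/-- weight sent to a degree three vertex in a triangle -/
def w1 (dx dy : ℕ) : ℕ := if dx = 4 ∧ 5 ≤ dy then 8 else if 5 ≤ dx ∧ dy = 4 then 10 else 9

/-- weight sent to the outer end of a pair -/
def w3 (dx dt : ℕ) : ℕ :=
  if dt = 3 then 24 else if dx = 4 ∧ 5 ≤ dt then 8 else if 5 ≤ dx ∧ dt = 4 then 16 else 12

/-- amount given by `x` to `v` -/
noncomputable def give (G : SimpleGraph V) (x v : V) : ℕ :=
  if h : ∃ y t, Tr G v x y t ∧ 4 ≤ de G x ∧ 4 ≤ de G y then w1 (de G x) (de G h.choose)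
  else if ∃ b s t, Pr G v b x s t then 6
  else if h : ∃ t b z, Pr G v b z x t ∧ 4 ≤ de G x then w3 (de G x) (de G h.choose)
  else 0

theorem give_T1 {v x y t : V} (h : Tr G v x y t) (hx : 4 ≤ de G x) (hy : 4 ≤ de G y) :
    give G x v = w1 (de G x) (de G y) := by
  have h' : ∃ y t, Tr G v x y t ∧ 4 ≤ de G x ∧ 4 ≤ de G y := ⟨y, t, h, hx, hy⟩
  rw [give, dif_pos h']
  obtain ⟨t', ht', -⟩ := h'.choose_spec
  have h1 := h.uniq ht'
  have h2 := h.xy.ne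
  have h3 : h'.choose = y := by
    rcases h1.2 with h1 | h1
    · exact h1.2
    · exact absurd h1.1 h2
  rw [h3]

theorem Pr.noT1 {v b z s t : V} (h : Pr G v b z s t) {x : V} :
    ¬ ∃ y t, Tr G v x y t ∧ 4 ≤ de G x ∧ 4 ≤ de G y := by
  rintro ⟨y, t', h', h1, h2⟩
  have h3 := h.ta.uniq h'
  have h4 := h.tb.d3
  rcases h3.2 with ⟨rfl, rfl⟩ | ⟨rfl, rfl⟩ <;> omega

theorem give_T2 {v b x s t : V} (h : Pr G v b x s t) : give G x v = 6 := by
  rw [give, dif_neg h.noT1, if_pos ⟨b, s, t, h⟩]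

theorem give_T3 {v b z x t : V} (h : Pr G v b z x t) (hx : 4 ≤ de G x) :
    give G x v = w3 (de G x) (de G t) := by
  have h' : ∃ t b z, Pr G v b z x t ∧ 4 ≤ de G x := ⟨t, b, z, h, hx⟩
  rw [give, dif_neg h.noT1, if_neg, dif_pos h']
  · obtain ⟨b', z', ht', -⟩ := h'.choose_spec
    have := (h.uniq ht').2.2.2
    rw [this]
  · rintro ⟨b', s', t', h2⟩
    have h3 := h.uniq h2
    have h4 := h.facts
    exact h4.1.2.2.2.2.2.2.2.1 h3.2.1.symm

theorem give_cases (G : SimpleGraph V) (x v : V) :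
    (∃ y t, Tr G v x y t ∧ 4 ≤ de G x ∧ 4 ≤ de G y ∧ give G x v = w1 (de G x) (de G y)) ∨
    (∃ b s t, Pr G v b x s t ∧ give G x v = 6) ∨
    (∃ t b z, Pr G v b z x t ∧ 4 ≤ de G x ∧ give G x v = w3 (de G x) (de G t)) ∨
    give G x v = 0 := by
  by_cases h1 : ∃ y t, Tr G v x y t ∧ 4 ≤ de G x ∧ 4 ≤ de G y
  · obtain ⟨y, t, h, hx, hy⟩ := h1
    exact Or.inl ⟨y, t, h, hx, hy, give_T1 h hx hy⟩
  by_cases h2 : ∃ b s t, Pr G v b x s t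
  · obtain ⟨b, s, t, h⟩ := h2
    exact Or.inr (Or.inl ⟨b, s, t, h, give_T2 h⟩)
  by_cases h3 : ∃ t b z, Pr G v b z x t ∧ 4 ≤ de G x
  · obtain ⟨t, b, z, h, hx⟩ := h3
    exact Or.inr (Or.inr (Or.inl ⟨t, b, z, h, hx, give_T3 h hx⟩))
  · refine Or.inr (Or.inr (Or.inr ?_))
    rw [give, dif_neg h1, if_neg h2, dif_neg h3]

theorem give_ne {x v : V} (h : give G x v ≠ 0) : G.Adj x v ∧ de G v = 3 ∧ 4 ≤ de G x := by
  rcases give_cases G x v with ⟨y, t, h1, h2, h3, -⟩ | ⟨b, s, t, h1, -⟩ | ⟨t, b, z, h1, h2, -⟩ | h0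
  · exact ⟨h1.vx.symm, h1.d3, h2⟩
  · exact ⟨h1.ta.vy.symm, h1.ta.d3, h1.dz⟩
  · exact ⟨h1.ta.vt.symm, h1.ta.d3, h2⟩
  · exact absurd h0 h

theorem give_D4 {x v : V} (h : 4 ≤ de G v) : give G x v = 0 := by
  by_contra h0
  have := (give_ne h0).2.1
  omega

/-- the total given by `x` -/
noncomputable def load (G : SimpleGraph V) (x : V) : ℕ := ∑ v, give G x v

theorem load_eq (T : Finset V) (x : V) (h : ∀ u, G.Adj x u ↔ u ∈ T) : load G x = ∑ v ∈ T, give G x v := by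
  unfold load
  symm
  apply Finset.sum_subset (Finset.subset_univ _)
  intro v _ hv
  by_contra h0
  exact hv ((h v).1 (give_ne h0).1)

/-! ### receipts -/

/-- the total received by `v` -/
noncomputable def rc (G : SimpleGraph V) (v : V) : ℕ := ∑ x, give G x v

theorem rc_two {v x y : V} (h : x ≠ y) : give G x v + give G y v ≤ rc G v := by
  unfold rc
  rw [← Finset.sum_pair (f := fun x => give G x v) h]
  exact Finset.sum_le_sum_of_subset (Finset.subset_univ _)

theorem MC.rcPr (hG : MC G) {a b z s t : V} (h : Pr G a b z s t) : 36 ≤ rc G a + rc G b := by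
  have f := h.facts
  have r1 := rc_two (G := G) (v := a) f.1.2.2.2.2.2.2.2.1
  have r2 := rc_two (G := G) (v := b) f.1.2.2.2.2.2.2.2.2.1
  rw [give_T2 h] at r1
  rw [give_T2 h.symm] at r2
  have ds := hG.deg3 s
  have dt := hG.deg3 t
  by_cases hs : de G s = 3
  · obtain ⟨r, -, -, h5⟩ := hG.O2 h hs
    rw [give_T3 h.symm (by omega)] at r2
    unfold w3 at r2
    rw [if_pos hs] at r2
    omega
  · by_cases ht : de G t = 3
    · obtain ⟨r, -, -, h5⟩ := hG.O2 h.symm ht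
      rw [give_T3 h (by omega)] at r1
      unfold w3 at r1
      rw [if_pos ht] at r1
      omega
    · rw [give_T3 h (by omega)] at r1
      rw [give_T3 h.symm (by omega)] at r2
      unfold w3 at r1 r2
      split_ifs at r1 r2 <;> omega

/-- the partner of a vertex in its pair -/
noncomputable def mate (G : SimpleGraph V) (v : V) : V :=
  if h : ∃ b z s t, Pr G v b z s t then h.choose else v

theorem mate_eq {a b z s t : V} (h : Pr G a b z s t) : mate G a = b := by
  have h' : ∃ b z s t, Pr G a b z s t := ⟨b, z, s, t, h⟩
  rw [mate, dif_pos h']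
  obtain ⟨z', s', t', ht'⟩ := h'.choose_spec
  exact (h.uniq ht').1

theorem mate_mate (v : V) : mate G (mate G v) = v := by
  by_cases h : ∃ b z s t, Pr G v b z s t
  · obtain ⟨b, z, s, t, h⟩ := h
    rw [mate_eq h, mate_eq h.symm]
  · have : mate G v = v := by rw [mate, dif_neg h]
    rw [this, this]

theorem MC.rc_mate (hG : MC G) {v : V} (hv : de G v = 3) : 36 ≤ rc G v + rc G (mate G v) := by
  by_cases h : ∃ b z s t, Pr G v b z s t
  · obtain ⟨b, z, s, t, h⟩ := h
    rw [mate_eq h]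
    exact hG.rcPr h
  · have hm : mate G v = v := by rw [mate, dif_neg h]
    rw [hm]
    obtain ⟨x, y, t, ht⟩ := hG.exTr hv
    have dx : 4 ≤ de G x := by
      by_contra hd
      have hd : de G x = 3 := by have := hG.deg3 x; omega
      obtain ⟨s', t', hp⟩ := hG.pr hv hd ht.vx ht.vy ht.xy
      exact h ⟨_, _, _, _, hp⟩
    have dy : 4 ≤ de G y := by
      by_contra hd
      have hd : de G y = 3 := by have := hG.deg3 y; omega
      obtain ⟨s', t', hp⟩ := hG.pr hv hd ht.vy ht.vx ht.xy.symm
      exact h ⟨_, _, _, _, hp⟩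
    have r := rc_two (G := G) (v := v) ht.xy.ne
    rw [give_T1 ht dx dy, give_T1 ht.symm dy dx] at r
    unfold w1 at r
    split_ifs at r <;> omega

theorem mate_d3 {v : V} (hv : de G v = 3) : de G (mate G v) = 3 := by
  by_cases h : ∃ b z s t, Pr G v b z s t
  · obtain ⟨b, z, s, t, h⟩ := h
    rw [mate_eq h]
    exact h.tb.d3
  · have : mate G v = v := by rw [mate, dif_neg h]
    rw [this, hv]

theorem MC.rc_total (hG : MC G) :
    18 * (Finset.univ.filter (fun v => de G v = 3)).card ≤ ∑ v, rc G v := by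
  have h1 : ∑ v ∈ Finset.univ.filter (fun v => de G v = 3), rc G (mate G v) =
      ∑ v ∈ Finset.univ.filter (fun v => de G v = 3), rc G v := by
    refine Finset.sum_nbij' (mate G) (mate G) ?_ ?_ ?_ ?_ ?_
    · intro v hv; simp at hv ⊢; exact mate_d3 hv
    · intro v hv; simp at hv ⊢; exact mate_d3 hv
    · intro v _; exact mate_mate v
    · intro v _; exact mate_mate v
    · intro v _; rfl
  have h2 := Finset.card_nsmul_le_sum (Finset.univ.filter (fun v => de G v = 3))
    (fun v => rc G v + rc G (mate G v)) 36 (by intro v hv; simp at hv; exact hG.rc_mate hv)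
  rw [Finset.sum_add_distrib, h1] at h2
  have h3 : ∑ v ∈ Finset.univ.filter (fun v => de G v = 3), rc G v ≤ ∑ v, rc G v :=
    Finset.sum_le_sum_of_subset (Finset.subset_univ _)
  simp only [smul_eq_mul] at h2
  omega

/-! ### loads -/

/-- partner lemma: single and outer clients force a neighbour of large degree -/
theorem MC.partner (hG : MC G) {x v : V} (h : 6 < give G x v) : ∃ y, G.Adj x y ∧ 4 ≤ de G y := by
  rcases give_cases G x v with ⟨y, t, h1, h2, h3, -⟩ | ⟨b, s, t, h1, h0⟩ | ⟨t, b, z, h1, h2, -⟩ | h0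
  · exact ⟨y, h1.xy, h3⟩
  · omega
  · by_cases ht : de G t = 3
    · obtain ⟨r, h5, h6, -⟩ := hG.O2 h1.symm ht
      exact ⟨r, h5.xy, h6⟩
    · exact ⟨t, h1.st, by have := hG.deg3 t; omega⟩
  · omega

theorem MC.load_noD4 (hG : MC G) {x : V} (h : ∀ y, G.Adj x y → ¬ 4 ≤ de G y) : load G x ≤ 6 * de G x := by
  rw [load_eq (nb G Finset.univ x) x (by simp [mem_nb])]
  have := Finset.sum_le_card_nsmul (nb G Finset.univ x) (fun v => give G x v) 6 (by
    intro v _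
    by_contra hv
    obtain ⟨y, hy, hy'⟩ := hG.partner (G := G) (x := x) (v := v) (by omega)
    exact h y hy hy')
  simpa [de, dg, mul_comm] using this

/-- classification of clients at a vertex of degree four -/
theorem MC.cl4 (hG : MC G) {x v : V} (dx : de G x = 4) :
    (∃ y, G.Adj x y ∧ 4 ≤ de G y ∧ ((∃ w, Tr G v x y w) ∨ (∃ b z, Pr G v b z x y)) ∧
        give G x v ≤ 12 ∧ (5 ≤ de G y → give G x v = 8)) ∨
    (∃ b s t, Pr G v b x s t ∧ give G x v = 6) ∨ give G x v = 0 := by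
  rcases give_cases G x v with ⟨y, t, h1, h2, h3, hg⟩ | ⟨b, s, t, h1, h0⟩ | ⟨t, b, z, h1, h2, hg⟩ | h0
  · refine Or.inl ⟨y, h1.xy, h3, Or.inl ⟨t, h1⟩, ?_, ?_⟩
    · rw [hg]; unfold w1; split_ifs <;> omega
    · intro h; rw [hg]; unfold w1; rw [if_pos ⟨dx, h⟩]
  · exact Or.inr (Or.inl ⟨b, s, t, h1, h0⟩)
  · have ht : de G t ≠ 3 := by
      intro ht
      obtain ⟨r, h5, h6, h7⟩ := hG.O2 h1.symm ht
      omega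
    refine Or.inl ⟨t, h1.st, by have := hG.deg3 t; omega, Or.inr ⟨b, z, h1⟩, ?_, ?_⟩
    · rw [hg]; unfold w3; split_ifs <;> omega
    · intro h; rw [hg]; unfold w3; rw [if_neg ht, if_pos ⟨dx, h⟩]
  · exact Or.inr (Or.inr h0)

theorem MC.load4 (hG : MC G) {x : V} (dx : de G x = 4) : load G x ≤ 24 := by
  by_cases h : ∀ y, G.Adj x y → ¬ 4 ≤ de G y
  · have := hG.load_noD4 h; omega
  push Not at h
  obtain ⟨y, hxy, dy⟩ := h
  have hc : ((nb G Finset.univ x).erase y).card = 3 := by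
    rw [Finset.card_erase_of_mem (mem_nb.2 ⟨Finset.mem_univ _, hxy⟩)]
    have : (nb G Finset.univ x).card = 4 := dx
    omega
  obtain ⟨u1, u2, u3, n12, n13, n23, hu⟩ := Finset.card_eq_three.1 hc
  have hN : ∀ u, G.Adj x u ↔ u = y ∨ u = u1 ∨ u = u2 ∨ u = u3 := by
    intro u
    have := congrArg (fun T => u ∈ T) hu
    simp [mem_nb] at this
    by_cases huy : u = y
    · subst huy; simp [hxy]
    · simp [huy] at this ⊢; exact this
  have hy : y ≠ u1 ∧ y ≠ u2 ∧ y ≠ u3 := by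
    have := congrArg (fun T => y ∈ T) hu
    simpa using this
  have hl : load G x = give G x u1 + give G x u2 + give G x u3 := by
    rw [load_eq {y, u1, u2, u3} x (by simpa using hN)]
    rw [Finset.sum_insert (by simp [hy]), Finset.sum_insert (by simp [n12, n13]), Finset.sum_pair n23,
      give_D4 dy]
    ring
  have c1 := hG.cl4 (v := u1) dx
  have c2 := hG.cl4 (v := u2) dx
  have c3 := hG.cl4 (v := u3) dx
  have bd : ∀ v, give G x v ≤ 12 := by
    intro v
    rcases hG.cl4 (v := v) dx with ⟨_, _, _, _, h, _⟩ | ⟨_, _, _, _, h⟩ | h <;> omega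
  have b1 := bd u1
  have b2 := bd u2
  have b3 := bd u3
  have t2 : ∀ v, (∃ b s t, Pr G v b x s t ∧ give G x v = 6) →
      ∃ b, b ≠ v ∧ (b = u1 ∨ b = u2 ∨ b = u3) ∧ give G x b = 6 := by
    rintro v ⟨b, s, t, h, -⟩
    refine ⟨b, h.ta.vx.ne', ?_, give_T2 h.symm⟩
    have h1 := (hN b).1 h.tb.vy.symm
    rcases h1 with rfl | h1
    · have := h.tb.d3; omega
    · exact h1
  rw [hl]
  rcases c1 with ⟨y1, a1, d1, e1, -, g1⟩ | c1 | c1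
  swap
  · have hg := c1
    obtain ⟨_, _, _, _, hg⟩ := hg
    obtain ⟨b, hb, h1 | h1 | h1, hb'⟩ := t2 _ c1 <;> subst h1 <;> first | omega | exact absurd rfl hb
  swap
  · omega
  rcases c2 with ⟨y2, a2, d2, e2, -, g2⟩ | c2 | c2
  swap
  · have hg := c2
    obtain ⟨_, _, _, _, hg⟩ := hg
    obtain ⟨b, hb, h1 | h1 | h1, hb'⟩ := t2 _ c2 <;> subst h1 <;> first | omega | exact absurd rfl hb
  swap
  · omega
  rcases c3 with ⟨y3, a3, d3, e3, -, g3⟩ | c3 | c3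
  swap
  · have hg := c3
    obtain ⟨_, _, _, _, hg⟩ := hg
    obtain ⟨b, hb, h1 | h1 | h1, hb'⟩ := t2 _ c3 <;> subst h1 <;> first | omega | exact absurd rfl hb
  swap
  · omega
  have dd : ∀ v y', ((∃ w, Tr G v x y' w) ∨ (∃ b z, Pr G v b z x y')) → de G v = 3 := by
    rintro v y' (⟨w, h⟩ | ⟨b, z, h⟩)
    · exact h.d3
    · exact h.ta.d3
  have q1 := dd _ _ e1
  have q2 := dd _ _ e2
  have q3 := dd _ _ e3
  have yy : ∀ y', G.Adj x y' → 4 ≤ de G y' → y' = y := by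
    intro y' h1 h2
    rcases (hN y').1 h1 with h | rfl | rfl | rfl
    · exact h
    all_goals omega
  obtain rfl := yy _ a1 d1
  obtain rfl := yy _ a2 d2
  obtain rfl := yy _ a3 d3
  by_cases d5 : 5 ≤ de G y3
  · rw [g1 d5, g2 d5, g3 d5]
  · exact (hG.closed e1 e2 e3 n12 n13 n23 dx (by omega)).elim

/-- clients receiving 24 -/
theorem MC.big (hG : MC G) {x v : V} (hx : 5 ≤ de G x) (h : 16 < give G x v) :
    give G x v = 24 ∧ ∃ t a z r, Pr G a v z t x ∧ Tr G t x r a ∧ 4 ≤ de G r ∧ G.Adj x t ∧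
      give G x t = w1 (de G x) (de G r) ∧ G.Adj x r := by
  rcases give_cases G x v with ⟨y, t, h1, h2, h3, hg⟩ | ⟨b, s, t, h1, h0⟩ | ⟨t, b, z, h1, h2, hg⟩ | h0
  · rw [hg] at h; unfold w1 at h; split_ifs at h <;> omega
  · omega
  · have ht : de G t = 3 := by
      by_contra ht
      rw [hg] at h; unfold w3 at h; split_ifs at h <;> omega
    obtain ⟨r, h5, h6, h7⟩ := hG.O2 h1.symm ht
    refine ⟨by rw [hg]; unfold w3; rw [if_pos ht], t, b, z, r, h1.symm, h5, h6, h1.st, ?_, h5.xy⟩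
    exact give_T1 h5 (by omega) h6
  · omega

theorem MC.load5 (hG : MC G) {x : V} (dx : 5 ≤ de G x) : load G x + 144 ≤ 42 * de G x := by
  by_cases h : ∀ y, G.Adj x y → ¬ 4 ≤ de G y
  · have := hG.load_noD4 h; omega
  push Not at h
  obtain ⟨y, hxy, dy⟩ := h
  have hbig := fun v (h : 16 < give G x v) => hG.big (v := v) dx h
  choose! h24 φ α ζ ρ hP hT hr hφ hgφ hρ using hbig
  set N := nb G Finset.univ x with hN
  have cN : N.card = de G x := rfl
  set B := N.filter (fun v => 16 < give G x v) with hB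
  have memB : ∀ v, v ∈ B ↔ 16 < give G x v := by
    intro v
    rw [hB, Finset.mem_filter, hN, mem_nb]
    constructor
    · exact fun h => h.2
    · intro h; exact ⟨⟨Finset.mem_univ _, (give_ne (G := G) (x := x) (v := v) (by omega)).1⟩, h⟩
  have w10 : ∀ a b, w1 a b ≤ 10 := by intro a b; unfold w1; split_ifs <;> omega
  have inj : Set.InjOn φ B := by
    intro v hv v' hv' he
    have h1 := (memB v).1 hv
    have h2 := (memB v').1 hv'
    have h3 := hT v h1
    rw [he] at h3
    have h4 := (h3.uniq (hT v' h2)).1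
    have h5 := hP v h1
    rw [← h4] at h5
    exact ((hP v' h2).uniq h5).1
  have cB' : (B.image φ).card = B.card := Finset.card_image_of_injOn inj
  have hB'N : B.image φ ⊆ N := by
    intro u hu
    obtain ⟨v, hv, rfl⟩ := Finset.mem_image.1 hu
    exact mem_nb.2 ⟨Finset.mem_univ _, hφ v ((memB v).1 hv)⟩
  have hB'g : ∀ u ∈ B.image φ, give G x u ≤ 10 ∧ de G u = 3 := by
    intro u hu
    obtain ⟨v, hv, rfl⟩ := Finset.mem_image.1 hu
    have h1 := (memB v).1 hv
    rw [hgφ v h1]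
    exact ⟨w10 _ _, (hT v h1).d3⟩
  have hyN : y ∈ N := mem_nb.2 ⟨Finset.mem_univ _, hxy⟩
  have gy := give_D4 (G := G) (x := x) dy
  have hBN : B ⊆ N := Finset.filter_subset _ _
  have disj : Disjoint B (B.image φ) := by
    rw [Finset.disjoint_left]
    intro u hu hu'
    have := (memB u).1 hu
    have := (hB'g u hu').1
    omega
  have hcard : 2 * B.card + 1 ≤ N.card := by
    have h1 : y ∉ B ∪ B.image φ := by
      rw [Finset.mem_union]
      rintro (h | h)
      · have := (memB y).1 h; omega
      · have := (hB'g y h).2; omega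
    have h2 : insert y (B ∪ B.image φ) ⊆ N :=
      Finset.insert_subset hyN (Finset.union_subset hBN hB'N)
    have h3 := Finset.card_le_card h2
    rw [Finset.card_insert_of_notMem h1, Finset.card_union_of_disjoint disj, cB'] at h3
    omega
  have hload : load G x = ∑ v ∈ N, give G x v := load_eq N x (by simp [hN, mem_nb])
  have hsum : load G x + 6 * B.card + 16 ≤ 16 * N.card + 8 * B.card := by
    have h1 : ∀ v ∈ N, give G x v + (if v ∈ B.image φ then 6 else 0) + (if v = y then 16 else 0) ≤
        16 + (if v ∈ B then 8 else 0) := by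
      intro v hv
      by_cases hvy : v = y
      · subst hvy
        have : v ∉ B.image φ := by intro h; have := (hB'g v h).2; omega
        simp [this, gy]
      · by_cases hv' : v ∈ B.image φ
        · have := (hB'g v hv').1
          simp [hv', hvy]; omega
        · by_cases hvB : v ∈ B
          · have := h24 v ((memB v).1 hvB)
            simp [hv', hvy, hvB]; omega
          · have : ¬ 16 < give G x v := fun h => hvB ((memB v).2 h)
            simp [hv', hvy, hvB]; omega
    have h2 := Finset.sum_le_sum h1
    rw [Finset.sum_add_distrib, Finset.sum_add_distrib, Finset.sum_add_distrib, ← hload] at h2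
    have e1 : ∑ v ∈ N, (if v ∈ B.image φ then 6 else 0) = 6 * B.card := by
      rw [← Finset.sum_filter, Finset.filter_mem_eq_inter, Finset.inter_eq_right.2 hB'N]
      simp [cB', mul_comm]
    have e2 : ∑ v ∈ N, (if v ∈ B then 8 else 0) = 8 * B.card := by
      rw [← Finset.sum_filter, Finset.filter_mem_eq_inter, Finset.inter_eq_right.2 hBN]
      simp [mul_comm]
    have e3 : ∑ v ∈ N, (if v = y then 16 else 0) = 16 := by
      simp [hyN]
    rw [e1, e2, e3] at h2
    simp at h2
    omega
  by_cases h6 : 6 ≤ de G x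
  · omega
  by_cases ho : B.card ≤ 1
  · omega
  have d5 : de G x = 5 := by omega
  have ho : B.card = 2 := by omega
  obtain ⟨b1, b2, nb12, hBe⟩ := Finset.card_eq_two.1 ho
  have g1 : 16 < give G x b1 := (memB b1).1 (by simp [hBe])
  have g2 : 16 < give G x b2 := (memB b2).1 (by simp [hBe])
  have nt : φ b1 ≠ φ b2 := fun h => nb12 (inj (by simp [hBe]) (by simp [hBe]) h)
  have dt1 := (hT b1 g1).d3
  have dt2 := (hT b2 g2).d3
  have gt1 := hgφ b1 g1
  have gt2 := hgφ b2 g2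
  have ne1 : b1 ≠ φ b1 := by intro h; rw [← h] at gt1; have := w10 (de G x) (de G (ρ b1)); omega
  have ne2 : b1 ≠ φ b2 := by intro h; rw [← h] at gt2; have := w10 (de G x) (de G (ρ b2)); omega
  have ne3 : b2 ≠ φ b1 := by intro h; rw [← h] at gt1; have := w10 (de G x) (de G (ρ b1)); omega
  have ne4 : b2 ≠ φ b2 := by intro h; rw [← h] at gt2; have := w10 (de G x) (de G (ρ b2)); omega
  have yne : ∀ u, de G u = 3 → y ≠ u := by rintro u hu rfl; omega
  have db1 := (hP b1 g1).tb.d3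
  have db2 := (hP b2 g2).tb.d3
  have y1 := yne _ db1
  have y2 := yne _ db2
  have y3 := yne _ dt1
  have y4 := yne _ dt2
  have i1 : y ∉ ({b1, b2, φ b1, φ b2} : Finset V) := by simp [y1, y2, y3, y4]
  have i2 : b1 ∉ ({b2, φ b1, φ b2} : Finset V) := by simp [nb12, ne1, ne2]
  have i3 : b2 ∉ ({φ b1, φ b2} : Finset V) := by simp [ne3, ne4]
  have nx := nb_full (G := G) (v := x) {y, b1, b2, φ b1, φ b2} (by
    simp [hxy, hφ b1 g1, hφ b2 g2, (hP b1 g1).tb.vt.symm, (hP b2 g2).tb.vt.symm]) (by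
    rw [d5, Finset.card_insert_of_notMem i1, Finset.card_insert_of_notMem i2,
      Finset.card_insert_of_notMem i3, Finset.card_pair nt])
  have yy : ∀ y', G.Adj x y' → 4 ≤ de G y' → y' = y := by
    intro y' k1 k2
    have := (nx y').1 k1
    simp at this
    rcases this with h | rfl | rfl | rfl | rfl
    · exact h
    all_goals omega
  have r1 := yy _ (hρ b1 g1) (hr b1 g1)
  have r2 := yy _ (hρ b2 g2) (hr b2 g2)
  have t1 := hT b1 g1
  have t2 := hT b2 g2
  rw [r1] at t1 gt1
  rw [r2] at t2 gt2
  by_cases dy5 : de G y = 4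
  · exact (hG.five (hP b1 g1) (hP b2 g2) t1 t2 nb12 d5 dy5).elim
  have hw : w1 (de G x) (de G y) = 9 := by
    unfold w1; split_ifs <;> omega
  have hl := load_eq _ x nx
  rw [Finset.sum_insert i1, Finset.sum_insert i2, Finset.sum_insert i3, Finset.sum_pair nt, gy, gt1, gt2,
    hw, h24 b1 g1, h24 b2 g2] at hl
  omega

theorem MC.false (hG : MC G) : False := by
  have h1 : ∀ x, load G x + 144 ≤ 42 * de G x + (if de G x = 3 then 18 else 0) := by
    intro x
    have := hG.deg3 x
    by_cases h3 : de G x = 3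
    · have : load G x = 0 := by
        unfold load
        apply Finset.sum_eq_zero
        intro v _
        by_contra h0
        have := (give_ne h0).2.2
        omega
      rw [if_pos h3]; omega
    · rw [if_neg h3]
      by_cases h4 : de G x = 4
      · have := hG.load4 h4; omega
      · have := hG.load5 (x := x) (by omega); omega
  have h2 := Finset.sum_le_sum (s := Finset.univ) (fun x _ => h1 x)
  rw [Finset.sum_add_distrib, Finset.sum_add_distrib, ← Finset.mul_sum] at h2
  have h3 : ∑ x, load G x = ∑ v, rc G v := by
    unfold load rc
    exact Finset.sum_comm
  have h4 := hG.rc_total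
  have h5 : ∑ x, (if de G x = 3 then 18 else 0) = 18 * (Finset.univ.filter (fun v => de G v = 3)).card := by
    rw [← Finset.sum_filter]; simp [mul_comm]
  have h6 := hG.low
  have h7 : ∑ v, de G v = ∑ v, dg G Finset.univ v := rfl
  rw [h3, h5, h7] at h2
  simp at h2
  omega

end IVC

namespace IVC
open Classical
set_option linter.unusedSectionVars false

theorem dg_comap {V : Type*} [Fintype V] (H : SimpleGraph V) (W : Finset V) (v : {v // v ∈ W}) :
    dg (H.comap (Subtype.val : {v // v ∈ W} → V)) Finset.univ v = dg H W v.1 := by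
  unfold dg
  rw [← Finset.card_map (Function.Embedding.subtype (fun v => v ∈ W))]
  congr 1
  ext u
  simp [mem_nb]
  tauto

theorem nf_comap {V : Type*} [Fintype V] (H : SimpleGraph V) (W : Finset V) (h : NFon H W) :
    NFon (H.comap (Subtype.val : {v // v ∈ W} → V)) Finset.univ := by
  intro S P Q hS
  let e := Function.Embedding.subtype (fun v => v ∈ W)
  have hm : ∀ (T : Finset {v // v ∈ W}) (v : V), v ∈ T.map e ↔ ∃ h : v ∈ W, (⟨v, h⟩ : {v // v ∈ W}) ∈ T := by
    intro T v
    simp [e]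
  refine h (S.map e) (P.map e) (Q.map e) ⟨?_, ?_, ?_, ?_, ?_, ?_, ?_, ?_, ?_⟩
  · intro v
    rw [hm, hm, hm]
    constructor
    · intro hv
      have := (hS.cov ⟨v, hv⟩).1 (Finset.mem_univ _)
      rcases this with h | h | h
      · exact Or.inl ⟨hv, h⟩
      · exact Or.inr (Or.inl ⟨hv, h⟩)
      · exact Or.inr (Or.inr ⟨hv, h⟩)
    · rintro (⟨h, -⟩ | ⟨h, -⟩ | ⟨h, -⟩) <;> exact h
  · intro v; rw [hm, hm]; rintro ⟨h1, h2⟩ ⟨h3, h4⟩; exact hS.sp _ h2 h4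
  · intro v; rw [hm, hm]; rintro ⟨h1, h2⟩ ⟨h3, h4⟩; exact hS.sq _ h2 h4
  · intro v; rw [hm, hm]; rintro ⟨h1, h2⟩ ⟨h3, h4⟩; exact hS.pq _ h2 h4
  · obtain ⟨v, hv⟩ := hS.pne; exact ⟨v.1, (hm _ _).2 ⟨v.2, hv⟩⟩
  · obtain ⟨v, hv⟩ := hS.qne; exact ⟨v.1, (hm _ _).2 ⟨v.2, hv⟩⟩
  · intro p q; rw [hm, hm]; rintro ⟨h1, h2⟩ ⟨h3, h4⟩ ha; exact hS.nadj _ _ h2 h4 ha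
  · intro p q; rw [hm, hm]; rintro ⟨h1, h2⟩ ⟨h3, h4⟩ ha; exact hS.indep _ _ h2 h4 ha
  · rw [Finset.card_map]; exact hS.card

theorem bound (n : ℕ) : ∀ (V : Type u) [Fintype V] (G : SimpleGraph V), Fintype.card V = n →
    NFon G Finset.univ → 1 ≤ n → 24 * n ≤ 7 * (∑ v, dg G Finset.univ v) + 34 := by
  induction n using Nat.strong_induction_on with
  | _ n ih =>
    intro V _ G hV hnf hn
    by_contra hcon
    refine MC.false (G := G) ⟨hnf, ?_, by rw [hV]; omega⟩
    intro H W hW hWu hHW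
    have hlt : W.card < n := by
      rw [← hV, ← Finset.card_univ]
      exact Finset.card_lt_card (Finset.ssubset_univ_iff.2 hWu)
    have h1 := ih W.card hlt {v // v ∈ W} (H.comap Subtype.val) (by simp) (nf_comap H W hHW)
      (Finset.card_pos.2 hW)
    have h2 : ∑ v : {v // v ∈ W}, dg (H.comap (Subtype.val : {v // v ∈ W} → V)) Finset.univ v =
        ∑ v ∈ W, dg H W v := by
      rw [← Finset.sum_coe_sort W]
      exact Finset.sum_congr rfl fun v _ => dg_comap H W v
    rwa [h2] at h1

theorem sum_dg {V : Type*} [Fintype V] (G : SimpleGraph V) :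
    ∑ v, dg G Finset.univ v = 2 * G.edgeSet.ncard := by
  have h := G.sum_degrees_eq_twice_card_edges
  rw [← SimpleGraph.coe_edgeFinset, Set.ncard_coe_finset, ← h]
  refine Finset.sum_congr rfl fun v _ => ?_
  unfold dg SimpleGraph.degree
  congr 1
  ext u
  simp [mem_nb]

theorem Sep.not_conn {V : Type*} [Fintype V] {G : SimpleGraph V} {S P Q : Finset V}
    (h : Sep G Finset.univ S P Q) : ¬ (G.induce ((S : Set V)ᶜ)).Connected := by
  intro hc
  obtain ⟨p, hp⟩ := h.pne
  obtain ⟨q, hq⟩ := h.qne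
  have hpS : p ∈ ((S : Set V)ᶜ) := fun hs => h.sp p hs hp
  have hqS : q ∈ ((S : Set V)ᶜ) := fun hs => h.sq q hs hq
  have key : ∀ (u w : ((S : Set V)ᶜ : Set V)), (G.induce ((S : Set V)ᶜ)).Walk u w → u.1 ∈ P → w.1 ∈ P := by
    intro u w W
    induction W with
    | nil => exact id
    | @cons a b c hab _ ih =>
      intro ha
      apply ih
      have h1 := (h.cov b.1).1 (Finset.mem_univ _)
      have h2 : b.1 ∉ S := fun hh => b.2 hh
      have h3 := h.nadj a.1 b.1 ha
      have h4 : G.Adj a.1 b.1 := hab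
      tauto
  obtain ⟨W⟩ := hc.preconnected ⟨p, hpS⟩ ⟨q, hqS⟩
  exact h.pq q (key _ _ W hp) hq

end IVC

/-- Every connected graph of order `n` and size at most `12n/7 - 3` contains
an independent vertex cut of cardinality at most 3. -/
theorem independent_vertex_cut_card_le_three_of_size_le
    {V : Type*} [Fintype V] (G : SimpleGraph V) (n : ℕ)
    (hn : Fintype.card V = n) (hconn : G.Connected)
    (hsize : (G.edgeSet.ncard : ℚ) ≤ 12 * n / 7 - 3) :
    ∃ S : Finset V, IsVertexCut G S ∧ S.card ≤ 3 ∧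
      ∀ a ∈ S, ∀ b ∈ S, ¬ G.Adj a b := by
  by_contra hcon
  have hnf : IVC.NFon G Finset.univ := by
    intro S P Q h
    apply hcon
    refine ⟨S, ⟨?_, h.not_conn⟩, h.card, fun a ha b hb => h.indep a b ha hb⟩
    obtain ⟨p, hp⟩ := h.pne
    intro hu
    have : p ∈ (S : Set V) := by rw [hu]; exact Set.mem_univ p
    exact h.sp p this hp
  have hn1 : 1 ≤ n := by
    rw [← hn]
    have := hconn.nonempty
    exact Fintype.card_pos
  have h1 := IVC.bound n V G hn hnf hn1
  rw [IVC.sum_dg] at h1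
  have h2 : (24 * n : ℚ) ≤ 7 * (2 * G.edgeSet.ncard) + 34 := by exact_mod_cast h1
  linarith
end

section
/- Every connected cubic (3-regular) finite simple graph G with connectivity κ(G) = 2 has an independent vertex cut of cardinality 2, i.e., two nonadjacent vertices whose removal disconnects G. -/
open SimpleGraph

lemma isVertexCut_iff_aux {V : Type*} [Fintype V] (G : SimpleGraph V) (S : Finset V) :
    IsVertexCut G S ↔ ∃ A : Set V, ∃ u ∈ A, ∃ w, w ∉ A ∧ w ∉ S ∧ (∀ a ∈ A, a ∉ S) ∧
      ∀ a ∈ A, ∀ b, G.Adj a b → b ∈ A ∨ b ∈ S := by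
  constructor
  · rintro ⟨h1, h2⟩
    obtain ⟨z, hz⟩ := (Set.ne_univ_iff_exists_notMem _).1 h1
    have hne : Nonempty ((S : Set V)ᶜ : Set V) := ⟨⟨z, hz⟩⟩
    have h3 : ¬ (G.induce ((S : Set V)ᶜ)).Preconnected := fun h => h2 ⟨h⟩
    unfold SimpleGraph.Preconnected at h3
    push Not at h3
    obtain ⟨u, w, huw⟩ := h3
    refine ⟨{a | ∃ h : a ∈ ((S : Set V)ᶜ : Set V),
      (G.induce ((S : Set V)ᶜ)).Reachable u ⟨a, h⟩}, u, ⟨u.2, Reachable.refl _⟩, w, ?_, ?_, ?_, ?_⟩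
    · rintro ⟨h, h'⟩
      exact huw h'
    · exact fun h => w.2 h
    · rintro a ⟨h, -⟩
      simpa using h
    · rintro a ⟨h, h'⟩ b hab
      by_cases hb : b ∈ S
      · exact Or.inr hb
      · refine Or.inl ⟨by simpa using hb, h'.trans (Adj.reachable ?_)⟩
        simpa using hab
  · rintro ⟨A, u, hu, w, hwA, hwS, hA, hE⟩
    refine ⟨(Set.ne_univ_iff_exists_notMem _).2 ⟨w, by simpa using hwS⟩, fun hc => ?_⟩
    have key : ∀ p q : ((S : Set V)ᶜ : Set V), (G.induce ((S : Set V)ᶜ)).Walk p q →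
        p.1 ∈ A → q.1 ∈ A := by
      intro p q W
      induction W with
      | nil => exact id
      | @cons p r q h W ih =>
        intro hp
        apply ih
        rcases hE p.1 hp r.1 (by simpa using h) with h | h
        · exact h
        · exact absurd h (fun h => r.2 h)
    obtain ⟨W⟩ := hc.preconnected ⟨u, by simpa using hA u hu⟩ ⟨w, by simpa using hwS⟩
    exact hwA (key _ _ W hu)

lemma nbr_eq_aux {V : Type*} [Fintype V] (G : SimpleGraph V)
    (hcubic : ∀ v : V, (G.neighborSet v).ncard = 3) {x a b c : V}
    (ha : G.Adj x a) (hb : G.Adj x b) (hc : G.Adj x c) (hab : a ≠ b) (hac : a ≠ c) (hbc : b ≠ c)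
    {z : V} (hz : G.Adj x z) : z = a ∨ z = b ∨ z = c := by
  have h3 : ({a, b, c} : Set V).ncard = 3 := Set.ncard_eq_three.2 ⟨a, b, c, hab, hac, hbc, rfl⟩
  have hsub : ({a, b, c} : Set V) ⊆ G.neighborSet x := by
    rintro t (rfl | rfl | rfl) <;> assumption
  have := Set.eq_of_subset_of_ncard_le hsub (by rw [h3, hcubic]) (Set.toFinite _)
  have hz' : z ∈ G.neighborSet x := hz
  rw [← this] at hz'
  simpa using hz'

theorem cubic_connectivity_two_independent_cut
    {V : Type*} [Fintype V] (G : SimpleGraph V)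
    (hconn : G.Connected)
    (hcubic : ∀ v : V, (G.neighborSet v).ncard = 3)
    (hk : graphConnectivity G = 2) :
    ∃ S : Finset V, IsVertexCut G S ∧ S.card = 2 ∧
      ∀ a ∈ S, ∀ b ∈ S, ¬ G.Adj a b := by
  classical
  have hno : ∀ y : V, ¬ IsVertexCut G {y} := by
    intro y hy
    have : graphConnectivity G ≤ 1 := Nat.sInf_le ⟨{y}, hy, by simp⟩
    omega
  have hex : ∃ S : Finset V, IsVertexCut G S ∧ S.card = 2 := by
    have hne : {k | ∃ S : Finset V, IsVertexCut G S ∧ S.card = k}.Nonempty := by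
      apply Nat.nonempty_of_pos_sInf
      have : 0 < graphConnectivity G := by omega
      exact this
    have := Nat.sInf_mem hne
    change graphConnectivity G ∈ _ at this
    rw [hk] at this
    exact this
  obtain ⟨S, hS, hcard⟩ := hex
  obtain ⟨x, y, hxy, rfl⟩ := Finset.card_eq_two.1 hcard
  by_cases hadj : G.Adj x y
  swap
  · refine ⟨_, hS, hcard, ?_⟩
    have := fun h : G.Adj y x => hadj h.symm
    intro a ha b hb
    simp only [Finset.mem_insert, Finset.mem_singleton] at ha hb
    rcases ha with rfl | rfl <;> rcases hb with rfl | rfl <;> simp_all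
  obtain ⟨A, u, hu, w, hwA, hwS, hA, hE⟩ := (isVertexCut_iff_aux G _).1 hS
  simp only [Finset.mem_insert, Finset.mem_singleton, not_or] at hwS hA hE
  have hyx := hadj.symm
  -- each of the two vertices has neighbours on both sides
  have nA : ∀ p q : V, (∀ a ∈ A, ∀ b, G.Adj a b → b ∈ A ∨ b = p ∨ b = q) → w ≠ q →
      (∀ a ∈ A, a ≠ q) → ∃ a ∈ A, G.Adj p a := by
    intro p q h hw hq
    by_contra! hcon
    refine hno q ((isVertexCut_iff_aux G _).2 ⟨A, u, hu, w, hwA, by simpa using hw,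
      by simpa using hq, ?_⟩)
    intro a ha b hab
    rcases h a ha b hab with h | rfl | h
    · exact Or.inl h
    · exact absurd hab.symm (hcon a ha)
    · exact Or.inr (by simpa using h)
  have nB : ∀ p q : V, (∀ a ∈ A, ∀ b, G.Adj a b → b ∈ A ∨ b = p ∨ b = q) → w ≠ q → w ≠ p →
      (∀ a ∈ A, a ≠ q) → ∃ b, b ∉ A ∧ b ≠ p ∧ b ≠ q ∧ G.Adj p b := by
    intro p q h hw hwp hq
    by_contra! hcon
    refine hno q ((isVertexCut_iff_aux G _).2 ⟨{b | b ∉ A ∧ b ≠ p ∧ b ≠ q}, w, ⟨hwA, hwp, hw⟩,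
      u, fun h => h.1 hu, by simpa using hq u hu, fun a ha => by simpa using ha.2.2, ?_⟩)
    rintro a ⟨h1, h2, h3⟩ b hab
    by_cases hbq : b = q
    · exact Or.inr (by simpa using hbq)
    refine Or.inl ⟨fun hb => ?_, ?_, hbq⟩
    · rcases h b hb a hab.symm with h | h | h
      · exact h1 h
      · exact h2 h
      · exact h3 h
    · rintro rfl
      exact hcon a h1 h2 h3 hab.symm
  have hE' : ∀ a ∈ A, ∀ b, G.Adj a b → b ∈ A ∨ b = y ∨ b = x := by
    intro a ha b hab
    have := hE a ha b hab
    tauto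
  obtain ⟨a, haA, hxa⟩ := nA x y hE hwS.2 fun a ha => (hA a ha).2
  obtain ⟨a', haA', hya⟩ := nA y x hE' hwS.1 fun a ha => (hA a ha).1
  obtain ⟨b, hbA, hbx, hby, hxb⟩ := nB x y hE hwS.2 hwS.1 fun a ha => (hA a ha).2
  obtain ⟨b', hbA', hby', hbx', hyb⟩ := nB y x hE' hwS.1 hwS.2 fun a ha => (hA a ha).1
  have hxA : x ∉ A := fun h => (hA x h).1 rfl
  have hyA : y ∉ A := fun h => (hA y h).2 rfl
  have ux : ∀ z ∈ A, G.Adj x z → z = a := by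
    intro z hz hxz
    rcases nbr_eq_aux G hcubic hadj hxa hxb (fun h => hyA (h ▸ haA)) hby.symm
      (fun h => hbA (h ▸ haA)) hxz with rfl | h | rfl
    · exact absurd hz hyA
    · exact h
    · exact absurd hz hbA
  have uy : ∀ z ∈ A, G.Adj y z → z = a' := by
    intro z hz hxz
    rcases nbr_eq_aux G hcubic hyx hya hyb (fun h => hxA (h ▸ haA')) hbx'.symm
      (fun h => hbA' (h ▸ haA')) hxz with rfl | h | rfl
    · exact absurd hz hxA
    · exact h
    · exact absurd hz hbA'
  by_cases haa : a = a'
  · subst haa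
    exfalso
    have : ∃ c ∈ G.neighborSet a, c ∉ ({x, y} : Set V) := by
      refine Set.exists_mem_notMem_of_ncard_lt_ncard ?_ (Set.toFinite _)
      rw [hcubic, Set.ncard_pair hxy]
      omega
    obtain ⟨c, hac, hc⟩ := this
    have hac : G.Adj a c := hac
    simp only [Set.mem_insert_iff, Set.mem_singleton_iff] at hc
    have hcA : c ∈ A := (hE a haA c hac).resolve_right hc
    refine hno a ((isVertexCut_iff_aux G _).2 ⟨A \ {a}, c, ⟨hcA, hac.ne'⟩, x, fun h => hxA h.1,
      by simpa using hxa.ne, fun z hz => by simpa using hz.2, ?_⟩)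
    rintro z ⟨hz, hza⟩ t hzt
    by_cases hta : t = a
    · exact Or.inr (by simpa using hta)
    rcases hE z hz t hzt with h | rfl | rfl
    · exact Or.inl ⟨h, hta⟩
    · exact absurd (ux z hz hzt.symm) hza
    · exact absurd (uy z hz hzt.symm) hza
  · have hay : a ≠ y := (hA a haA).2
    have hnay : ¬ G.Adj y a := fun h => haa (uy a haA h)
    refine ⟨{a, y}, (isVertexCut_iff_aux G _).2 ⟨A \ {a}, a', ⟨haA', fun h => haa h.symm⟩, x,
      fun h => hxA h.1, by simp [hxa.ne, hxy], ?_, ?_⟩, Finset.card_pair hay, ?_⟩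
    · rintro z ⟨hz, hza⟩ hz'
      simp only [Finset.mem_insert, Finset.mem_singleton] at hz'
      rcases hz' with h | h
      · exact hza h
      · exact (hA z hz).2 h
    · rintro z ⟨hz, hza⟩ t hzt
      by_cases hta : t = a
      · exact Or.inr (by simp [hta])
      rcases hE z hz t hzt with h | rfl | rfl
      · exact Or.inl ⟨h, hta⟩
      · exact absurd (ux z hz hzt.symm) hza
      · exact Or.inr (by simp)
    · have := fun h : G.Adj a y => hnay h.symm
      intro p hp q hq
      simp only [Finset.mem_insert, Finset.mem_singleton] at hp hq
      rcases hp with rfl | rfl <;> rcases hq with rfl | rfl <;>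
        first | exact G.irrefl | assumption
end

section
/- Every connected 4-regular finite simple graph G of order at least 7 with connectivity κ(G) = 4 has a vertex cut S of cardinality 4 such that the induced subgraph G[S] is a forest. -/
open SimpleGraph

open Classical in
theorem cut_of_sep {V : Type*} [Fintype V] (G : SimpleGraph V) (A S : Finset V)
    (hA : A.Nonempty) (hd : ∀ a ∈ A, a ∉ S) (hc : (A ∪ S).card < Fintype.card V)
    (hN : ∀ a ∈ A, ∀ u, G.Adj a u → u ∈ A ∨ u ∈ S) : IsVertexCut G S := by
  obtain ⟨a, ha⟩ := hA
  have haS := hd a ha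
  refine ⟨fun h => haS ?_, fun h => ?_⟩
  · have : a ∈ (S : Set V) := by rw [h]; trivial
    exact this
  · obtain ⟨w, hw⟩ : ∃ w, w ∉ A ∪ S := by
      by_contra hcon
      push Not at hcon
      rw [Finset.eq_univ_of_forall hcon, Finset.card_univ] at hc
      exact lt_irrefl _ hc
    simp only [Finset.mem_union, not_or] at hw
    obtain ⟨p⟩ := h.preconnected ⟨a, by simpa using haS⟩ ⟨w, by simpa using hw.2⟩
    have key : ∀ (x y : ((S : Set V)ᶜ : Set V)), (G.induce ((S : Set V)ᶜ)).Walk x y →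
        x.1 ∈ A → y.1 ∈ A := by
      intro x y p
      induction p with
      | nil => exact id
      | cons h _ ih =>
        intro hx
        apply ih
        rename_i u v w q
        rcases hN _ hx v.1 h with h1 | h1
        · exact h1
        · exact absurd h1 v.2
    exact hw.1 (key _ _ p ha)

theorem exists_short_cycle {V : Type*} (G : SimpleGraph V) (S : Finset V) (hS : S.card = 4)
    (h : ¬ (G.induce (S : Set V)).IsAcyclic) :
    (∃ a ∈ S, ∃ b ∈ S, ∃ c ∈ S, G.Adj a b ∧ G.Adj b c ∧ G.Adj c a) ∨
    (∃ a ∈ S, ∃ b ∈ S, ∃ c ∈ S, ∃ d ∈ S, a ≠ c ∧ b ≠ d ∧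
      G.Adj a b ∧ G.Adj b c ∧ G.Adj c d ∧ G.Adj d a) := by
  simp only [SimpleGraph.IsAcyclic, not_forall, not_not] at h
  obtain ⟨v, p, hp⟩ := h
  have hnd := hp.support_nodup
  have h3 := hp.three_le_length
  have hlen : p.length ≤ 4 := by
    have h1 := hnd.length_le_card
    simp at h1
    omega
  match p, hnd, h3, hlen with
  | .cons (v := b) h1 (.cons (v := c) h2 (.cons h4 .nil)), _, _, _ =>
    exact .inl ⟨v, v.2, b, b.2, c, c.2, h1, h2, h4⟩
  | .cons (v := b) h1 (.cons (v := c) h2 (.cons (v := d) h4 (.cons h5 .nil))), hnd, _, _ =>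
    simp at hnd
    refine .inr ⟨v, v.2, b, b.2, c, c.2, d, d.2, ?_, ?_, h1, h2, h4, h5⟩
    · rintro h; have := Subtype.ext h; grind
    · rintro h; have := Subtype.ext h; grind
  | .cons h1 .nil, _, h3, _ => simp at h3
  | .cons h1 (.cons h2 .nil), _, h3, _ => simp at h3
  | .nil, _, h3, _ => simp at h3
  | .cons _ (.cons _ (.cons _ (.cons _ (.cons _ q)))), _, _, h4 => simp at h4; omega

/-- A vertex cut has at least four vertices. -/
theorem no_small_cut {V : Type*} [Fintype V] {G : SimpleGraph V}
    (hk : graphConnectivity G = 4) {S : Finset V} (hS : IsVertexCut G S) : 4 ≤ S.card := by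
  rw [← hk]
  exact Nat.sInf_le ⟨S, hS, rfl⟩

/-- If three distinct neighbours are known, the fourth exists. -/
theorem fourth {V : Type*} [Fintype V] (G : SimpleGraph V)
    (hreg : ∀ v : V, (G.neighborSet v).ncard = 4) {v a b c : V}
    (ha : G.Adj v a) (hb : G.Adj v b) (hc : G.Adj v c) (hab : a ≠ b) (hac : a ≠ c) (hbc : b ≠ c) :
    ∃ d, d ≠ a ∧ d ≠ b ∧ d ≠ c ∧ ∀ u, G.Adj v u ↔ u = a ∨ u = b ∨ u = c ∨ u = d := by
  classical
  have h4 := hreg v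
  have hsub : ({a, b, c} : Set V) ⊆ G.neighborSet v := by
    rintro x (rfl | rfl | rfl) <;> assumption
  have h3 : ({a, b, c} : Set V).ncard = 3 := Set.ncard_eq_three.2 ⟨a, b, c, hab, hac, hbc, rfl⟩
  have h1 : (G.neighborSet v \ {a, b, c}).ncard = 1 := by
    rw [Set.ncard_sdiff hsub, h4, h3]
  obtain ⟨d, hd⟩ := Set.ncard_eq_one.1 h1
  have hd' : ∀ x, (G.Adj v x ∧ ¬ (x = a ∨ x = b ∨ x = c)) ↔ x = d := by
    intro x
    have := Set.ext_iff.1 hd x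
    simpa using this
  have := (hd' d).2 rfl
  refine ⟨d, by grind, by grind, by grind, fun u => ?_⟩
  have := hd' u
  grind

theorem k4_case {V : Type*} [Fintype V] (G : SimpleGraph V)
    (hreg : ∀ v : V, (G.neighborSet v).ncard = 4)
    (h7 : 7 ≤ Fintype.card V)
    (hk : graphConnectivity G = 4) {p q r s : V}
    (hpq : G.Adj p q) (hpr : G.Adj p r) (hps : G.Adj p s)
    (hqr : G.Adj q r) (hqs : G.Adj q s) (hrs : G.Adj r s) :
    ∃ S : Finset V, IsVertexCut G S ∧ S.card = 4 ∧
      (G.induce (S : Set V)).IsAcyclic := by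
  classical
  -- two vertices of a `K4` have different outside neighbours
  have inj : ∀ p q r s x : V, G.Adj p q → G.Adj p r → G.Adj p s → G.Adj q r → G.Adj q s →
      G.Adj r s → (∀ u, G.Adj p u → u = q ∨ u = r ∨ u = s ∨ u = x) →
      (∀ u, G.Adj q u → u = p ∨ u = r ∨ u = s ∨ u = x) → x ≠ p → x ≠ q → False := by
    intro p q r s x h1 h2 h3 h4 h5 h6 hp hq hxp hxq
    have hcut : IsVertexCut G {x, r, s} := by
      apply cut_of_sep G {p, q} {x, r, s} (by simp)
      · have := h2.ne; have := h3.ne; have := h4.ne; have := h5.ne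
        simp; grind
      · refine lt_of_le_of_lt (b := 5) ?_ (by omega)
        refine (Finset.card_union_le _ _).trans ?_
        have := Finset.card_le_two (a := p) (b := q)
        have := Finset.card_le_three (a := x) (b := r) (c := s)
        omega
      · simp; grind
    have := no_small_cut hk hcut
    have := Finset.card_le_three (a := x) (b := r) (c := s)
    omega
  have := hpq.ne
  have := hpr.ne
  have := hps.ne
  have := hqr.ne
  have := hqs.ne
  have := hrs.ne
  obtain ⟨p', hp1, hp2, hp3, hp⟩ := fourth G hreg hpq hpr hps (by assumption) (by assumption) (by assumption)
  obtain ⟨q', hq1, hq2, hq3, hq⟩ := fourth G hreg hpq.symm hqr hqs (by assumption) (by assumption) (by assumption)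
  obtain ⟨r', hr1, hr2, hr3, hr⟩ := fourth G hreg hpr.symm hqr.symm hrs (by assumption) (by assumption) (by assumption)
  obtain ⟨s', hs1, hs2, hs3, hs⟩ := fourth G hreg hps.symm hqs.symm hrs.symm (by assumption) (by assumption) (by assumption)
  have np : p' ≠ p := fun h => G.loopless.irrefl p ((hp p).2 (by simp [h]))
  have nq : q' ≠ q := fun h => G.loopless.irrefl q ((hq q).2 (by simp [h]))
  have nr : r' ≠ r := fun h => G.loopless.irrefl r ((hr r).2 (by simp [h]))
  have ns : s' ≠ s := fun h => G.loopless.irrefl s ((hs s).2 (by simp [h]))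
  have e1 : p' ≠ r' := fun h => inj p r q s p' hpr hpq hps hqr.symm hrs hqs (by grind) (by grind) np (by grind)
  have e2 : p' ≠ s' := fun h => inj p s q r p' hps hpq hpr hqs.symm hrs.symm hqr (by grind) (by grind) np (by grind)
  have e3 : q' ≠ r' := fun h => inj q r p s q' hqr hpq.symm hqs hpr.symm hrs hps (by grind) (by grind) nq (by grind)
  have e4 : q' ≠ s' := fun h => inj q s p r q' hqs hpq.symm hqr hps.symm hrs.symm hpr (by grind) (by grind) nq (by grind)
  have e5 : r' ≠ s' := fun h => inj r s p q r' hrs hpr.symm hqr.symm hps.symm hqs.symm hpq (by grind) (by grind) nr (by grind)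
  have n1 : ¬ G.Adj p r' := by rw [hp]; grind
  have n2 : ¬ G.Adj p s' := by rw [hp]; grind
  have n3 : ¬ G.Adj q r' := by rw [hq]; grind
  have n4 : ¬ G.Adj q s' := by rw [hq]; grind
  have hcard : ({p, q, r', s'} : Finset V).card = 4 := by
    rw [Finset.card_insert_of_notMem, Finset.card_insert_of_notMem, Finset.card_pair e5]
    · simp; grind
    · simp; grind
  refine ⟨{p, q, r', s'}, ?_, hcard, ?_⟩
  · apply cut_of_sep G {r, s} _ (by simp)
    · simp; grind
    · refine lt_of_le_of_lt (b := 6) ?_ (by omega)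
      refine (Finset.card_union_le _ _).trans ?_
      have := Finset.card_le_two (a := r) (b := s)
      omega
    · simp; grind
  · by_contra hac
    have m1 := fun h => n1 (G.adj_symm h)
    have m2 := fun h => n2 (G.adj_symm h)
    have m3 := fun h => n3 (G.adj_symm h)
    have m4 := fun h => n4 (G.adj_symm h)
    have l := G.loopless.irrefl
    rcases exists_short_cycle G _ hcard hac with
      ⟨a, ha, b, hb, c, hc, h1, h2, h3⟩ | ⟨a, ha, b, hb, c, hc, d, hd, h1, h2, h3, h4, h5, h6⟩
    · simp only [Finset.mem_insert, Finset.mem_singleton] at ha hb hc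
      rcases ha with rfl | rfl | rfl | rfl <;> rcases hb with rfl | rfl | rfl | rfl <;>
        first | exact absurd h1 (by grind) | grind
    · simp only [Finset.mem_insert, Finset.mem_singleton] at ha hb hc hd
      rcases ha with rfl | rfl | rfl | rfl <;> rcases hb with rfl | rfl | rfl | rfl <;>
        first | exact absurd h3 (by grind) | grind

set_option maxHeartbeats 2000000 in
/-- Every connected 4-regular graph of order at least 7 with connectivity 4
has a foresty vertex cut of cardinality 4. -/
theorem four_regular_connectivity_four_foresty_cut
    {V : Type*} [Fintype V] (G : SimpleGraph V)
    (hconn : G.Connected)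
    (hreg : ∀ v : V, (G.neighborSet v).ncard = 4)
    (h7 : 7 ≤ Fintype.card V)
    (hk : graphConnectivity G = 4) :
    ∃ S : Finset V, IsVertexCut G S ∧ S.card = 4 ∧
      (G.induce (S : Set V)).IsAcyclic := by
  classical
  by_contra hno
  have K : ∀ p q r s : V, G.Adj p q → G.Adj p r → G.Adj p s → G.Adj q r → G.Adj q s →
      G.Adj r s → False := fun p q r s h1 h2 h3 h4 h5 h6 =>
    hno (k4_case G hreg h7 hk h1 h2 h3 h4 h5 h6)
  -- every neighbourhood contains a four-cycle
  have C : ∀ v : V, ∃ a b c d, G.Adj v a ∧ G.Adj v b ∧ G.Adj v c ∧ G.Adj v d ∧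
      a ≠ c ∧ b ≠ d ∧ G.Adj a b ∧ G.Adj b c ∧ G.Adj c d ∧ G.Adj d a := by
    intro v
    have hcard : (G.neighborFinset v).card = 4 := by
      rw [← hreg v, ← Set.ncard_coe_finset, coe_neighborFinset]
    have hcut : IsVertexCut G (G.neighborFinset v) := by
      apply cut_of_sep G {v} _ (by simp)
      · simp
      · refine lt_of_le_of_lt (b := 5) ?_ (by omega)
        refine (Finset.card_union_le _ _).trans ?_
        simp only [Finset.card_singleton]
        omega
      · simp +contextual
    have hac : ¬ (G.induce ((G.neighborFinset v : Finset V) : Set V)).IsAcyclic :=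
      fun h => hno ⟨_, hcut, hcard, h⟩
    rcases exists_short_cycle G _ hcard hac with
      ⟨a, ha, b, hb, c, hc, h1, h2, h3⟩ | ⟨a, ha, b, hb, c, hc, d, hd, h1, h2, h3, h4, h5, h6⟩
    · simp only [mem_neighborFinset] at ha hb hc
      exact (K v a b c ha hb hc h1 h3.symm h2).elim
    · simp only [mem_neighborFinset] at ha hb hc hd
      exact ⟨a, b, c, d, ha, hb, hc, hd, h1, h2, h3, h4, h5, h6⟩
  have v : V := hconn.nonempty.some
  obtain ⟨a, b, c, d, ha, hb, hc, hd, hac, hbd, hab, hbc, hcd, hda⟩ := C v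
  have nbd : ¬ G.Adj b d := fun h => K v a b d ha hb hd hab hda.symm h
  have nac : ¬ G.Adj a c := fun h => K v a b c ha hb hc hab h hbc
  have hv : ∀ u, G.Adj v u → u = a ∨ u = b ∨ u = c ∨ u = d := by
    obtain ⟨e, -, -, -, he⟩ := fourth G hreg ha hb hc hab.ne hac hbc.ne
    have := (he d).1 hd
    have := hcd.ne
    have := hda.ne
    grind
  obtain ⟨x, hx1, hx2, hx3, hx⟩ := fourth G hreg ha.symm hab hda.symm hb.ne hd.ne hbd
  have hax : G.Adj a x := (hx x).2 (by simp)
  have hxa := hax.ne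
  have hxc : x ≠ c := by rintro rfl; exact nac hax
  have nvx : ¬ G.Adj v x := fun h => by have := hv x h; grind
  -- the four-cycle around `a` forces `x` to be adjacent to `b` and `d`
  have hxbd : G.Adj x b ∧ G.Adj x d := by
    obtain ⟨e, f, g, h, he, hf, hg, hh, h1, h2, h3, h4, h5, h6⟩ := C a
    rw [hx] at he hf hg hh
    have nvx' : ¬ G.Adj x v := fun h => nvx h.symm
    have nbd' : ¬ G.Adj d b := fun h => nbd h.symm
    have l := G.loopless.irrefl
    have sy : ∀ p q, G.Adj p q → G.Adj q p := fun p q h => h.symm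
    rcases he with rfl | rfl | rfl | rfl <;> rcases hf with rfl | rfl | rfl | rfl <;> grind
  obtain ⟨hxb, hxd⟩ := hxbd
  have hcut : IsVertexCut G {x, c} := by
    obtain ⟨e, -, -, -, he⟩ := fourth G hreg hb.symm hab.symm hbc ha.ne hc.ne hac
    obtain ⟨f, -, -, -, hf⟩ := fourth G hreg hd.symm hda hcd.symm ha.ne hc.ne hac
    have e1 := (he x).1 hxb.symm
    have f1 := (hf x).1 hxd.symm
    have := hbc.ne
    have := hcd.ne
    have := hc.ne
    have := hxb.ne
    have := hxd.ne
    apply cut_of_sep G {v, a, b, d} _ (by simp)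
    · simp; grind
    · refine lt_of_le_of_lt (b := 6) ?_ (by omega)
      refine (Finset.card_union_le _ _).trans ?_
      have := Finset.card_le_two (a := x) (b := c)
      have := Finset.card_le_four (a := v) (b := a) (c := b) (d := d)
      omega
    · clear K C hno
      have hc1 : e = x := by grind
      have hc2 : f = x := by grind
      intro y hy u hu
      simp only [Finset.mem_insert, Finset.mem_singleton] at hy ⊢
      rcases hy with rfl | rfl | rfl | rfl
      · have := hv u hu; tauto
      · have := (hx u).1 hu; tauto
      · have := (he u).1 hu; grind
      · have := (hf u).1 hu; grind
  have := no_small_cut hk hcut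
  have := Finset.card_le_two (a := x) (b := c)
  omega
end

section
/- Let n ≥ 7 be odd and let G_n be the graph obtained from a cycle C: v_1 v_2 … v_{n-1} v_1 of order n − 1 by adding a new vertex v_n together with the edges v_1 v_{(n+1)/2}, v_1 v_n, v_{(n+1)/2} v_n, and v_i v_{n+1-i} for i = 2, 3, …, (n−1)/2. Then G_n is connected of order n and size ⌊3n/2⌋ + 1, and {v_1, v_{(n+1)/2}} is the unique minimum vertex cut of G_n; this cut induces an edge, so G_n has no independent minimum vertex cut. -/
open SimpleGraph

/-- Oriented edges (smaller endpoint first) of the graph, on naturals, with n = 2m+1. -/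
def EdgeRel (m a b : ℕ) : Prop :=
  (a + 1 = b ∧ b < 2 * m) ∨ (a = 0 ∧ b = 2 * m - 1) ∨ (a = 0 ∧ b = m) ∨
  (a = 0 ∧ b = 2 * m) ∨ (a = m ∧ b = 2 * m) ∨ (1 ≤ a ∧ a < m ∧ b = 2 * m - a)

lemma rel_iff (m : ℕ) (hm : 3 ≤ m) (a b : ℕ) (ha : a < 2 * m + 1) (hb : b < 2 * m + 1) :
    (((a < 2 * m + 1 - 1 ∧ b < 2 * m + 1 - 1 ∧ b = (a + 1) % (2 * m + 1 - 1)) ∨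
        (a = 0 ∧ b = (2 * m + 1 - 1) / 2) ∨
        (a = 0 ∧ b = 2 * m + 1 - 1) ∨
        (a = (2 * m + 1 - 1) / 2 ∧ b = 2 * m + 1 - 1) ∨
        (1 ≤ a ∧ a ≤ (2 * m + 1 - 3) / 2 ∧ b = 2 * m + 1 - 1 - a))) ↔
     ((a + 1 = b ∧ b < 2 * m) ∨ (b = 0 ∧ a = 2 * m - 1) ∨ (a = 0 ∧ b = m) ∨
      (a = 0 ∧ b = 2 * m) ∨ (a = m ∧ b = 2 * m) ∨ (1 ≤ a ∧ a < m ∧ b = 2 * m - a)) := by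
  have h1 : 2 * m + 1 - 1 = 2 * m := by omega
  have h2 : 2 * m / 2 = m := by omega
  have h3 : (2 * m + 1 - 3) / 2 = m - 1 := by omega
  rw [h1, h2, h3]
  by_cases h : a + 1 < 2 * m
  · rw [Nat.mod_eq_of_lt h]; omega
  · by_cases h' : a + 1 = 2 * m
    · rw [h', Nat.mod_self]; omega
    · omega

lemma edgeRel_lt {m a b : ℕ} (hm : 3 ≤ m) (h : EdgeRel m a b) : a < b ∧ b < 2 * m + 1 := by
  unfold EdgeRel at h; omega

lemma edge_of_rel {m a b : ℕ} (h : (a + 1 = b ∧ b < 2 * m) ∨ (b = 0 ∧ a = 2 * m - 1) ∨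
      (a = 0 ∧ b = m) ∨
      (a = 0 ∧ b = 2 * m) ∨ (a = m ∧ b = 2 * m) ∨ (1 ≤ a ∧ a < m ∧ b = 2 * m - a)) :
    EdgeRel m a b ∨ EdgeRel m b a := by
  rcases h with h | h | h
  · exact Or.inl (Or.inl h)
  · exact Or.inr (Or.inr (Or.inl h))
  · exact Or.inl (Or.inr (Or.inr h))

lemma rel_of_edge {m a b : ℕ} (h : EdgeRel m a b) :
    ((a + 1 = b ∧ b < 2 * m) ∨ (b = 0 ∧ a = 2 * m - 1) ∨ (a = 0 ∧ b = m) ∨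
      (a = 0 ∧ b = 2 * m) ∨ (a = m ∧ b = 2 * m) ∨ (1 ≤ a ∧ a < m ∧ b = 2 * m - a)) ∨
    ((b + 1 = a ∧ a < 2 * m) ∨ (a = 0 ∧ b = 2 * m - 1) ∨ (b = 0 ∧ a = m) ∨
      (b = 0 ∧ a = 2 * m) ∨ (b = m ∧ a = 2 * m) ∨ (1 ≤ b ∧ b < m ∧ a = 2 * m - b)) := by
  rcases h with h | h | h
  · exact Or.inl (Or.inl h)
  · exact Or.inr (Or.inr (Or.inl h))
  · exact Or.inl (Or.inr (Or.inr h))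

lemma core (m : ℕ) (hm : 3 ≤ m) (s : ℕ → Prop) (p q : ℕ) (hs : ∀ x, s x → x = p ∨ x = q)
    (hne : ¬ (s 0 ∧ s m)) (P : ℕ → Prop)
    (hP : ∀ a b, EdgeRel m a b → ¬ s a → ¬ s b → (P a ↔ P b)) :
    ∀ x y, x < 2 * m + 1 → y < 2 * m + 1 → ¬ s x → ¬ s y → P x → P y := by
  have seg : ∀ d a, a + d < 2 * m → (∀ i, a ≤ i → i ≤ a + d → ¬ s i) → (P a ↔ P (a + d)) := by
    intro d
    induction d with
    | zero => intro a _ _; rfl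
    | succ d ih =>
      intro a h1 h2
      rw [ih a (by omega) (fun i hi hi' => h2 i hi (by omega))]
      exact hP _ _ (Or.inl ⟨by omega, by omega⟩) (h2 _ (by omega) (by omega))
        (h2 _ (by omega) (by omega))
  have seg' : ∀ a b, a ≤ b → b < 2 * m → (∀ i, a ≤ i → i ≤ b → ¬ s i) → (P a ↔ P b) := by
    intro a b hab hb h
    obtain ⟨d, rfl⟩ := Nat.exists_eq_add_of_le hab
    exact seg d a hb h
  have seg0 : ∀ a, 0 < a → a < 2 * m → ¬ s 0 → (∀ i, a ≤ i → i < 2 * m → ¬ s i) →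
      (P a ↔ P 0) := by
    intro a h0 ha hs0 h
    rw [seg' a (2 * m - 1) (by omega) (by omega) (fun i hi hi' => h i hi (by omega))]
    exact (hP 0 (2 * m - 1) (by unfold EdgeRel; omega) hs0 (h _ (by omega) (by omega))).symm
  have rung : ∀ a, 1 ≤ a → a < m → ¬ s a → ¬ s (2 * m - a) → (P a ↔ P (2 * m - a)) := by
    intro a h1 h2 h3 h4
    exact hP _ _ (by unfold EdgeRel; omega) h3 h4
  have e0m : ¬ s 0 → ¬ s m → (P 0 ↔ P m) := hP _ _ (by unfold EdgeRel; omega)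
  have e02 : ¬ s 0 → ¬ s (2 * m) → (P 0 ↔ P (2 * m)) := hP _ _ (by unfold EdgeRel; omega)
  have em2 : ¬ s m → ¬ s (2 * m) → (P m ↔ P (2 * m)) := hP _ _ (by unfold EdgeRel; omega)
  -- a set with an element outside both p and q
  have three : ∀ a b c, s a → s b → s c → a ≠ b → a ≠ c → b ≠ c → False := by
    intro a b c ha hb hc
    have := hs a ha; have := hs b hb; have := hs c hc
    omega
  have hub : ∃ c, ∀ x, x < 2 * m + 1 → ¬ s x → (P x ↔ P c) := by
    by_cases hs0 : s 0
    · have hsm : ¬ s m := fun h => hne ⟨hs0, h⟩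
      refine ⟨m, fun x hx hsx => ?_⟩
      rcases Nat.lt_trichotomy x m with h | h | h
      · have hx0 : x ≠ 0 := by rintro rfl; exact hsx hs0
        by_cases hL : ∀ i, x ≤ i → i ≤ m → ¬ s i
        · exact seg' x m (by omega) (by omega) hL
        · push Not at hL
          obtain ⟨j, hj, hj', hsj⟩ := hL
          have hR : ∀ i, m ≤ i → i ≤ 2 * m - x → ¬ s i := by
            intro i hi hi' hsi
            have : j ≠ m := by rintro rfl; exact hsm hsj
            exact three 0 j i hs0 hsj hsi (by omega) (by omega) (by omega)
          rw [rung x (by omega) h hsx (hR _ (by omega) (by omega))]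
          exact (seg' m (2 * m - x) (by omega) (by omega) hR).symm
      · rw [h]
      · by_cases hx2 : x = 2 * m
        · subst hx2; exact (em2 hsm hsx).symm
        by_cases hL : ∀ i, m ≤ i → i ≤ x → ¬ s i
        · exact (seg' m x (by omega) (by omega) hL).symm
        · push Not at hL
          obtain ⟨j, hj, hj', hsj⟩ := hL
          have hR : ∀ i, 2 * m - x ≤ i → i ≤ m → ¬ s i := by
            intro i hi hi' hsi
            have : j ≠ m := by rintro rfl; exact hsm hsj
            exact three 0 j i hs0 hsj hsi (by omega) (by omega) (by omega)
          have hr := rung (2 * m - x) (by omega) (by omega) (hR _ (by omega) (by omega))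
          rw [show 2 * m - (2 * m - x) = x by omega] at hr
          rw [← hr hsx]
          exact seg' (2 * m - x) m (by omega) (by omega) hR
    · refine ⟨0, fun x hx hsx => ?_⟩
      rcases Nat.lt_trichotomy x m with h | h | h
      · by_cases hL : ∀ i, 0 ≤ i → i ≤ x → ¬ s i
        · exact (seg' 0 x (by omega) (by omega) hL).symm
        push Not at hL
        obtain ⟨j, -, hj', hsj⟩ := hL
        have hjx : j ≠ x := by rintro rfl; exact hsx hsj
        have hj0 : j ≠ 0 := by rintro rfl; exact hs0 hsj
        by_cases hL2 : ∀ i, x ≤ i → i ≤ m → ¬ s i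
        · rw [seg' x m (by omega) (by omega) hL2]
          exact (e0m hs0 (hL2 m (by omega) (by omega))).symm
        push Not at hL2
        obtain ⟨k, hk, hk', hsk⟩ := hL2
        have hkx : k ≠ x := by rintro rfl; exact hsx hsk
        have hR : ∀ i, 2 * m - x ≤ i → i < 2 * m → ¬ s i := by
          intro i hi hi' hsi
          exact three j k i hsj hsk hsi (by omega) (by omega) (by omega)
        rw [rung x (by omega) h hsx (hR _ (by omega) (by omega))]
        exact seg0 _ (by omega) (by omega) hs0 hR
      · subst h; exact (e0m hs0 hsx).symm
      · by_cases hx2 : x = 2 * m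
        · subst hx2; exact (e02 hs0 hsx).symm
        by_cases hL : ∀ i, x ≤ i → i < 2 * m → ¬ s i
        · exact seg0 x (by omega) (by omega) hs0 hL
        push Not at hL
        obtain ⟨j, hj, hj', hsj⟩ := hL
        have hjx : j ≠ x := by rintro rfl; exact hsx hsj
        by_cases hL2 : ∀ i, m ≤ i → i ≤ x → ¬ s i
        · rw [← seg' m x (by omega) (by omega) hL2]
          exact (e0m hs0 (hL2 m (by omega) (by omega))).symm
        push Not at hL2
        obtain ⟨k, hk, hk', hsk⟩ := hL2
        have hkx : k ≠ x := by rintro rfl; exact hsx hsk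
        have hR : ∀ i, 0 ≤ i → i ≤ 2 * m - x → ¬ s i := by
          intro i hi hi' hsi
          exact three j k i hsj hsk hsi (by omega) (by omega) (by omega)
        have hr := rung (2 * m - x) (by omega) (by omega) (hR _ (by omega) (by omega))
        rw [show 2 * m - (2 * m - x) = x by omega] at hr
        rw [← hr hsx]
        exact (seg' 0 (2 * m - x) (by omega) (by omega) hR).symm
  obtain ⟨c, hc⟩ := hub
  intro x y hx hy hsx hsy h
  exact (hc y hy hsy).2 ((hc x hx hsx).1 h)

/-- smaller endpoint of the k-th edge -/
def edgeA (m k : ℕ) : ℕ :=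
  if k < 2 * m - 1 then k else if k = 2 * m - 1 then 0 else if k < 3 * m - 1 then k - 2 * m + 1
  else if k = 3 * m - 1 then 0 else if k = 3 * m then 0 else m

/-- larger endpoint of the k-th edge -/
def edgeB (m k : ℕ) : ℕ :=
  if k < 2 * m - 1 then k + 1 else if k = 2 * m - 1 then 2 * m - 1
  else if k < 3 * m - 2 then 4 * m - k - 1
  else if k = 3 * m - 2 then m + 1
  else if k = 3 * m - 1 then m else 2 * m

lemma edge_rel (m : ℕ) (hm : 3 ≤ m) (k : ℕ) (hk : k < 3 * m + 2) :
    EdgeRel m (edgeA m k) (edgeB m k) := by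
  unfold EdgeRel edgeA edgeB
  split_ifs <;> omega

lemma edge_surj (m : ℕ) (hm : 3 ≤ m) (a b : ℕ) (h : EdgeRel m a b) :
    ∃ k, k < 3 * m + 2 ∧ edgeA m k = a ∧ edgeB m k = b := by
  unfold EdgeRel at h
  rcases h with h | h | h | h | h | h
  · exact ⟨a, by omega, by unfold edgeA; split_ifs <;> omega, by unfold edgeB; split_ifs <;> omega⟩
  · exact ⟨2 * m - 1, by omega, by unfold edgeA; split_ifs <;> omega,
      by unfold edgeB; split_ifs <;> omega⟩
  · exact ⟨3 * m - 1, by omega, by unfold edgeA; split_ifs <;> omega,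
      by unfold edgeB; split_ifs <;> omega⟩
  · exact ⟨3 * m, by omega, by unfold edgeA; split_ifs <;> omega,
      by unfold edgeB; split_ifs <;> omega⟩
  · exact ⟨3 * m + 1, by omega, by unfold edgeA; split_ifs <;> omega,
      by unfold edgeB; split_ifs <;> omega⟩
  · exact ⟨2 * m + a - 1, by omega, by unfold edgeA; split_ifs <;> omega,
      by unfold edgeB; split_ifs <;> omega⟩

lemma edge_inj (m : ℕ) (hm : 3 ≤ m) (k l : ℕ) (hk : k < 3 * m + 2) (hl : l < 3 * m + 2)
    (hA : edgeA m k = edgeA m l) (hB : edgeB m k = edgeB m l) : k = l := by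
  unfold edgeA at hA
  unfold edgeB at hB
  split_ifs at hA hB <;> omega

lemma edge_count (m : ℕ) (hm : 3 ≤ m) (G : SimpleGraph (Fin (2 * m + 1)))
    (hadj : ∀ a b : Fin (2 * m + 1), G.Adj a b ↔ EdgeRel m a b ∨ EdgeRel m b a) :
    G.edgeSet.ncard = 3 * m + 2 := by
  have hlt := fun k hk => edgeRel_lt hm (edge_rel m hm k hk)
  let f : (k : ℕ) → k < 3 * m + 2 → Sym2 (Fin (2 * m + 1)) := fun k hk =>
    s(⟨edgeA m k, by have := hlt k hk; omega⟩, ⟨edgeB m k, (hlt k hk).2⟩)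
  refine Set.ncard_eq_of_bijective f ?_ ?_ ?_
  · intro e he
    induction e using Sym2.ind with
    | _ a b =>
      rw [SimpleGraph.mem_edgeSet, hadj] at he
      rcases he with he | he
      · obtain ⟨k, hk, h1, h2⟩ := edge_surj m hm _ _ he
        refine ⟨k, hk, ?_⟩
        simp [f, h1, h2]
      · obtain ⟨k, hk, h1, h2⟩ := edge_surj m hm _ _ he
        refine ⟨k, hk, ?_⟩
        simp [f, h1, h2]
  · intro k hk
    rw [SimpleGraph.mem_edgeSet, hadj]
    exact Or.inl (edge_rel m hm k hk)
  · intro k l hk hl h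
    have h1 := hlt k hk
    have h2 := hlt l hl
    simp only [f, Sym2.eq_iff, Fin.mk.injEq] at h
    exact edge_inj m hm k l hk hl (by omega) (by omega)

lemma pre_conn (m : ℕ) (hm : 3 ≤ m) (G : SimpleGraph (Fin (2 * m + 1)))
    (hadj : ∀ a b : Fin (2 * m + 1), G.Adj a b ↔ EdgeRel m a b ∨ EdgeRel m b a)
    (S : Finset (Fin (2 * m + 1))) (p q : ℕ) (hS : ∀ x ∈ S, x.val = p ∨ x.val = q)
    (hne : ¬ ((⟨0, by omega⟩ : Fin (2 * m + 1)) ∈ S ∧ (⟨m, by omega⟩ : Fin (2 * m + 1)) ∈ S)) :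
    (G.induce ((S : Set (Fin (2 * m + 1)))ᶜ)).Preconnected := by
  intro u v
  let s : ℕ → Prop := fun x => ∃ h : x < 2 * m + 1, (⟨x, h⟩ : Fin (2 * m + 1)) ∈ S
  have hns : ∀ w : ((S : Set (Fin (2 * m + 1)))ᶜ : Set _), ¬ s w.1.val := by
    rintro ⟨w, hw⟩ ⟨_, h⟩
    exact hw h
  let P : ℕ → Prop := fun x => ∃ w, w.1.val = x ∧
    (G.induce ((S : Set (Fin (2 * m + 1)))ᶜ)).Reachable u w
  have := core m hm s p q (fun x ⟨h, hx⟩ => hS _ hx)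
    (fun ⟨⟨_, h1⟩, ⟨_, h2⟩⟩ => hne ⟨h1, h2⟩) P ?_ u.1.val v.1.val u.1.2 v.1.2 (hns u) (hns v)
    ⟨u, rfl, Reachable.refl _⟩
  · obtain ⟨w, hw, hr⟩ := this
    have : w = v := Subtype.ext (Fin.ext hw)
    rwa [this] at hr
  · intro a b hab ha hb
    have hl := edgeRel_lt hm hab
    have haS : (⟨a, by omega⟩ : Fin (2 * m + 1)) ∈ ((S : Set (Fin (2 * m + 1)))ᶜ) :=
      fun h => ha ⟨_, h⟩
    have hbS : (⟨b, hl.2⟩ : Fin (2 * m + 1)) ∈ ((S : Set (Fin (2 * m + 1)))ᶜ) :=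
      fun h => hb ⟨_, h⟩
    have hadj' : (G.induce ((S : Set (Fin (2 * m + 1)))ᶜ)).Adj ⟨_, haS⟩ ⟨_, hbS⟩ := by
      rw [SimpleGraph.comap_adj]
      exact (hadj _ _).2 (Or.inl hab)
    constructor
    · rintro ⟨w, hw, hr⟩
      have : w = ⟨_, haS⟩ := Subtype.ext (Fin.ext hw)
      subst this
      exact ⟨_, rfl, hr.trans hadj'.reachable⟩
    · rintro ⟨w, hw, hr⟩
      have : w = ⟨_, hbS⟩ := Subtype.ext (Fin.ext hw)
      subst this
      exact ⟨_, rfl, hr.trans hadj'.symm.reachable⟩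

lemma is_cut (m : ℕ) (hm : 3 ≤ m) (G : SimpleGraph (Fin (2 * m + 1)))
    (hadj : ∀ a b : Fin (2 * m + 1), G.Adj a b ↔ EdgeRel m a b ∨ EdgeRel m b a) :
    IsVertexCut G {⟨0, by omega⟩, ⟨m, by omega⟩} := by
  have h1 : (⟨1, by omega⟩ : Fin (2 * m + 1)) ∈
      (((({⟨0, by omega⟩, ⟨m, by omega⟩} : Finset (Fin (2 * m + 1)))) : Set _)ᶜ) := by
    simp; omega
  have h2 : (⟨2 * m, by omega⟩ : Fin (2 * m + 1)) ∈
      (((({⟨0, by omega⟩, ⟨m, by omega⟩} : Finset (Fin (2 * m + 1)))) : Set _)ᶜ) := by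
    simp; omega
  refine ⟨fun h => h1 (by rw [h]; trivial), fun h => ?_⟩
  obtain ⟨w⟩ := h.preconnected ⟨_, h2⟩ ⟨_, h1⟩
  obtain ⟨⟨v, hv⟩, hh, -, -⟩ := w.exists_eq_cons_of_ne (by
    intro h
    have := congrArg (fun z => z.1.val) h
    change 2 * m = 1 at this
    omega)
  rw [SimpleGraph.comap_adj] at hh
  have h3 : EdgeRel m (2 * m) v.val ∨ EdgeRel m v.val (2 * m) := (hadj _ _).1 hh
  have h4 : v.val ≠ 0 ∧ v.val ≠ m := by
    constructor
    · intro h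
      exact hv (by rw [show v = ⟨0, by omega⟩ from Fin.ext h]; simp)
    · intro h
      exact hv (by rw [show v = ⟨m, by omega⟩ from Fin.ext h]; simp)
  have := v.2
  unfold EdgeRel at h3
  omega

/-- For odd `n ≥ 7`, the graph `G_n` (a cycle `v_1 ⋯ v_{n-1} v_1` together
with a new vertex `v_n` and the edges `v_1 v_{(n+1)/2}`, `v_1 v_n`,
`v_{(n+1)/2} v_n` and `v_i v_{n+1-i}` for `2 ≤ i ≤ (n-1)/2`; here `v_i` is the
vertex `i - 1 : Fin n`) is connected, has order `n` and size `⌊3n/2⌋ + 1`, its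
unique minimum vertex cut is `{v_1, v_{(n+1)/2}}`, which induces an edge, and
hence it has no independent minimum vertex cut. -/
theorem G_n_odd_no_independent_minimum_vertex_cut
    (n : ℕ) (h7 : 7 ≤ n) (hodd : Odd n) (G : SimpleGraph (Fin n))
    (hG : G = SimpleGraph.fromRel (fun a b =>
        (a.val < n - 1 ∧ b.val < n - 1 ∧ b.val = (a.val + 1) % (n - 1)) ∨
        (a.val = 0 ∧ b.val = (n - 1) / 2) ∨
        (a.val = 0 ∧ b.val = n - 1) ∨
        (a.val = (n - 1) / 2 ∧ b.val = n - 1) ∨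
        (1 ≤ a.val ∧ a.val ≤ (n - 3) / 2 ∧ b.val = n - 1 - a.val))) :
    G.Connected ∧ Fintype.card (Fin n) = n ∧ G.edgeSet.ncard = 3 * n / 2 + 1 ∧
    (∀ S : Finset (Fin n), IsVertexCut G S → S.card = graphConnectivity G →
      S = {⟨0, by omega⟩, ⟨(n - 1) / 2, by omega⟩}) ∧
    G.Adj ⟨0, by omega⟩ ⟨(n - 1) / 2, by omega⟩ ∧
    ¬ ∃ S : Finset (Fin n), IsVertexCut G S ∧ S.card = graphConnectivity G ∧
      ∀ a ∈ S, ∀ b ∈ S, ¬ G.Adj a b := by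
  obtain ⟨m, rfl⟩ := hodd
  have hm : 3 ≤ m := by omega
  have hadj : ∀ a b : Fin (2 * m + 1), G.Adj a b ↔ EdgeRel m a b ∨ EdgeRel m b a := by
    intro a b
    have ha := a.2
    have hb := b.2
    rw [hG, SimpleGraph.fromRel_adj, rel_iff m hm _ _ ha hb, rel_iff m hm _ _ hb ha,
      Ne, Fin.ext_iff]
    constructor
    · rintro ⟨-, h | h⟩
      · exact edge_of_rel h
      · exact (edge_of_rel h).symm
    · rintro (h | h)
      · exact ⟨by have := edgeRel_lt hm h; omega, rel_of_edge h⟩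
      · exact ⟨by have := edgeRel_lt hm h; omega, (rel_of_edge h).symm⟩
  clear hG
  have hm2 : (2 * m + 1 - 1) / 2 = m := by omega
  simp only [hm2]
  have hcut := is_cut m hm G hadj
  have hk : graphConnectivity G ≤ 2 := by
    refine le_trans (Nat.sInf_le ?_) (Finset.card_le_two (a := (⟨0, by omega⟩ : Fin (2 * m + 1)))
      (b := ⟨m, by omega⟩))
    exact ⟨_, hcut, rfl⟩
  have h0m : G.Adj ⟨0, by omega⟩ ⟨m, by omega⟩ := (hadj _ _).2 (by simp [EdgeRel])
  have hun : ∀ S : Finset (Fin (2 * m + 1)), IsVertexCut G S → S.card = graphConnectivity G →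
      S = {⟨0, by omega⟩, ⟨m, by omega⟩} := by
    intro S hS hc
    have hc2 : S.card ≤ 2 := by omega
    by_cases hne : ((⟨0, by omega⟩ : Fin (2 * m + 1)) ∈ S ∧ (⟨m, by omega⟩ : Fin (2 * m + 1)) ∈ S)
    · symm
      apply Finset.eq_of_subset_of_card_le
      · intro x hx
        simp only [Finset.mem_insert, Finset.mem_singleton] at hx
        rcases hx with rfl | rfl
        · exact hne.1
        · exact hne.2
      · rw [Finset.card_pair (by simp [Fin.ext_iff]; omega)]
        exact hc2
    · exfalso
      have hpq : ∃ p q : ℕ, ∀ x ∈ S, x.val = p ∨ x.val = q := by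
        interval_cases h : S.card
        · rw [Finset.card_eq_zero] at h
          subst h
          exact ⟨0, 0, by simp⟩
        · obtain ⟨a, rfl⟩ := Finset.card_eq_one.1 h
          exact ⟨a, a, by simp⟩
        · obtain ⟨a, b, -, rfl⟩ := Finset.card_eq_two.1 h
          exact ⟨a, b, by simp [Fin.ext_iff]⟩
      obtain ⟨p, q, hpq⟩ := hpq
      apply hS.2
      obtain ⟨x, hx⟩ := (Set.ne_univ_iff_exists_notMem _).1 hS.1
      exact { preconnected := pre_conn m hm G hadj S p q hpq hne, nonempty := ⟨⟨x, hx⟩⟩ }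
  refine ⟨?_, by simp, ?_, hun, h0m, ?_⟩
  · have hp := pre_conn m hm G hadj ∅ 0 0 (by simp) (by simp)
    refine { preconnected := fun u v => ?_, nonempty := ⟨⟨0, by omega⟩⟩ }
    exact (hp ⟨u, by simp⟩ ⟨v, by simp⟩).map (SimpleGraph.Embedding.induce _).toHom
  · rw [edge_count m hm G hadj]; omega
  · rintro ⟨S, hS, hc, hi⟩
    have := hun S hS hc
    subst this
    exact hi _ (by simp) _ (by simp) h0m
end

section
/- Every connected finite simple graph of order 7 and size at most 14 with minimum degree 3 and connectivity 3 has a foresty minimum vertex cut, i.e., a vertex cut S with |S| = 3 such that the induced subgraph G[S] is a forest. -/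
open SimpleGraph

/-- Consequences of the cut condition for vertices `x, y, z` outside the closed neighbourhood
of a vertex of degree three with neighbours `p, q, r`. -/
def gB (xp xq xr yp yq yr zp zq zr xy xz yz : Bool) : Bool :=
  (xr || (xz || (yp && yq))) && ((xq || (xr || (yz && (yp && zp)))) &&
  ((xr || (yr || (zp && zq))) && ((xr || (yr || (xz || yz))) &&
  ((xq || (xr || (yq || yr))) && (xr || (yr || zr))))))

/-- The three cyclic rotations of `gB`. -/
def gAll (xp xq xr yp yq yr zp zq zr xy xz yz : Bool) : Bool :=
  gB xp xq xr yp yq yr zp zq zr xy xz yz && (gB xq xr xp yq yr yp zq zr zp xy xz yz &&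
    gB xr xp xq yr yp yq zr zp zq xy xz yz)

lemma bool_check : ∀ x1 x2 x3 y1 y2 y3 z1 z2 z3 xy xz yz : Bool,
    x1.toNat + x2.toNat + x3.toNat + y1.toNat + y2.toNat + y3.toNat + z1.toNat + z2.toNat
      + z3.toNat + xy.toNat + xz.toNat + yz.toNat ≤ 8 →
    3 ≤ x1.toNat + x2.toNat + x3.toNat + xy.toNat + xz.toNat →
    3 ≤ y1.toNat + y2.toNat + y3.toNat + xy.toNat + yz.toNat →
    3 ≤ z1.toNat + z2.toNat + z3.toNat + xz.toNat + yz.toNat →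
    gAll x1 x2 x3 y1 y2 y3 z1 z2 z3 xy xz yz = true →
    gAll x1 x2 x3 z1 z2 z3 y1 y2 y3 xz xy yz = true →
    gAll y1 y2 y3 x1 x2 x3 z1 z2 z3 xy yz xz = true →
    gAll y1 y2 y3 z1 z2 z3 x1 x2 x3 yz xy xz = true →
    gAll z1 z2 z3 x1 x2 x3 y1 y2 y3 xz yz xy = true →
    gAll z1 z2 z3 y1 y2 y3 x1 x2 x3 yz xz xy = true → False := by
  decide +kernel

/-- Every cut has at least three elements, and those with three elements are triangles. -/
def CutCond (A : Fin 7 → Fin 7 → Bool) : Prop :=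
  ∀ X T : Finset (Fin 7), (∃ i, i ∈ X ∧ i ∉ T) → (∃ k, k ∉ X ∧ k ∉ T) →
    (∀ i ∈ X, ∀ j, j ∉ X → j ∉ T → A i j = false) → 3 ≤ T.card ∧
    (T.card = 3 → ∀ i ∈ T, ∀ j ∈ T, i ≠ j → A i j = true)

lemma CutCond.three {A : Fin 7 → Fin 7 → Bool} (h : CutCond A) (X : Finset (Fin 7))
    (a b c x o : Fin 7) (hab : a ≠ b) (hac : a ≠ c) (hbc : b ≠ c)
    (hx : x ∈ X) (hx' : x ∉ ({a, b, c} : Finset (Fin 7)))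
    (ho : o ∉ X) (ho' : o ∉ ({a, b, c} : Finset (Fin 7)))
    (hsep : ∀ i ∈ X, ∀ j, j ∉ X → j ∉ ({a, b, c} : Finset (Fin 7)) → A i j = false) :
    A a b = true ∧ A a c = true ∧ A b c = true := by
  have h' := (h X {a, b, c} ⟨x, hx, hx'⟩ ⟨o, ho, ho'⟩ hsep).2
    (Finset.card_eq_three.2 ⟨a, b, c, hab, hac, hbc, rfl⟩)
  exact ⟨h' a (by simp) b (by simp) hab, h' a (by simp) c (by simp) hac,
    h' b (by simp) c (by simp) hbc⟩

lemma CutCond.two {A : Fin 7 → Fin 7 → Bool} (h : CutCond A) (X : Finset (Fin 7))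
    (a b x o : Fin 7)
    (hx : x ∈ X) (hx' : x ∉ ({a, b} : Finset (Fin 7)))
    (ho : o ∉ X) (ho' : o ∉ ({a, b} : Finset (Fin 7)))
    (hsep : ∀ i ∈ X, ∀ j, j ∉ X → j ∉ ({a, b} : Finset (Fin 7)) → A i j = false) : False := by
  have h' := (h X {a, b} ⟨x, hx, hx'⟩ ⟨o, ho, ho'⟩ hsep).1
  have := Finset.card_le_two (a := a) (b := b)
  omega

/-- `p, q, r, x, y, z` enumerate the nonzero elements. -/
def Good (p q r x y z : Fin 7) : Prop :=
  [0, p, q, r, x, y, z].Nodup ∧ ∀ j, j ∈ [0, p, q, r, x, y, z]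

instance (p q r x y z : Fin 7) : Decidable (Good p q r x y z) := by
  unfold Good; infer_instance

lemma gB_of_cut (A : Fin 7 → Fin 7 → Bool) (hK : CutCond A) (p q r x y z : Fin 7)
    (hx : A x 0 = false) (hy : A y 0 = false) (hz : A z 0 = false) (hg : Good p q r x y z) :
    gB (A x p) (A x q) (A x r) (A y p) (A y q) (A y r) (A z p) (A z q) (A z r)
      (A x y) (A x z) (A y z) = true := by
  obtain ⟨hnd, hc⟩ := hg
  simp only [List.nodup_cons, List.mem_cons, List.not_mem_nil, not_or, or_false, not_false_eq_true,
    List.nodup_nil, and_true] at hnd hc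
  obtain ⟨⟨n1, n2, n3, n4, n5, n6⟩, ⟨n7, n8, n9, n10, n11⟩, ⟨n12, n13, n14, n15⟩,
    ⟨n16, n17, n18⟩, ⟨n19, n20⟩, n21⟩ := hnd
  have m1 := Ne.symm n1
  have m2 := Ne.symm n2
  have m3 := Ne.symm n3
  have m4 := Ne.symm n4
  have m5 := Ne.symm n5
  have m6 := Ne.symm n6
  have m7 := Ne.symm n7
  have m8 := Ne.symm n8
  have m9 := Ne.symm n9
  have m10 := Ne.symm n10
  have m11 := Ne.symm n11
  have m12 := Ne.symm n12
  have m13 := Ne.symm n13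
  have m14 := Ne.symm n14
  have m15 := Ne.symm n15
  have m16 := Ne.symm n16
  have m17 := Ne.symm n17
  have m18 := Ne.symm n18
  have m19 := Ne.symm n19
  have m20 := Ne.symm n20
  have m21 := Ne.symm n21
  simp only [gB, Bool.and_eq_true, Bool.or_eq_true]
  refine ⟨?_, ?_, ?_, ?_, ?_, ?_⟩ <;> by_contra hn <;>
    simp only [not_or, Bool.not_eq_true] at hn
  · obtain ⟨e1, e2, e3⟩ := hn
    have := hK.three {x} y p q x 0 (by simp [*]) (by simp [*]) (by simp [*]) (by simp)
      (by simp [*]) (by simp [*]) (by simp [*]) (by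
      intro i hi j hj hj'
      simp only [Finset.mem_insert, Finset.mem_singleton, not_or] at hi hj hj'
      obtain ⟨f1, f2, f3⟩ := hj'
      rw [hi]
      rcases hc j with e | e | e | e | e | e | e <;> first | contradiction | (rw [e]; assumption))
    exact e3 ⟨this.1, this.2.1⟩
  · obtain ⟨e1, e2, e3⟩ := hn
    have := hK.three {x} y z p x 0 (by simp [*]) (by simp [*]) (by simp [*]) (by simp)
      (by simp [*]) (by simp [*]) (by simp [*]) (by
      intro i hi j hj hj'
      simp only [Finset.mem_insert, Finset.mem_singleton, not_or] at hi hj hj'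
      obtain ⟨f1, f2, f3⟩ := hj'
      rw [hi]
      rcases hc j with e | e | e | e | e | e | e <;> first | contradiction | (rw [e]; assumption))
    exact e3 this
  · obtain ⟨e1, e2, e3⟩ := hn
    have := hK.three {x, y} z p q x 0 (by simp [*]) (by simp [*]) (by simp [*]) (by simp)
      (by simp [*]) (by simp [*]) (by simp [*]) (by
      intro i hi j hj hj'
      simp only [Finset.mem_insert, Finset.mem_singleton, not_or] at hi hj hj'
      obtain ⟨f1, f2, f3⟩ := hj'
      obtain ⟨f4, f5⟩ := hj
      rcases hi with hi | hi <;> rw [hi] <;>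
      rcases hc j with e | e | e | e | e | e | e <;> first | contradiction | (rw [e]; assumption))
    exact e3 ⟨this.1, this.2.1⟩
  · obtain ⟨e1, e2, e3, e4⟩ := hn
    refine hK.two {x, y} p q x 0 (by simp) (by simp [*]) (by simp [*]) (by simp [*]) ?_
    intro i hi j hj hj'
    simp only [Finset.mem_insert, Finset.mem_singleton, not_or] at hi hj hj'
    obtain ⟨f1, f2⟩ := hj'
    obtain ⟨f4, f5⟩ := hj
    rcases hi with hi | hi <;> rw [hi] <;>
    rcases hc j with e | e | e | e | e | e | e <;> first | contradiction | (rw [e]; assumption)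
  · obtain ⟨e1, e2, e3, e4⟩ := hn
    refine hK.two {x, y} z p x 0 (by simp) (by simp [*]) (by simp [*]) (by simp [*]) ?_
    intro i hi j hj hj'
    simp only [Finset.mem_insert, Finset.mem_singleton, not_or] at hi hj hj'
    obtain ⟨f1, f2⟩ := hj'
    obtain ⟨f4, f5⟩ := hj
    rcases hi with hi | hi <;> rw [hi] <;>
    rcases hc j with e | e | e | e | e | e | e <;> first | contradiction | (rw [e]; assumption)
  · obtain ⟨e1, e2, e3⟩ := hn
    refine hK.two {x, y, z} p q x 0 (by simp) (by simp [*]) (by simp [*]) (by simp [*]) ?_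
    intro i hi j hj hj'
    simp only [Finset.mem_insert, Finset.mem_singleton, not_or] at hi hj hj'
    obtain ⟨f1, f2⟩ := hj'
    obtain ⟨f4, f5, f6⟩ := hj
    rcases hi with hi | hi | hi <;> rw [hi] <;>
    rcases hc j with e | e | e | e | e | e | e <;> first | contradiction | (rw [e]; assumption)

lemma gAll_of_cut (A : Fin 7 → Fin 7 → Bool) (hK : CutCond A) (x y z : Fin 7)
    (hx : A x 0 = false) (hy : A y 0 = false) (hz : A z 0 = false)
    (g1 : Good 1 2 3 x y z) (g2 : Good 2 3 1 x y z) (g3 : Good 3 1 2 x y z) :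
    gAll (A x 1) (A x 2) (A x 3) (A y 1) (A y 2) (A y 3) (A z 1) (A z 2) (A z 3)
      (A x y) (A x z) (A y z) = true := by
  rw [gAll, gB_of_cut A hK 1 2 3 x y z hx hy hz g1, gB_of_cut A hK 2 3 1 x y z hx hy hz g2,
    gB_of_cut A hK 3 1 2 x y z hx hy hz g3]
  rfl

lemma fin_check (A : Fin 7 → Fin 7 → Bool) (hs : ∀ i j, A i j = A j i) (hi : ∀ i, A i i = false)
    (h1 : A 0 1 = true) (h2 : A 0 2 = true) (h3 : A 0 3 = true)
    (h4 : A 0 4 = false) (h5 : A 0 5 = false) (h6 : A 0 6 = false)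
    (hd : ∀ i, 3 ≤ ∑ j, (A i j).toNat) (hsum : ∑ i, ∑ j, (A i j).toNat ≤ 28)
    (hK : CutCond A) : False := by
  obtain ⟨h12, h13, h23⟩ := hK.three {0} 1 2 3 0 4 (by decide) (by decide) (by decide)
    (by decide) (by decide) (by decide) (by decide) (by
      intro i hi0 j hj hj'
      rw [Finset.mem_singleton.1 hi0]
      fin_cases j <;> first
        | assumption
        | exact absurd hj (by decide)
        | exact absurd hj' (by decide))
  have d4 := hd 4
  have d5 := hd 5
  have d6 := hd 6
  simp only [Fin.sum_univ_seven] at d4 d5 d6 hsum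
  rw [hs 1 0, hs 2 0, hs 3 0, hs 4 0, hs 5 0, hs 6 0, hs 2 1, hs 3 1, hs 1 4, hs 1 5, hs 1 6,
    hs 3 2, hs 2 4, hs 2 5, hs 2 6, hs 3 4, hs 3 5, hs 3 6, hs 5 4, hs 6 4, hs 6 5] at hsum
  rw [hs 4 0] at d4
  rw [hs 5 0, hs 5 4] at d5
  rw [hs 6 0, hs 6 4, hs 6 5] at d6
  simp only [hi, h1, h2, h3, h4, h5, h6, h12, h13, h23, Bool.toNat_true, Bool.toNat_false]
    at d4 d5 d6 hsum
  rw [hs] at h4 h5 h6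
  have s1 := gAll_of_cut A hK 4 5 6 h4 h5 h6 (by decide) (by decide) (by decide)
  have s2 := gAll_of_cut A hK 4 6 5 h4 h6 h5 (by decide) (by decide) (by decide)
  have s3 := gAll_of_cut A hK 5 4 6 h5 h4 h6 (by decide) (by decide) (by decide)
  have s4 := gAll_of_cut A hK 5 6 4 h5 h6 h4 (by decide) (by decide) (by decide)
  have s5 := gAll_of_cut A hK 6 4 5 h6 h4 h5 (by decide) (by decide) (by decide)
  have s6 := gAll_of_cut A hK 6 5 4 h6 h5 h4 (by decide) (by decide) (by decide)
  rw [hs 6 5] at s2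
  rw [hs 5 4] at s3
  rw [hs 5 4, hs 6 4] at s4
  rw [hs 6 4, hs 6 5] at s5
  rw [hs 6 5, hs 6 4, hs 5 4] at s6
  exact bool_check (A 4 1) (A 4 2) (A 4 3) (A 5 1) (A 5 2) (A 5 3) (A 6 1) (A 6 2) (A 6 3)
    (A 4 5) (A 4 6) (A 5 6) (by omega) (by omega) (by omega) (by omega) s1 s2 s3 s4 s5 s6

lemma acyclic_of_three {V : Type*} [Fintype V] (G : SimpleGraph V) (hc : Fintype.card V = 3)
    (a b : V) (hab : a ≠ b) (hn : ¬ G.Adj a b) : G.IsAcyclic := by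
  classical
  intro u c hcyc
  have hl := hcyc.three_le_length
  have hnd := hcyc.support_nodup
  have hle := hnd.length_le_card
  rw [hc] at hle
  have hcov : ∀ x : V, x ∈ c.support.tail := by
    have : c.support.tail.toFinset = Finset.univ := by
      apply Finset.eq_univ_of_card
      rw [List.toFinset_card_of_nodup hnd, hc]
      simp at hle ⊢
      omega
    intro x
    rw [← List.mem_toFinset, this]; simp
  have ha := hcov a
  have hb := hcov b
  simp at hle
  match c, hl, hle, ha, hb with
  | .cons h1 (.cons h2 (.cons h3 .nil)), _, _, ha, hb =>
    simp at ha hb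
    have := h1.symm
    have := h2.symm
    have := h3.symm
    rcases ha with rfl | rfl | rfl <;> rcases hb with rfl | rfl | rfl <;> simp_all
  | .cons _ (.cons _ (.cons _ (.cons _ _))), _, hle, _, _ => simp at hle; omega

lemma cut_of_sep_s19 {V : Type*} [Fintype V] (G : SimpleGraph V) (S : Finset V) (X : Set V)
    (a b : V) (ha : a ∈ X) (haS : a ∉ S) (hb : b ∉ X) (hbS : b ∉ S)
    (h : ∀ x ∈ X, ∀ y, y ∉ X → G.Adj x y → y ∈ S) : IsVertexCut G S := by
  refine ⟨fun hS => haS (by have := Set.mem_univ a; rwa [← hS] at this), fun hcon => ?_⟩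
  obtain ⟨p⟩ := hcon.preconnected ⟨a, by simpa using haS⟩ ⟨b, by simpa using hbS⟩
  have key : ∀ (s t : ((S : Set V)ᶜ : Set V)) (_ : (G.induce ((S : Set V)ᶜ)).Walk s t),
      s.1 ∈ X → t.1 ∈ X := by
    intro s t p
    induction p with
    | nil => exact id
    | @cons u v w hadj _ ih =>
      intro hu
      apply ih
      by_contra hv
      exact v.2 (h u.1 hu v.1 hv (by simpa using hadj))
  exact hb (key _ _ p ha)

/-- Every connected graph of order 7, size at most 14, minimum degree 3 and
connectivity 3 has a foresty minimum vertex cut. -/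
theorem order_seven_foresty_minimum_vertex_cut
    {V : Type*} [Fintype V] (G : SimpleGraph V)
    (h7 : Fintype.card V = 7)
    (hconn : G.Connected)
    (hsize : G.edgeSet.ncard ≤ 14)
    (hdeg : ∀ v : V, 3 ≤ (G.neighborSet v).ncard)
    (hdeg' : ∃ v : V, (G.neighborSet v).ncard = 3)
    (hk : graphConnectivity G = 3) :
    ∃ S : Finset V, IsVertexCut G S ∧ S.card = 3 ∧
      (G.induce (S : Set V)).IsAcyclic := by
  classical
  by_contra hno
  have hmin : ∀ S : Finset V, IsVertexCut G S → 3 ≤ S.card := fun S hS => by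
    rw [← hk]; exact Nat.sInf_le ⟨S, hS, rfl⟩
  have htri : ∀ S : Finset V, IsVertexCut G S → S.card = 3 →
      ∀ a ∈ S, ∀ b ∈ S, a ≠ b → G.Adj a b := by
    intro S hS h3 a ha b hb hab
    by_contra hn
    refine hno ⟨S, hS, h3, acyclic_of_three _ (by simpa using h3) ⟨a, by simpa using ha⟩
      ⟨b, by simpa using hb⟩ (by simpa using hab) (by simpa using hn)⟩
  obtain ⟨v, hv⟩ := hdeg'
  obtain ⟨a, b, c, hab, hac, hbc, hN⟩ := Set.ncard_eq_three.1 hv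
  have hmem : ∀ x, G.Adj v x ↔ x = a ∨ x = b ∨ x = c := by
    intro x
    rw [← mem_neighborSet, hN]; simp
  have hva : G.Adj v a := by simp [hmem]
  have hvb : G.Adj v b := by simp [hmem]
  have hvc : G.Adj v c := by simp [hmem]
  have hcomp : (({v, a, b, c} : Finset V)ᶜ).card = 3 := by
    rw [Finset.card_compl, h7]
    rw [Finset.card_eq_of_equiv_fin (n := 4)]
    apply Finset.equivFinOfCardEq
    simp [hab, hac, hbc, hva.ne, hvb.ne, hvc.ne]
  obtain ⟨x, y, z, hxy, hxz, hyz, hC⟩ := Finset.card_eq_three.1 hcomp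
  have hx : x ∈ ({v, a, b, c} : Finset V)ᶜ := by rw [hC]; simp
  have hy : y ∈ ({v, a, b, c} : Finset V)ᶜ := by rw [hC]; simp
  have hz : z ∈ ({v, a, b, c} : Finset V)ᶜ := by rw [hC]; simp
  simp only [Finset.mem_compl, Finset.mem_insert, Finset.mem_singleton, not_or] at hx hy hz
  have hinj : Function.Injective ![v, a, b, c, x, y, z] := by
    have := hva.ne
    have := hvb.ne
    have := hvc.ne
    intro i j hij
    fin_cases i <;> fin_cases j <;> first | rfl | (exfalso; simp at hij; grind)
  have hbij : Function.Bijective ![v, a, b, c, x, y, z] :=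
    (Fintype.bijective_iff_injective_and_card _).2 ⟨hinj, by simp [h7]⟩
  let e : Fin 7 ≃ V := Equiv.ofBijective _ hbij
  have hdegsum : ∀ i, ∑ j, (decide (G.Adj (e i) (e j))).toNat = G.degree (e i) := by
    intro i
    rw [← G.card_neighborFinset_eq_degree, neighborFinset_eq_filter, Finset.card_filter,
      ← e.sum_comp]
    refine Finset.sum_congr rfl fun j _ => ?_
    by_cases h : G.Adj (e i) (e j) <;> simp [h]
  have hdegn : ∀ u, (G.neighborSet u).ncard = G.degree u := by
    intro u
    rw [← G.card_neighborFinset_eq_degree, ← Set.ncard_coe_finset, coe_neighborFinset]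
  refine fin_check (fun i j => decide (G.Adj (e i) (e j))) ?_ ?_ ?_ ?_ ?_ ?_ ?_ ?_ ?_ ?_ ?_
  · intro i j; simp [G.adj_comm]
  · intro i; simp
  · simpa [e] using hva
  · simpa [e] using hvb
  · simpa [e] using hvc
  · simp [e, hmem, hx]
  · simp [e, hmem, hy]
  · simp [e, hmem, hz]
  · intro i
    rw [hdegsum, ← hdegn]; exact hdeg _
  · simp only [hdegsum]
    rw [e.sum_comp (fun u => G.degree u), G.sum_degrees_eq_twice_card_edges,
      ← Set.ncard_coe_finset, coe_edgeFinset]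
    omega
  · rintro X T ⟨i0, hi0, hi0T⟩ ⟨k, hkX, hkT⟩ hsep
    have hcut : IsVertexCut G (T.map e.toEmbedding) := by
      refine cut_of_sep_s19 G _ (e '' (X : Set (Fin 7))) (e i0) (e k) ⟨i0, hi0, rfl⟩ ?_ ?_ ?_ ?_
      · simpa using hi0T
      · simpa using hkX
      · simpa using hkT
      · rintro _ ⟨i, hiX, rfl⟩ y hy hadj
        obtain ⟨j, rfl⟩ := e.surjective y
        have hjX : j ∉ X := by simpa using hy
        by_contra hjT
        have := hsep i hiX j hjX (by simpa using hjT)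
        simp [hadj] at this
    refine ⟨by simpa using hmin _ hcut, fun h3 i hi j hj hij => ?_⟩
    have := htri _ hcut (by simpa using h3) (e i) (by simpa using hi) (e j) (by simpa using hj)
      (by simpa using hij)
    simpa using this
end
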